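/- Let L = F_q with q = 2^n and let f ∈ L[x] be a polynomial of odd degree d such that d is not a Gold number 2^k+1 and not a Kasami-Welch number 2^{2k}−2^k+1 for any positive integer k. Then there exists N such that for all m ≥ N, the function induced by f on F_{q^m} is not APN; in particular f is not exceptional APN. -/

import Mathlib

open MvPolynomial

/-- A function `f : L → L` on a finite field is APN (almost perfect nonlinear) if
for all `a ≠ 0` and all `b`, the equation `f (x + a) + f x = b` has at most 2
solutions `x` (in characteristic 2, `+` and `-` coincide). -/
def IsAPN {L : Type} [Field L] [Fintype L] (f : L → L) : Prop :=
  ∀ a b : L, a ≠ 0 → Set.ncard {x : L | f (x + a) + f x = b} ≤ 2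

/-- `f ∈ L[x]` eventually fails to be APN on every extension `F_{q^m}` of `L = F_q`:
there is `N` such that for all `m ≥ N` and every extension `M` of `L` with
`|M| = q^m`, the function induced by `f` on `M` is not APN. -/
def NotAPNOnAllLargeExtensions {L : Type} [Field L] [Fintype L] (f : Polynomial L) : Prop :=
  ∃ N : ℕ, ∀ m : ℕ, N ≤ m → ∀ (M : Type) [Field M] [Fintype M], ∀ e : L →+* M,
    Fintype.card M = Fintype.card L ^ m →
      ¬ IsAPN (fun x => Polynomial.eval x (f.map e))

/-- `f ∈ L[x]` is exceptional APN if the induced function is APN on `L = F_q` and on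
infinitely many extensions `F_{q^m}` of `L`. -/
def IsExceptionalAPN {L : Type} [Field L] [Fintype L] (f : Polynomial L) : Prop :=
  IsAPN (fun x => Polynomial.eval x f) ∧
    {m : ℕ | ∀ (M : Type) [Field M] [Fintype M], ∀ e : L →+* M,
      Fintype.card M = Fintype.card L ^ m →
        IsAPN (fun x => Polynomial.eval x (f.map e))}.Infinite

open scoped Polynomial Polynomial.Bivariate

namespace PlaneCurve

section Homogenization

variable {k : Type*} [Field k]

/-- The coordinate function `x` in `k[x][y]`. -/
noncomputable abbrev xv : k[X][Y] := Polynomial.C Polynomial.X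

/-- The coordinate function `y` in `k[x][y]`. -/
noncomputable abbrev yv : k[X][Y] := Polynomial.X

/-- The constants of `k[x][y]`. -/
noncomputable abbrev cst (a : k) : k[X][Y] := Polynomial.C (Polynomial.C a)

/-- The homogenizing map `p(x, y) ↦ p(xT, yT)`. -/
noncomputable def hom : k[X][Y] →ₐ[k] Polynomial (k[X][Y]) :=
  Polynomial.aevalAeval (Polynomial.C xv * Polynomial.X) (Polynomial.C yv * Polynomial.X)

theorem algHom_ext_xy {A : Type*} [CommSemiring A] [Algebra k A] {f g : k[X][Y] →ₐ[k] A}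
    (hx : f xv = g xv) (hy : f yv = g yv) : f = g := by
  have : f.toRingHom = g.toRingHom := by
    refine Polynomial.ringHom_ext' (Polynomial.ringHom_ext' ?_ ?_) hy
    · ext a
      exact (f.commutes a).trans (g.commutes a).symm
    · exact hx
  exact AlgHom.ext fun p => congrArg (fun F : k[X][Y] →+* A => F p) this

/-- The monomial `x^i y^j`. -/
noncomputable abbrev mon (i j : ℕ) : k[X][Y] := xv ^ i * yv ^ j

theorem coeff_mon (i j a b : ℕ) :
    ((mon i j : k[X][Y]).coeff b).coeff a = if a = i ∧ b = j then 1 else 0 := by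
  rw [mon, xv, yv, ← Polynomial.C_pow, Polynomial.coeff_C_mul, Polynomial.coeff_X_pow]
  split_ifs with h1 h2 h2
  · simp [Polynomial.coeff_X_pow, h2.1]
  · simp only [mul_one, Polynomial.coeff_X_pow]
    rw [if_neg (by tauto)]
  · tauto
  · simp

theorem smul_mon_eq (c : k) (i j : ℕ) :
    c • (mon i j : k[X][Y]) = Polynomial.monomial j (Polynomial.monomial i c) := by
  ext b a
  rw [Polynomial.coeff_smul, Polynomial.coeff_smul, coeff_mon, Polynomial.coeff_monomial]
  split_ifs with h1 h2 h2
  · simp [h1.1]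
  · exact absurd h1.2.symm h2
  · rw [Polynomial.coeff_monomial, if_neg (by tauto)]
    simp
  · simp

@[elab_as_elim]
theorem mon_induction {motive : k[X][Y] → Prop} (p : k[X][Y])
    (add : ∀ p q, motive p → motive q → motive (p + q))
    (smul_mon : ∀ (c : k) (i j : ℕ), motive (c • mon i j)) : motive p := by
  induction p using Polynomial.induction_on' with
  | add p q hp hq => exact add p q hp hq
  | monomial n a =>
    induction a using Polynomial.induction_on' with
    | add p q hp hq => rw [map_add]; exact add _ _ hp hq
    | monomial m a => rw [← smul_mon_eq]; exact smul_mon _ _ _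

@[simp]
theorem hom_xv : hom (xv : k[X][Y]) = Polynomial.C xv * Polynomial.X := by
  simp [hom]

@[simp]
theorem hom_yv : hom (yv : k[X][Y]) = Polynomial.C yv * Polynomial.X := by
  simp [hom]

theorem hom_mon (i j : ℕ) :
    hom (mon i j : k[X][Y]) = Polynomial.monomial (i + j) (mon i j) := by
  rw [mon, map_mul, map_pow, map_pow, hom_xv, hom_yv, ← Polynomial.C_mul_X_pow_eq_monomial]
  simp only [map_mul, map_pow]
  ring

theorem coeff_hom (p : k[X][Y]) (n j i : ℕ) :
    (((hom p).coeff n).coeff j).coeff i = if i + j = n then (p.coeff j).coeff i else 0 := by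
  induction p using mon_induction with
  | add p q hp hq => simp only [map_add, Polynomial.coeff_add, hp, hq]; split_ifs <;> simp
  | smul_mon c a b =>
    rw [map_smul, hom_mon]
    simp only [Polynomial.coeff_smul, Polynomial.coeff_monomial, coeff_mon]
    split_ifs with h1 h2 h3 h3 h3 <;> simp [coeff_mon] <;> omega

theorem hom_injective : Function.Injective (hom : k[X][Y] → Polynomial (k[X][Y])) := by
  intro p q h
  ext j i
  have := coeff_hom p (i + j) j i
  rw [h, coeff_hom, if_pos rfl, if_pos rfl] at this
  exact this.symm

theorem hom_eq_zero {p : k[X][Y]} : hom p = 0 ↔ p = 0 :=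
  map_eq_zero_iff hom hom_injective

/-- The total degree. -/
noncomputable def tdeg (p : k[X][Y]) : ℕ := (hom p).natDegree

/-- The leading form. -/
noncomputable def top (p : k[X][Y]) : k[X][Y] := (hom p).leadingCoeff

theorem top_eq_zero {p : k[X][Y]} : top p = 0 ↔ p = 0 := by
  rw [top, Polynomial.leadingCoeff_eq_zero, hom_eq_zero]

theorem tdeg_le_iff {p : k[X][Y]} {n : ℕ} :
    tdeg p ≤ n ↔ ∀ i j, (p.coeff j).coeff i ≠ 0 → i + j ≤ n := by
  rw [tdeg, Polynomial.natDegree_le_iff_coeff_eq_zero]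
  constructor
  · intro h i j hij
    by_contra hlt
    have := coeff_hom p (i + j) j i
    rw [h _ (by omega), if_pos rfl] at this
    exact hij this.symm
  · intro h N hN
    ext j i
    rw [coeff_hom]
    split_ifs with hij
    · by_contra hne
      have := h i j hne
      omega
    · rfl

theorem natDegree_coeff_hom_le (p : k[X][Y]) (n : ℕ) :
    ((hom p).coeff n).natDegree ≤ p.natDegree := by
  rw [Polynomial.natDegree_le_iff_coeff_eq_zero]
  intro j hj
  ext i
  rw [coeff_hom, Polynomial.coeff_eq_zero_of_natDegree_lt hj]
  simp

theorem degree_coeff_hom_le (p : k[X][Y]) (n : ℕ) :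
    ((hom p).coeff n).degree ≤ p.degree := by
  by_cases hp : p = 0
  · simp [hp]
  · rw [Polynomial.degree_eq_natDegree hp]
    exact Polynomial.degree_le_of_natDegree_le (natDegree_coeff_hom_le p n)

theorem tdeg_mul {p q : k[X][Y]} (hp : p ≠ 0) (hq : q ≠ 0) :
    tdeg (p * q) = tdeg p + tdeg q := by
  rw [tdeg, map_mul, Polynomial.natDegree_mul (hom_eq_zero.not.2 hp) (hom_eq_zero.not.2 hq)]
  rfl

theorem tdeg_mul_le (p q : k[X][Y]) : tdeg (p * q) ≤ tdeg p + tdeg q := by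
  rw [tdeg, map_mul]; exact Polynomial.natDegree_mul_le

theorem tdeg_add_le {p q : k[X][Y]} {n : ℕ} (hp : tdeg p ≤ n) (hq : tdeg q ≤ n) :
    tdeg (p + q) ≤ n := by
  rw [tdeg, map_add]; exact Polynomial.natDegree_add_le_of_degree_le hp hq

theorem top_mul (p q : k[X][Y]) : top (p * q) = top p * top q := by
  rw [top, map_mul, Polynomial.leadingCoeff_mul]; rfl

theorem natDegree_le_tdeg (p : k[X][Y]) : p.natDegree ≤ tdeg p := by
  by_cases hp : p = 0
  · simp [hp]
  · have h : p.leadingCoeff ≠ 0 := Polynomial.leadingCoeff_ne_zero.2 hp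
    have := tdeg_le_iff.1 le_rfl p.leadingCoeff.natDegree p.natDegree
      (Polynomial.leadingCoeff_ne_zero.2 h)
    omega

/-- Monic in `y`, of total degree equal to the degree in `y`. -/
structure Good (u : k[X][Y]) : Prop where
  monic : u.Monic
  tdeg_le : tdeg u ≤ u.natDegree

theorem Good.tdeg_eq {u : k[X][Y]} (hu : Good u) : tdeg u = u.natDegree :=
  le_antisymm hu.tdeg_le (natDegree_le_tdeg u)

theorem Good.degree_top {u : k[X][Y]} (hu : Good u) : (top u).degree = u.degree := by
  apply le_antisymm (degree_coeff_hom_le u _)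
  rw [Polynomial.degree_eq_natDegree hu.monic.ne_zero]
  apply Polynomial.le_degree_of_ne_zero
  intro h
  have := coeff_hom u (tdeg u) u.natDegree 0
  rw [if_pos (by rw [hu.tdeg_eq, zero_add]), Polynomial.coeff_natDegree, hu.monic.leadingCoeff]
    at this
  change ((top u).coeff u.natDegree).coeff 0 = _ at this
  rw [show (top u).coeff u.natDegree = 0 from h] at this
  simp at this

theorem Good.of_dvd {g u : k[X][Y]} (hg : Good g) (hu : u.Monic) (h : u ∣ g) : Good u := by
  obtain ⟨v, rfl⟩ := h
  have hv : v.Monic := hu.of_mul_monic_left hg.monic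
  refine ⟨hu, ?_⟩
  have h1 := hg.tdeg_le
  rw [tdeg_mul hu.ne_zero hv.ne_zero, hu.natDegree_mul hv] at h1
  have := natDegree_le_tdeg v
  omega

theorem Good.tdeg_add_le {u v a b : k[X][Y]} (hu : Good u) (huv : IsRelPrime (top u) (top v))
    (hv : v ≠ 0) (hb : b ≠ 0) (hdeg : b.degree < u.degree) :
    tdeg b + tdeg v ≤ tdeg (a * u + b * v) := by
  by_contra! hlt
  have ha : hom a * hom u = -(hom (b * v) - hom (a * u + b * v)) := by
    rw [map_add, map_mul hom a u]; ring
  have hbv : (hom (a * u + b * v)).degree < (hom (b * v)).degree := by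
    apply Polynomial.degree_lt_degree
    change tdeg _ < tdeg _
    rwa [tdeg_mul hb hv]
  have hl := congrArg Polynomial.leadingCoeff ha
  rw [Polynomial.leadingCoeff_neg, Polynomial.leadingCoeff_sub_of_degree_lt hbv,
    Polynomial.leadingCoeff_mul] at hl
  change top a * top u = -top (b * v) at hl
  rw [top_mul] at hl
  have hd : top u ∣ top b := by
    apply huv.dvd_of_dvd_mul_right
    rw [← dvd_neg, ← hl]
    exact dvd_mul_left _ _
  refine hb (top_eq_zero.1 (Polynomial.eq_zero_of_dvd_of_degree_lt hd ?_))
  rw [hu.degree_top]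
  exact (degree_coeff_hom_le b _).trans_lt hdeg

theorem Good.tdeg_modByMonic_le {u : k[X][Y]} (hu : Good u) (p : k[X][Y]) :
    tdeg (p %ₘ u) ≤ tdeg p := by
  by_cases hb : p %ₘ u = 0
  · rw [hb]; simp [tdeg]
  · have := hu.tdeg_add_le (v := 1) (a := p /ₘ u) (b := p %ₘ u)
      (by simp [top, isRelPrime_one_right]) one_ne_zero hb
      (Polynomial.degree_modByMonic_lt _ hu.monic)
    rw [mul_one, mul_comm, add_comm (u * _), Polynomial.modByMonic_add_div] at this
    omega

end Homogenization

section Support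

variable (k : Type*) [Field k]

/-- The polynomials supported on `s`. -/
noncomputable def supp (s : Finset (ℕ × ℕ)) : Submodule k (k[X][Y]) where
  carrier := {p | ∀ i j, (p.coeff j).coeff i ≠ 0 → (i, j) ∈ s}
  add_mem' := by
    intro p q hp hq i j h
    by_contra hn
    rw [Polynomial.coeff_add, Polynomial.coeff_add, not_not.1 (mt (hp i j) hn),
      not_not.1 (mt (hq i j) hn)] at h
    simp at h
  zero_mem' := by intro i j h; simp at h
  smul_mem' := by
    intro c p hp i j h
    refine hp i j fun h0 => h ?_
    rw [Polynomial.coeff_smul, Polynomial.coeff_smul, h0, smul_zero]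

variable {k}

/-- A polynomial supported on `s` is given by its coefficients. -/
noncomputable def suppEquiv (s : Finset (ℕ × ℕ)) : supp k s ≃ₗ[k] (s → k) where
  toFun p := fun e => (p.1.coeff e.1.2).coeff e.1.1
  map_add' p q := by ext; simp
  map_smul' c p := by ext; simp
  invFun c := ⟨∑ e : s, c e • mon e.1.1 e.1.2, by
    refine Submodule.sum_mem _ fun e _ => Submodule.smul_mem _ _ fun i j h => ?_
    rw [coeff_mon] at h
    have : (i, j) = e.1 := by
      by_contra hne
      rw [if_neg (fun hh => hne (Prod.ext hh.1 hh.2))] at h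
      exact h rfl
    rw [this]; exact e.2⟩
  left_inv p := by
    ext j i
    simp only [Polynomial.finsetSum_coeff, Polynomial.coeff_smul, coeff_mon]
    by_cases h : (i, j) ∈ s
    · rw [Finset.sum_eq_single ⟨(i, j), h⟩]
      · simp
      · intro e _ he
        rw [if_neg, smul_zero]
        rintro ⟨h1, h2⟩
        exact he (Subtype.ext (Prod.ext h1.symm h2.symm))
      · simp
    · rw [not_not.1 (mt (p.2 i j) h)]
      apply Finset.sum_eq_zero
      intro e _
      rw [if_neg, smul_zero]
      rintro ⟨h1, h2⟩
      exact h (by rw [h1, h2]; exact e.2)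
  right_inv c := by
    ext e
    simp only [Polynomial.finsetSum_coeff, Polynomial.coeff_smul, coeff_mon]
    rw [Finset.sum_eq_single e]
    · simp
    · intro e' _ he
      rw [if_neg, smul_zero]
      rintro ⟨h1, h2⟩
      exact he (Subtype.ext (Prod.ext h1.symm h2.symm))
    · simp

instance (s : Finset (ℕ × ℕ)) : Module.Finite k (supp k s) :=
  Module.Finite.equiv (suppEquiv s).symm

instance (s : Finset (ℕ × ℕ)) : Module.Free k (supp k s) :=
  Module.Free.of_equiv (suppEquiv s).symm

theorem finrank_supp (s : Finset (ℕ × ℕ)) : Module.finrank k (supp k s) = s.card := by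
  rw [(suppEquiv s).finrank_eq, Module.finrank_fintype_fun_eq_card, Fintype.card_coe]

/-- The exponents `(i, j)` with `j < m` and `i + j < N`. -/
def tri (m N : ℕ) : Finset (ℕ × ℕ) :=
  ((Finset.range N) ×ˢ (Finset.range m)).filter fun e => e.1 + e.2 < N

theorem mem_tri {m N : ℕ} {e : ℕ × ℕ} : e ∈ tri m N ↔ e.2 < m ∧ e.1 + e.2 < N := by
  simp only [tri, Finset.mem_filter, Finset.mem_product, Finset.mem_range]
  omega

theorem card_tri (m N : ℕ) : (tri m N).card = ∑ j ∈ Finset.range m, (N - j) := by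
  rw [Finset.card_eq_sum_card_fiberwise (f := Prod.snd) (t := Finset.range m)]
  · refine Finset.sum_congr rfl fun j hj => ?_
    rw [← Finset.card_range (N - j)]
    refine Finset.card_nbij Prod.fst ?_ ?_ ?_
    · intro e he
      simp only [Finset.coe_filter, Set.mem_ofPred_eq, mem_tri] at he
      simp only [Finset.coe_range, Set.mem_Iio]
      omega
    · intro e he e' he' h
      simp only [Finset.coe_filter, Set.mem_ofPred_eq] at he he'
      exact Prod.ext h (he.2.trans he'.2.symm)
    · intro i hi
      simp only [Finset.coe_range, Set.mem_Iio] at hi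
      refine ⟨(i, j), ?_, rfl⟩
      simp only [Finset.coe_filter, Set.mem_ofPred_eq, mem_tri]
      simp only [Finset.mem_range] at hj
      exact ⟨⟨hj, by omega⟩, trivial⟩
  · intro e he
    simp only [Finset.mem_coe, mem_tri] at he
    simpa using he.1

theorem card_tri_add {m N s : ℕ} (h : m ≤ N) :
    (tri m (N + s)).card = (tri m N).card + m * s := by
  have : m * s = ∑ _j ∈ Finset.range m, s := by simp
  rw [card_tri, card_tri, this, ← Finset.sum_add_distrib]
  refine Finset.sum_congr rfl fun j hj => ?_
  have := Finset.mem_range.1 hj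
  omega

theorem card_tri_split (r N : ℕ) :
    (tri (r + N) (r + N)).card = (tri r (r + N)).card + (tri N N).card := by
  rw [card_tri, card_tri, card_tri, Finset.sum_range_add]
  congr 1
  refine Finset.sum_congr rfl fun j _ => by omega

theorem mem_supp_tri {m N : ℕ} {p : k[X][Y]} :
    p ∈ supp k (tri m N) ↔ p.degree < m ∧ (p = 0 ∨ tdeg p < N) := by
  constructor
  · intro h
    constructor
    · rw [Polynomial.degree_lt_iff_coeff_zero]
      intro j hj
      ext i
      by_contra hne
      have := (mem_tri.1 (h i j hne)).1
      simp only at this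
      omega
    · by_cases hp : p = 0
      · exact Or.inl hp
      · right
        obtain ⟨j, hj⟩ : ∃ j, p.coeff j ≠ 0 := by
          by_contra! hc; exact hp (Polynomial.ext (by simpa using hc))
        obtain ⟨i, hi⟩ : ∃ i, (p.coeff j).coeff i ≠ 0 := by
          by_contra! hc; exact hj (Polynomial.ext (by simpa using hc))
        have h1 := (mem_tri.1 (h i j hi)).2
        simp only at h1
        have : tdeg p ≤ N - 1 := tdeg_le_iff.2 fun i j hij => by
          have := (mem_tri.1 (h i j hij)).2
          simp only at this
          omega
        omega
  · rintro ⟨h1, h2⟩ i j hij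
    rcases h2 with rfl | h2
    · simp at hij
    · rw [mem_tri]
      refine ⟨?_, (tdeg_le_iff.1 le_rfl i j hij).trans_lt h2⟩
      by_contra hle
      rw [Polynomial.degree_lt_iff_coeff_zero] at h1
      rw [h1 j (not_lt.1 hle)] at hij
      simp at hij

end Support

theorem finrank_add_le_of_comp_eq_zero {k U V W : Type*} [Field k] [AddCommGroup U] [Module k U]
    [AddCommGroup V] [Module k V] [AddCommGroup W] [Module k W] [Module.Finite k V]
    (g : U →ₗ[k] V) (f : V →ₗ[k] W) (hg : Function.Injective g) (hfg : ∀ u, f (g u) = 0) :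
    Module.finrank k (LinearMap.range f) + Module.finrank k U ≤ Module.finrank k V := by
  rw [← LinearMap.finrank_range_add_finrank_ker f, ← LinearMap.finrank_range_of_inj hg]
  have : LinearMap.range g ≤ LinearMap.ker f := by
    rintro _ ⟨u, rfl⟩; exact hfg u
  have := Submodule.finrank_mono this
  omega

section Quotients

variable {k : Type*} [Field k]

theorem Good.mod_mem_supp {h p : k[X][Y]} (hh : Good h) {N : ℕ} (hN : tdeg p < N) :
    p %ₘ h ∈ supp k (tri h.natDegree N) := by
  rw [mem_supp_tri]
  refine ⟨?_, Or.inr ((hh.tdeg_modByMonic_le p).trans_lt hN)⟩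
  rw [← Polynomial.degree_eq_natDegree hh.monic.ne_zero]
  exact Polynomial.degree_modByMonic_lt _ hh.monic

theorem tdeg_lt_of_mem_supp_tri {m N : ℕ} {p : k[X][Y]} (hN : 0 < N) (hp : p ∈ supp k (tri m N)) :
    tdeg p < N := by
  rcases (mem_supp_tri.1 hp).2 with rfl | h
  · simpa [tdeg] using hN
  · exact h

theorem Good.card_le_of_linearIndependent {h A : k[X][Y]} (hh : Good h) (hirr : Irreducible h)
    (hA : ¬ h ∣ A) {a : ℕ} (ha : tdeg A ≤ a) {I : Ideal (k[X][Y])}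
    (hhI : h ∈ I) (hAI : A ∈ I) (s : Finset (k[X][Y] ⧸ I))
    (hs : LinearIndependent k (fun i : s => (i : k[X][Y] ⧸ I))) :
    s.card ≤ h.natDegree * a := by
  have hmod : ∀ p : k[X][Y], Ideal.Quotient.mk I (p %ₘ h) = Ideal.Quotient.mk I p := by
    intro p
    rw [Ideal.Quotient.mk_eq_mk_iff_sub_mem, Polynomial.modByMonic_eq_sub_mul_div,
      sub_sub_cancel_left]
    exact I.neg_mem (I.mul_mem_right _ hhI)
  choose lift hlift using Ideal.Quotient.mk_surjective (I := I)
  obtain ⟨N, hN, hsN⟩ : ∃ N, h.natDegree < N ∧ ∀ e ∈ s, tdeg (lift e) < N := by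
    refine ⟨s.sup (fun e => tdeg (lift e)) + 1 + h.natDegree, by omega, fun e he => ?_⟩
    have := Finset.le_sup (f := fun e => tdeg (lift e)) he
    omega
  let modh : k[X][Y] →ₗ[k] k[X][Y] := (Polynomial.modByMonicHom h).restrictScalars k
  let g : supp k (tri h.natDegree N) →ₗ[k] supp k (tri h.natDegree (N + a)) :=
    LinearMap.codRestrict _
      (modh ∘ₗ (LinearMap.mulRight k A) ∘ₗ (supp k (tri h.natDegree N)).subtype) fun b => by
        refine hh.mod_mem_supp ((tdeg_mul_le _ _).trans_lt ?_)
        have := tdeg_lt_of_mem_supp_tri (by omega) b.2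
        exact Nat.add_lt_add_of_lt_of_le this ha
  let f : supp k (tri h.natDegree (N + a)) →ₗ[k] k[X][Y] ⧸ I :=
    (Ideal.Quotient.mkₐ k I).toLinearMap ∘ₗ (supp k (tri h.natDegree (N + a))).subtype
  have hg : Function.Injective g := by
    rw [injective_iff_map_eq_zero]
    intro b hb
    have h1 : (b.1 * A) %ₘ h = 0 := congrArg Subtype.val hb
    rw [Polynomial.modByMonic_eq_zero_iff_dvd hh.monic] at h1
    have h2 : h ∣ b.1 := (hirr.prime.dvd_or_dvd h1).resolve_right hA
    have h3 := (mem_supp_tri.1 b.2).1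
    rw [← Polynomial.degree_eq_natDegree hh.monic.ne_zero] at h3
    exact Subtype.ext (Polynomial.eq_zero_of_dvd_of_degree_lt h2 h3)
  have hfg : ∀ b, f (g b) = 0 := by
    intro b
    change Ideal.Quotient.mk I ((b.1 * A) %ₘ h) = 0
    rw [hmod]
    exact Ideal.Quotient.eq_zero_iff_mem.2 (I.mul_mem_left _ hAI)
  have hfin := finrank_add_le_of_comp_eq_zero (k := k) (U := supp k _) (V := supp k _)
    (W := k[X][Y] ⧸ I) g f hg hfg
  rw [finrank_supp, finrank_supp, card_tri_add hN.le] at hfin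
  have hmem : ∀ e ∈ s, e ∈ LinearMap.range f := by
    intro e he
    have hlt : tdeg (lift e) < N + a := (hsN e he).trans_le (by omega)
    exact ⟨⟨lift e %ₘ h, hh.mod_mem_supp hlt⟩, (hmod _).trans (hlift e)⟩
  have hli : LinearIndependent k (fun i : s => (⟨i, hmem i i.2⟩ : LinearMap.range f)) :=
    LinearIndependent.of_comp (LinearMap.range f).subtype hs
  have := hli.fintype_card_le_finrank
  rw [Fintype.card_coe] at this
  omega

theorem Good.finite_quotient {h A : k[X][Y]} (hh : Good h) (hirr : Irreducible h)
    (hA : ¬ h ∣ A) : Module.Finite k (k[X][Y] ⧸ Ideal.span {h, A}) := by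
  apply Module.rank_lt_aleph0_iff.1
  exact (rank_le (hh.card_le_of_linearIndependent hirr hA le_rfl
    (Ideal.subset_span (by simp)) (Ideal.subset_span (by simp)))).trans_lt
    (Cardinal.natCast_lt_aleph0)

theorem Good.finrank_quotient_le {h A : k[X][Y]} (hh : Good h) (hirr : Irreducible h)
    (hA : ¬ h ∣ A) {a : ℕ} (ha : tdeg A ≤ a) :
    Module.finrank k (k[X][Y] ⧸ Ideal.span {h, A}) ≤ h.natDegree * a :=
  Module.finrank_le_of_rank_le (rank_le (hh.card_le_of_linearIndependent hirr hA ha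
    (Ideal.subset_span (by simp)) (Ideal.subset_span (by simp))))

/-- Elimination of `y` between `h` and `A`. -/
theorem Good.exists_eliminant {h A : k[X][Y]} (hh : Good h) (hirr : Irreducible h)
    (hA : ¬ h ∣ A) {a : ℕ} (ha : tdeg A ≤ a) :
    ∃ r : k[X], r ≠ 0 ∧ r.natDegree ≤ h.natDegree * a ∧
      ∃ b c : k[X][Y], Polynomial.C r = b * h + c * A := by
  have := hh.finite_quotient hirr hA
  set I := Ideal.span {h, A} with hI
  set n := h.natDegree * a
  let f : Polynomial.degreeLT k (n + 1) →ₗ[k] k[X][Y] ⧸ I :=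
    (Ideal.Quotient.mkₐ k I).toLinearMap ∘ₗ
      ((Algebra.linearMap k[X] k[X][Y]).restrictScalars k) ∘ₗ
        (Polynomial.degreeLT k (n + 1)).subtype
  have hker : ∃ r, f r = 0 ∧ r ≠ 0 := by
    by_contra! hc
    have hinj : Function.Injective f := (injective_iff_map_eq_zero f).2 hc
    have h1 := LinearMap.finrank_le_finrank_of_injective hinj
    rw [(Polynomial.degreeLTEquiv k (n + 1)).finrank_eq, Module.finrank_fin_fun] at h1
    have h2 : Module.finrank k (k[X][Y] ⧸ I) ≤ n := hh.finrank_quotient_le hirr hA ha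
    omega
  obtain ⟨r, hr, hr0⟩ := hker
  refine ⟨r.1, fun h0 => hr0 (Subtype.ext h0), ?_, ?_⟩
  · have := Polynomial.mem_degreeLT.1 r.2
    exact Polynomial.natDegree_le_of_degree_le (Order.lt_succ_iff.1 (by exact_mod_cast this))
  · have : (Polynomial.C r.1 : k[X][Y]) ∈ I := Ideal.Quotient.eq_zero_iff_mem.1 hr
    obtain ⟨b, c, hbc⟩ := Ideal.mem_span_pair.1 this
    exact ⟨b, c, hbc.symm⟩

/-- Evaluation at a point as an algebra homomorphism. -/
noncomputable def ev (P : k × k) : k[X][Y] →ₐ[k] k := Polynomial.aevalAeval P.1 P.2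

@[simp]
theorem ev_xv (P : k × k) : ev P (xv : k[X][Y]) = P.1 := by simp [ev]

@[simp]
theorem ev_yv (P : k × k) : ev P (yv : k[X][Y]) = P.2 := by simp [ev]

theorem ev_C (P : k × k) (r : k[X]) : ev P (Polynomial.C r) = r.eval P.1 := by
  simp [ev, Polynomial.aeval_def]

theorem ev_cst (P : k × k) (a : k) : ev P (cst a) = a := by
  rw [ev_C, Polynomial.eval_C]

theorem exists_interpolation [DecidableEq (k × k)] (S : Finset (k × k)) (P : k × k) :
    ∃ p : k[X][Y], ev P p = 1 ∧ ∀ Q ∈ S, Q ≠ P → ev Q p = 0 := by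
  have hsep : ∀ Q : k × k, ∃ p : k[X][Y], Q ≠ P → ev P p = 1 ∧ ev Q p = 0 := by
    intro Q
    by_cases h1 : Q.1 = P.1
    · by_cases h2 : Q.2 = P.2
      · exact ⟨0, fun h => absurd (Prod.ext h1 h2) h⟩
      · refine ⟨(yv - cst Q.2) * cst (P.2 - Q.2)⁻¹, fun _ => ?_⟩
        have : P.2 - Q.2 ≠ 0 := sub_ne_zero.2 (Ne.symm h2)
        constructor
        · rw [map_mul, map_sub, ev_yv, ev_cst, ev_cst, mul_inv_cancel₀ this]
        · rw [map_mul, map_sub, ev_yv, ev_cst, sub_self, zero_mul]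
    · refine ⟨(xv - cst Q.1) * cst (P.1 - Q.1)⁻¹, fun _ => ?_⟩
      have : P.1 - Q.1 ≠ 0 := sub_ne_zero.2 (Ne.symm h1)
      constructor
      · rw [map_mul, map_sub, ev_xv, ev_cst, ev_cst, mul_inv_cancel₀ this]
      · rw [map_mul, map_sub, ev_xv, ev_cst, sub_self, zero_mul]
  choose p hp using hsep
  refine ⟨∏ Q ∈ S.erase P, p Q, ?_, ?_⟩
  · rw [map_prod]
    exact Finset.prod_eq_one fun Q hQ => (hp Q (Finset.ne_of_mem_erase hQ)).1
  · intro Q hQ hne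
    rw [map_prod]
    exact Finset.prod_eq_zero (Finset.mem_erase.2 ⟨hne, hQ⟩) (hp Q hne).2

theorem Good.card_zeros_le {h A : k[X][Y]} (hh : Good h) (hirr : Irreducible h)
    (hA : ¬ h ∣ A) {a : ℕ} (ha : tdeg A ≤ a) (S : Finset (k × k))
    (hS : ∀ P ∈ S, ev P h = 0 ∧ ev P A = 0) : S.card ≤ h.natDegree * a := by
  classical
  have := hh.finite_quotient hirr hA
  set I := Ideal.span {h, A} with hI
  let e : k[X][Y] →ₐ[k] (S → k) := AlgHom.pi fun P => ev P.1
  have he : ∀ p ∈ I, e p = 0 := by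
    intro p hp
    obtain ⟨b, c, rfl⟩ := Ideal.mem_span_pair.1 hp
    ext P
    change ev P.1 (b * h + c * A) = 0
    rw [map_add, map_mul, map_mul, (hS P.1 P.2).1, (hS P.1 P.2).2]
    simp
  let f : (k[X][Y] ⧸ I) →ₐ[k] (S → k) := Ideal.Quotient.liftₐ I e he
  have hf : Function.Surjective f := by
    intro c
    choose p hp using fun P : S => exists_interpolation S P.1
    refine ⟨Ideal.Quotient.mk I (∑ P : S, c P • p P), ?_⟩
    change e _ = c
    ext Q
    change ev Q.1 (∑ P : S, c P • p P) = c Q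
    rw [map_sum, Finset.sum_eq_single Q]
    · rw [map_smul, (hp Q).1, smul_eq_mul, mul_one]
    · intro P _ hPQ
      rw [map_smul, (hp P).2 Q.1 Q.2 (fun h => hPQ (Subtype.ext h.symm)), smul_zero]
    · simp
  have h1 := LinearMap.finrank_le_finrank_of_surjective (f := f.toLinearMap) hf
  rw [Module.finrank_fintype_fun_eq_card, Fintype.card_coe] at h1
  exact h1.trans (hh.finrank_quotient_le hirr hA ha)

end Quotients

section LocalBound

variable {k : Type*} [Field k]

theorem mem_pow_of_coeff {p : k[X][Y]} {N : ℕ}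
    (hp : ∀ i j, i + j < N → (p.coeff j).coeff i = 0) :
    p ∈ Ideal.span {(xv : k[X][Y]), yv} ^ N := by
  rw [p.as_sum_support]
  refine Ideal.sum_mem _ fun j _ => ?_
  rw [(p.coeff j).as_sum_support, map_sum]
  refine Ideal.sum_mem _ fun i hi => ?_
  rw [← smul_mon_eq]
  have hij : N ≤ i + j := by
    by_contra! hlt
    exact Polynomial.mem_support_iff.1 hi (hp i j hlt)
  refine Submodule.smul_of_tower_mem _ _ (Ideal.pow_le_pow_right hij ?_)
  rw [Ideal.IsTwoSided.pow_add]
  exact Ideal.mul_mem_mul (Ideal.pow_mem_pow (Ideal.subset_span (by simp)) i)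
    (Ideal.pow_mem_pow (Ideal.subset_span (by simp)) j)

/-- Dropping the terms of degree at least `N`. -/
noncomputable def trunc (N : ℕ) : k[X][Y] →ₗ[k] supp k (tri N N) :=
  (suppEquiv (tri N N)).symm.toLinearMap ∘ₗ
    LinearMap.pi fun e => (Polynomial.lcoeff k e.1.1) ∘ₗ
      (Polynomial.lcoeff k[X] e.1.2).restrictScalars k

theorem coeff_trunc (N : ℕ) (p : k[X][Y]) {i j : ℕ} (h : i + j < N) :
    (((trunc N p).1).coeff j).coeff i = (p.coeff j).coeff i := by
  have h1 : suppEquiv (tri N N) (trunc N p) = fun e => (p.coeff e.1.2).coeff e.1.1 := by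
    rw [trunc, LinearMap.comp_apply]
    exact (suppEquiv (tri N N)).apply_symm_apply _
  exact congrFun h1 ⟨(i, j), mem_tri.2 ⟨by simp; omega, h⟩⟩

theorem sub_trunc_mem (N : ℕ) (p : k[X][Y]) :
    p - (trunc N p).1 ∈ Ideal.span {(xv : k[X][Y]), yv} ^ N := by
  refine mem_pow_of_coeff fun i j hij => ?_
  rw [Polynomial.coeff_sub, Polynomial.coeff_sub, coeff_trunc N p hij, sub_self]

theorem coeff_hom_of_trunc_eq_zero {N : ℕ} {p : k[X][Y]} (h : trunc N p = 0) {n : ℕ} (hn : n < N) :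
    (hom p).coeff n = 0 := by
  ext j i
  rw [coeff_hom]
  split_ifs with hij
  · rw [← coeff_trunc N p (by omega), h]; simp
  · simp

theorem coeff_hom_eq_zero {m N : ℕ} {p : k[X][Y]} (hp : p ∈ supp k (tri m N)) {n : ℕ}
    (hn : N ≤ n) : (hom p).coeff n = 0 := by
  by_cases h0 : p = 0
  · simp [h0]
  · exact Polynomial.coeff_eq_zero_of_natDegree_lt
      (((mem_supp_tri.1 hp).2.resolve_left h0).trans_le hn)

theorem finrank_local_le_of_X_pow_dvd {u v : k[X][Y]} {r s N : ℕ} (hr : Polynomial.X ^ r ∣ hom u)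
    (hs : Polynomial.X ^ s ∣ hom v) (hrel : IsRelPrime ((hom u).coeff r) ((hom v).coeff s))
    (hdeg : (((hom u).coeff r).coeff r).coeff 0 ≠ 0) :
    Module.finrank k (k[X][Y] ⧸ (Ideal.span {u, v} ⊔ Ideal.span {(xv : k[X][Y]), yv} ^ (r + s + N)))
      ≤ r * s := by
  obtain ⟨u', hu'⟩ := hr
  obtain ⟨v', hv'⟩ := hs
  set M := r + s + N with hM
  set I := Ideal.span {u, v} ⊔ Ideal.span {(xv : k[X][Y]), yv} ^ M with hI
  have hru : (hom u).coeff r = u'.coeff 0 := by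
    rw [hu']; simpa using Polynomial.coeff_X_pow_mul u' r 0
  have hsv : (hom v).coeff s = v'.coeff 0 := by
    rw [hv']; simpa using Polynomial.coeff_X_pow_mul v' s 0
  rw [hru] at hdeg
  rw [hru, hsv] at hrel
  have hu0 : u'.coeff 0 ≠ 0 := fun h => hdeg (by simp [h])
  have hudeg : (r : WithBot ℕ) ≤ (u'.coeff 0).degree :=
    Polynomial.le_degree_of_ne_zero fun h => hdeg (by simp [h])
  let f : supp k (tri M M) →ₗ[k] k[X][Y] ⧸ I :=
    (Ideal.Quotient.mkₐ k I).toLinearMap ∘ₗ (supp k (tri M M)).subtype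
  have hft : ∀ p, f (trunc M p) = Ideal.Quotient.mk I p := by
    intro p
    refine (Ideal.Quotient.mk_eq_mk_iff_sub_mem _ _).2 ?_
    rw [← neg_sub]
    exact I.neg_mem ((le_sup_right : _ ≤ I) (sub_trunc_mem M p))
  have hf : Function.Surjective f := by
    intro q
    obtain ⟨p, rfl⟩ := Ideal.Quotient.mk_surjective q
    exact ⟨_, hft p⟩
  let g : (supp k (tri (s + N) (s + N)) × supp k (tri r (r + N))) →ₗ[k] supp k (tri M M) :=
    trunc M ∘ₗ ((LinearMap.mulRight k u ∘ₗ (supp k _).subtype).coprod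
      (LinearMap.mulRight k v ∘ₗ (supp k _).subtype))
  have hgdef : ∀ a, g a = trunc M (a.1.1 * u + a.2.1 * v) := fun a => rfl
  have hg : Function.Injective g := by
    rw [injective_iff_map_eq_zero]
    rintro ⟨a, b⟩ hab
    rw [hgdef] at hab
    have key : ∀ n, n < M → (Polynomial.X ^ r * hom a.1).coeff n = 0 ∧
        (Polynomial.X ^ s * hom b.1).coeff n = 0 := by
      intro n
      induction n using Nat.strong_induction_on with
      | _ n ih =>
      intro hn
      have h0 := coeff_hom_of_trunc_eq_zero hab hn
      have hlow : ∀ (A w : Polynomial (k[X][Y])), (∀ m < n, A.coeff m = 0) →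
          (A * w).coeff n = A.coeff n * w.coeff 0 := by
        intro A w hA
        rw [Polynomial.coeff_mul, Finset.sum_eq_single (n, 0)]
        · rintro ⟨i, j⟩ hij hne
          have hij := Finset.HasAntidiagonal.mem_antidiagonal.1 hij
          simp only at hij
          rw [hA i, zero_mul]
          by_contra hle
          exact hne (Prod.ext (by simp; omega) (by simp; omega))
        · intro h; exact absurd (Finset.HasAntidiagonal.mem_antidiagonal.2 (by simp)) h
      have h1 := hlow (Polynomial.X ^ r * hom a.1) u' fun m hm => (ih m hm (hm.trans hn)).1
      have h2 := hlow (Polynomial.X ^ s * hom b.1) v' fun m hm => (ih m hm (hm.trans hn)).2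
      have h3 : hom (a.1 * u + b.1 * v) =
          Polynomial.X ^ r * hom a.1 * u' + Polynomial.X ^ s * hom b.1 * v' := by
        rw [map_add, map_mul, map_mul, hu', hv']; ring
      rw [h3, Polynomial.coeff_add, h1, h2] at h0
      have hdvd : u'.coeff 0 ∣ (Polynomial.X ^ s * hom b.1).coeff n := by
        apply hrel.dvd_of_dvd_mul_right
        exact (dvd_add_right (dvd_mul_left _ _)).1 (h0 ▸ dvd_zero _)
      have hb0 : (Polynomial.X ^ s * hom b.1).coeff n = 0 := by
        refine Polynomial.eq_zero_of_dvd_of_degree_lt hdvd (lt_of_lt_of_le ?_ hudeg)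
        rw [Polynomial.coeff_X_pow_mul']
        split_ifs
        · exact (degree_coeff_hom_le _ _).trans_lt (mem_supp_tri.1 b.2).1
        · simp
      rw [hb0, zero_mul, add_zero] at h0
      exact ⟨(mul_eq_zero.1 h0).resolve_right hu0, hb0⟩
    have ha : hom a.1 = 0 := by
      ext1 n
      by_cases hn : n + r < M
      · simpa [Polynomial.coeff_X_pow_mul] using (key (n + r) hn).1
      · exact coeff_hom_eq_zero a.2 (by omega)
    have hb : hom b.1 = 0 := by
      ext1 n
      by_cases hn : n + s < M
      · simpa [Polynomial.coeff_X_pow_mul] using (key (n + s) hn).2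
      · exact coeff_hom_eq_zero b.2 (by omega)
    exact Prod.ext (Subtype.ext (hom_eq_zero.1 ha)) (Subtype.ext (hom_eq_zero.1 hb))
  have hfg : ∀ a, f (g a) = 0 := by
    intro a
    rw [hgdef, hft]
    refine Ideal.Quotient.eq_zero_iff_mem.2 ((le_sup_left : _ ≤ I) ?_)
    exact Ideal.mem_span_pair.2 ⟨_, _, rfl⟩
  have hfin := finrank_add_le_of_comp_eq_zero (k := k)
    (U := supp k (tri (s + N) (s + N)) × supp k (tri r (r + N))) (V := supp k (tri M M))
    (W := k[X][Y] ⧸ I) g f hg hfg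
  rw [LinearMap.range_eq_top.2 hf, finrank_top, Module.finrank_prod, finrank_supp, finrank_supp,
    finrank_supp, hM, add_assoc, card_tri_split r (s + N)] at hfin
  have := card_tri_add (m := r) (N := r + N) (s := s) (by omega)
  rw [show r + N + s = r + (s + N) by ring] at this
  omega

theorem pow_span_le {u v : k[X][Y]} {N M : ℕ} (h : N ≤ M) :
    Ideal.span {u, v} ⊔ Ideal.span {(xv : k[X][Y]), yv} ^ M ≤
      Ideal.span {u, v} ⊔ Ideal.span {(xv : k[X][Y]), yv} ^ N :=
  sup_le_sup_left (Ideal.pow_le_pow_right h) _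

instance finite_quotient_sup_pow (J : Ideal (k[X][Y])) (N : ℕ) :
    Module.Finite k (k[X][Y] ⧸ (J ⊔ Ideal.span {(xv : k[X][Y]), yv} ^ N)) := by
  set I := J ⊔ Ideal.span {(xv : k[X][Y]), yv} ^ N with hI
  refine Module.Finite.of_surjective
    ((Ideal.Quotient.mkₐ k I).toLinearMap ∘ₗ (supp k (tri N N)).subtype) fun q => ?_
  obtain ⟨p, rfl⟩ := Ideal.Quotient.mk_surjective q
  refine ⟨trunc N p, (Ideal.Quotient.mk_eq_mk_iff_sub_mem _ _).2 ?_⟩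
  rw [← neg_sub]
  exact I.neg_mem ((le_sup_right : _ ≤ I) (sub_trunc_mem N p))

theorem not_isUnit_xv : ¬ IsUnit (xv : k[X][Y]) := by
  intro h
  have := h.map (ev ((0 : k), (0 : k)))
  simp at this

/-- If the initial forms of `u` and `v` at the origin are relatively prime, the local intersection
number of `u` and `v` there is at most the product of their multiplicities. -/
theorem finrank_local_le {u v : k[X][Y]} {r s : ℕ} (hr : Polynomial.X ^ r ∣ hom u)
    (hs : Polynomial.X ^ s ∣ hom v) (hrel : IsRelPrime ((hom u).coeff r) ((hom v).coeff s))
    (N : ℕ) :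
    Module.finrank k (k[X][Y] ⧸ (Ideal.span {u, v} ⊔ Ideal.span {(xv : k[X][Y]), yv} ^ N))
      ≤ r * s := by
  have hle : Module.finrank k
      (k[X][Y] ⧸ (Ideal.span {u, v} ⊔ Ideal.span {(xv : k[X][Y]), yv} ^ N)) ≤
      Module.finrank k
      (k[X][Y] ⧸ (Ideal.span {u, v} ⊔ Ideal.span {(xv : k[X][Y]), yv} ^ (r + s + N))) := by
    refine LinearMap.finrank_le_finrank_of_surjective
      (f := (Ideal.Quotient.factorₐ k (pow_span_le (u := u) (v := v)
        (show N ≤ r + s + N by omega))).toLinearMap) ?_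
    exact Ideal.Quotient.factor_surjective (pow_span_le (show N ≤ r + s + N by omega))
  refine hle.trans ?_
  have hx : ∀ (w : k[X][Y]) (t : ℕ), (((hom w).coeff t).coeff t).coeff 0 = 0 →
      xv ∣ (hom w).coeff t := by
    intro w t h
    rw [xv, Polynomial.C_dvd_iff_dvd_coeff]
    intro j
    rw [Polynomial.X_dvd_iff, coeff_hom]
    split_ifs with hj
    · rw [coeff_hom, if_pos (by omega)] at h
      rw [← h, ← hj, zero_add]
    · rfl
  by_cases h1 : (((hom u).coeff r).coeff r).coeff 0 = 0
  · by_cases h2 : (((hom v).coeff s).coeff s).coeff 0 = 0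
    · exact absurd (hrel (hx u r h1) (hx v s h2)) not_isUnit_xv
    · rw [Ideal.span_pair_comm, mul_comm, add_comm r]
      exact finrank_local_le_of_X_pow_dvd hs hr hrel.symm h2
  · exact finrank_local_le_of_X_pow_dvd hr hs hrel h1

/-- The translation `x ↦ x + α`, `y ↦ y + β`. -/
noncomputable def shift (P : k × k) : k[X][Y] →ₐ[k] k[X][Y] :=
  Polynomial.aevalAeval (xv + cst P.1) (yv + cst P.2)

@[simp]
theorem shift_xv (P : k × k) : shift P (xv : k[X][Y]) = xv + cst P.1 := by simp [shift]

@[simp]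
theorem shift_yv (P : k × k) : shift P (yv : k[X][Y]) = yv + cst P.2 := by simp [shift]

theorem algHom_cst {A : Type*} [CommSemiring A] [Algebra k A] (f : k[X][Y] →ₐ[k] A) (a : k) :
    f (cst a) = algebraMap k A a :=
  f.commutes a

@[simp]
theorem shift_cst (P : k × k) (a : k) : shift P (cst a : k[X][Y]) = cst a := algHom_cst _ a

theorem shift_shift_neg (P : k × k) (p : k[X][Y]) : shift P (shift (-P) p) = p := by
  have : (shift P).comp (shift (-P)) = AlgHom.id k _ := by
    apply algHom_ext_xy <;> simp [cst]
  exact congrArg (fun F : k[X][Y] →ₐ[k] k[X][Y] => F p) this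

theorem shift_neg_shift (P : k × k) (p : k[X][Y]) : shift (-P) (shift P p) = p := by
  simpa using shift_shift_neg (-P) p

/-- Translation as an automorphism. -/
noncomputable def shiftEquiv (P : k × k) : k[X][Y] ≃ₐ[k] k[X][Y] :=
  AlgEquiv.ofAlgHom (shift P) (shift (-P)) (AlgHom.ext (shift_shift_neg P))
    (AlgHom.ext (shift_neg_shift P))

/-- The maximal ideal of a point. -/
noncomputable def ptIdeal (P : k × k) : Ideal (k[X][Y]) := Ideal.span {xv - cst P.1, yv - cst P.2}

/-- The expansion of a polynomial at a point by degree. -/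
noncomputable def loc (P : k × k) : k[X][Y] →ₐ[k] Polynomial (k[X][Y]) := hom.comp (shift P)

theorem loc_injective (P : k × k) : Function.Injective (loc P) :=
  hom_injective.comp (shiftEquiv P).injective

/-- The intersection multiplicity of `u` and `v` at `P` is at most `b`. -/
def LocLE (u v : k[X][Y]) (P : k × k) (b : ℕ) : Prop :=
  ∀ N, Module.finrank k (k[X][Y] ⧸ (Ideal.span {u, v} ⊔ ptIdeal P ^ N)) ≤ b

theorem locLE_mul {u v : k[X][Y]} {P : k × k} {r s : ℕ} (hr : Polynomial.X ^ r ∣ loc P u)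
    (hs : Polynomial.X ^ s ∣ loc P v) (hrel : IsRelPrime ((loc P u).coeff r) ((loc P v).coeff s)) :
    LocLE u v P (r * s) := by
  intro N
  refine le_trans (le_of_eq ?_) (finrank_local_le (u := shift P u) (v := shift P v) hr hs hrel N)
  apply LinearEquiv.finrank_eq
  refine (Ideal.quotientEquivAlg _ _ (shiftEquiv P) ?_).toLinearEquiv
  rw [Ideal.map_sup, Ideal.map_pow, ptIdeal, Ideal.map_span, Ideal.map_span]
  have : ∀ p, (shiftEquiv P) p = shift P p := fun p => rfl
  simp [Set.image_pair, this]

theorem LocLE.mono {u v : k[X][Y]} {P : k × k} {b c : ℕ} (h : LocLE u v P b) (hbc : b ≤ c) :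
    LocLE u v P c := fun N => (h N).trans hbc

theorem LocLE.symm {u v : k[X][Y]} {P : k × k} {b : ℕ} (h : LocLE u v P b) : LocLE v u P b := by
  intro N
  rw [Ideal.span_pair_comm]
  exact h N

theorem LocLE.of_sub_mul {u v w : k[X][Y]} {P : k × k} {b : ℕ} (h : LocLE (u - w * v) v P b) :
    LocLE u v P b := by
  intro N
  have : Ideal.span {u - w * v, v} = Ideal.span {u, v} := by
    rw [show u - w * v = u + (-w) * v by ring, Ideal.span_pair_add_mul_right]
  rw [← this]
  exact h N

end LocalBound

section Bezout

variable {k : Type*} [Field k]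

theorem Good.mul_le_finrank {u v : k[X][Y]} (hu : Good u) (hv : Good v) (hirr : Irreducible u)
    (huv : ¬ u ∣ v) (hrel : IsRelPrime (top u) (top v)) :
    u.natDegree * v.natDegree ≤ Module.finrank k (k[X][Y] ⧸ Ideal.span {u, v}) := by
  have := hu.finite_quotient hirr huv
  obtain ⟨m, hm⟩ : ∃ m, m = u.natDegree := ⟨_, rfl⟩
  have hmdeg : u.degree = m := by rw [hm, Polynomial.degree_eq_natDegree hu.monic.ne_zero]
  let f : supp k (tri m (m + v.natDegree)) →ₗ[k] k[X][Y] ⧸ Ideal.span {u, v} :=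
    (Ideal.Quotient.mkₐ k _).toLinearMap ∘ₗ (supp k (tri m (m + v.natDegree))).subtype
  let φ : supp k (tri m m) →ₗ[k] k[X][Y] :=
    (Polynomial.modByMonicHom u).restrictScalars k ∘ₗ LinearMap.mulRight k v ∘ₗ
      (supp k (tri m m)).subtype
  have hφ : ∀ b, φ b = (b.1 * v) %ₘ u := fun b => rfl
  have hker : (LinearMap.ker f).map (supp k (tri m (m + v.natDegree))).subtype ≤
      LinearMap.range φ := by
    rintro _ ⟨p, hp, rfl⟩
    have hpJ : p.1 ∈ Ideal.span {u, v} := Ideal.Quotient.eq_zero_iff_mem.1 hp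
    obtain ⟨a, b, hab⟩ := Ideal.mem_span_pair.1 hpJ
    have hpdeg := (mem_supp_tri.1 p.2).1
    have hpmod : p.1 %ₘ u = p.1 :=
      (Polynomial.modByMonic_eq_self_iff hu.monic).2 (hpdeg.trans_eq hmdeg.symm)
    have hbdeg : (b %ₘ u).degree < u.degree := Polynomial.degree_modByMonic_lt _ hu.monic
    have hp' : p.1 = (a + b /ₘ u * v) * u + (b %ₘ u) * v := by
      rw [← hab]
      conv_lhs => rw [← Polynomial.modByMonic_add_div b u]
      ring
    have hmod : p.1 = ((b %ₘ u) * v) %ₘ u := by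
      rw [← hpmod, hp', Polynomial.add_modByMonic,
        (Polynomial.modByMonic_eq_zero_iff_dvd hu.monic).2
        (dvd_mul_left _ _), zero_add]
    have hmem : b %ₘ u ∈ supp k (tri m m) := by
      rw [mem_supp_tri]
      refine ⟨hbdeg.trans_eq hmdeg, ?_⟩
      by_cases hb0 : b %ₘ u = 0
      · exact Or.inl hb0
      · right
        have h1 := hu.tdeg_add_le (a := a + b /ₘ u * v) hrel hv.monic.ne_zero hb0 hbdeg
        rw [← hp', hv.tdeg_eq] at h1
        have h2 : tdeg p.1 < m + v.natDegree :=
          tdeg_lt_of_mem_supp_tri (by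
            by_contra h0
            have : m = 0 := by omega
            rw [hmdeg, this, Nat.cast_zero, Nat.WithBot.lt_zero_iff] at hbdeg
            exact hb0 (Polynomial.degree_eq_bot.1 hbdeg)) p.2
        omega
    exact ⟨⟨_, hmem⟩, hmod.symm⟩
  have h1 : Module.finrank k (LinearMap.ker f) ≤ (tri m m).card := by
    rw [(Submodule.equivMapOfInjective _ (Submodule.injective_subtype _)
      (LinearMap.ker f)).finrank_eq, ← finrank_supp (k := k)]
    exact (Submodule.finrank_mono hker).trans (LinearMap.finrank_range_le φ)
  have h2 := LinearMap.finrank_range_add_finrank_ker (K := k)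
    (V := supp k (tri m (m + v.natDegree))) (V₂ := k[X][Y] ⧸ Ideal.span {u, v}) f
  rw [finrank_supp, card_tri_add le_rfl] at h2
  have h3 := Submodule.finrank_le (LinearMap.range f)
  rw [← hm]
  omega

theorem isCoprime_ptIdeal {P Q : k × k} (h : P ≠ Q) : IsCoprime (ptIdeal P) (ptIdeal Q) := by
  rw [Ideal.isCoprime_iff_exists]
  have key : ∀ (z a b : _), a ≠ b → z - cst a ∈ ptIdeal P → z - cst b ∈ ptIdeal Q →
      ∃ i ∈ ptIdeal P, ∃ j ∈ ptIdeal Q, i + j = (1 : k[X][Y]) := by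
    intro z a b hab h1 h2
    refine ⟨cst (b - a)⁻¹ * (z - cst a), Ideal.mul_mem_left _ _ h1,
      -(cst (b - a)⁻¹ * (z - cst b)), Submodule.neg_mem _ (Ideal.mul_mem_left _ _ h2), ?_⟩
    have : (cst (b - a)⁻¹ : k[X][Y]) * (cst b - cst a) = 1 := by
      rw [← map_sub, ← map_sub, ← map_mul, ← map_mul, inv_mul_cancel₀ (sub_ne_zero.2 hab.symm)]
      simp
    linear_combination this
  by_cases h1 : P.1 = Q.1
  · exact key yv P.2 Q.2 (fun h2 => h (Prod.ext h1 h2)) (Ideal.subset_span (by simp))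
      (Ideal.subset_span (by simp))
  · exact key xv P.1 Q.1 h1 (Ideal.subset_span (by simp)) (Ideal.subset_span (by simp))

theorem exists_pow_le_of_isArtinianRing {R : Type*} [CommRing R] {I J : Ideal R}
    [IsArtinianRing (R ⧸ J)] (h : ∀ M : Ideal R, M.IsMaximal → J ≤ M → I ≤ M) :
    ∃ N, I ^ N ≤ J := by
  obtain ⟨N, hN⟩ := IsArtinianRing.isNilpotent_jacobson_bot (R := R ⧸ J)
  refine ⟨N, ?_⟩
  have hle : I.map (Ideal.Quotient.mk J) ≤ Ideal.jacobson ⊥ := by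
    refine le_sInf fun M (hM : ⊥ ≤ M ∧ M.IsMaximal) => ?_
    rw [Ideal.map_le_iff_le_comap]
    have := hM.2
    refine h _ (Ideal.comap_isMaximal_of_surjective _ Ideal.Quotient.mk_surjective) ?_
    intro p hp
    rw [Ideal.mem_comap, Ideal.Quotient.eq_zero_iff_mem.2 hp]
    exact M.zero_mem
  have h1 := Ideal.pow_right_mono hle N
  rw [hN, ← Ideal.map_pow, Ideal.map_le_iff_le_comap] at h1
  intro p hp
  exact Ideal.Quotient.eq_zero_iff_mem.1 (h1 hp)

theorem prod_sup_le {R ι : Type*} [CommRing R] (J : Ideal R) (I : ι → Ideal R) (S : Finset ι) :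
    ∏ i ∈ S, (J ⊔ I i) ≤ J ⊔ ∏ i ∈ S, I i := by
  classical
  induction S using Finset.induction_on with
  | empty => simp
  | insert a s ha ih =>
    rw [Finset.prod_insert ha, Finset.prod_insert ha]
    refine (Ideal.mul_mono_right ih).trans (Ideal.mul_le.2 fun x hx y hy => ?_)
    obtain ⟨a₁, ha₁, b₁, hb₁, rfl⟩ := Submodule.mem_sup.1 hx
    obtain ⟨a₂, ha₂, b₂, hb₂, rfl⟩ := Submodule.mem_sup.1 hy
    refine Submodule.mem_sup.2 ⟨a₁ * (a₂ + b₂) + b₁ * a₂, ?_, b₁ * b₂, Ideal.mul_mem_mul hb₁ hb₂,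
      by ring⟩
    exact J.add_mem (J.mul_mem_right _ ha₁) (J.mul_mem_left _ ha₂)

theorem ptIdeal_le {P : k × k} {M : Ideal (k[X][Y])} (h : ∀ p, ev P p = 0 → p ∈ M) :
    ptIdeal P ≤ M := by
  rw [ptIdeal, Ideal.span_le]
  intro p hp
  rcases hp with rfl | rfl
  · exact h _ (by rw [map_sub, ev_xv, ev_cst, sub_self])
  · exact h _ (by rw [map_sub, ev_yv, ev_cst, sub_self])

variable [IsAlgClosed k]

theorem exists_ev_eq_zero_iff (M : Ideal (k[X][Y])) [hM : M.IsMaximal]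
    [Module.Finite k (k[X][Y] ⧸ M)] : ∃ P, ∀ p, p ∈ M ↔ ev P p = 0 := by
  obtain ⟨φ, hφ⟩ : ∃ φ : k →+* k[X][Y] ⧸ M, φ = algebraMap k (k[X][Y] ⧸ M) := ⟨_, rfl⟩
  have hbij : Function.Bijective φ :=
    hφ ▸ IsAlgClosed.algebraMap_bijective_of_isIntegral (k := k) (K := k[X][Y] ⧸ M)
  have hcst : ∀ a, φ a = Ideal.Quotient.mk M (cst a) := fun a => by rw [hφ]; rfl
  obtain ⟨α, hα⟩ := hbij.2 (Ideal.Quotient.mk M xv)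
  obtain ⟨β, hβ⟩ := hbij.2 (Ideal.Quotient.mk M yv)
  have hπ : φ.comp ((ev (α, β) : k[X][Y] →ₐ[k] k) : k[X][Y] →+* k) = Ideal.Quotient.mk M := by
    refine Polynomial.ringHom_ext' (Polynomial.ringHom_ext' ?_ ?_) ?_
    · refine RingHom.ext fun a => ?_
      exact (congrArg φ (ev_cst (α, β) a)).trans (hcst a)
    · exact (congrArg φ (ev_xv (α, β))).trans hα
    · exact (congrArg φ (ev_yv (α, β))).trans hβ
  refine ⟨(α, β), fun p => ?_⟩
  have h1 : φ (ev (α, β) p) = Ideal.Quotient.mk M p := RingHom.congr_fun hπ p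
  rw [← Ideal.Quotient.eq_zero_iff_mem, ← h1]
  exact ⟨fun h => hbij.1 (h.trans (map_zero _).symm), fun h => by rw [h, map_zero]⟩

theorem exists_pow_prod_ptIdeal_le {u v : k[X][Y]} [Module.Finite k (k[X][Y] ⧸ Ideal.span {u, v})]
    (S : Finset (k × k)) (hS : ∀ P, ev P u = 0 → ev P v = 0 → P ∈ S) :
    ∃ N, (∏ P ∈ S, ptIdeal P) ^ N ≤ Ideal.span {u, v} := by
  have : IsArtinianRing (k[X][Y] ⧸ Ideal.span {u, v}) := IsArtinianRing.of_finite k _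
  refine exists_pow_le_of_isArtinianRing fun M hM hJM => ?_
  have : Module.Finite k (k[X][Y] ⧸ M) :=
    Module.Finite.of_surjective (Ideal.Quotient.factorₐ k hJM).toLinearMap
      (Ideal.Quotient.factor_surjective hJM)
  obtain ⟨P, hP⟩ := exists_ev_eq_zero_iff M
  have hmem : P ∈ S := hS P ((hP _).1 (hJM (Ideal.subset_span (by simp))))
    ((hP _).1 (hJM (Ideal.subset_span (by simp))))
  exact (Ideal.prod_le_inf.trans (Finset.inf_le hmem)).trans (ptIdeal_le fun p => (hP p).2)

theorem finrank_quotient_le_sum {u v : k[X][Y]} [Module.Finite k (k[X][Y] ⧸ Ideal.span {u, v})]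
    (S : Finset (k × k)) (hS : ∀ P, ev P u = 0 → ev P v = 0 → P ∈ S) (b : k × k → ℕ)
    (hb : ∀ P ∈ S, LocLE u v P (b P)) :
    Module.finrank k (k[X][Y] ⧸ Ideal.span {u, v}) ≤ ∑ P ∈ S, b P := by
  obtain ⟨N, hN⟩ := exists_pow_prod_ptIdeal_le S hS
  obtain ⟨J, hJ⟩ : ∃ J, J = Ideal.span {u, v} := ⟨_, rfl⟩
  simp only [LocLE] at hb
  rw [← hJ] at hb hN ⊢
  have hJfin : Module.Finite k (k[X][Y] ⧸ J) := by rw [hJ]; infer_instance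
  have hfac : ∀ P, J ≤ J ⊔ ptIdeal P ^ N := fun P => le_sup_left
  have hfin : ∀ P : S, Module.Finite k (k[X][Y] ⧸ (J ⊔ ptIdeal P.1 ^ N)) := fun P =>
    Module.Finite.of_surjective (Ideal.Quotient.factorₐ k (hfac P)).toLinearMap
      (Ideal.Quotient.factor_surjective (hfac P))
  have hfree : ∀ P : S, Module.Free k (k[X][Y] ⧸ (J ⊔ ptIdeal P.1 ^ N)) := fun P =>
    Module.Free.of_divisionRing k _
  let f : (k[X][Y] ⧸ J) →ₗ[k] ((P : S) → k[X][Y] ⧸ (J ⊔ ptIdeal P.1 ^ N)) :=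
    LinearMap.pi fun P => (Ideal.Quotient.factorₐ k (hfac P)).toLinearMap
  have hf : Function.Injective f := by
    rw [injective_iff_map_eq_zero]
    intro q hq
    obtain ⟨p, rfl⟩ := Ideal.Quotient.mk_surjective q
    rw [Ideal.Quotient.eq_zero_iff_mem]
    have hp : ∀ P ∈ S, p ∈ J ⊔ ptIdeal P ^ N := fun P hP =>
      Ideal.Quotient.eq_zero_iff_mem.1 (congrFun hq ⟨P, hP⟩)
    have hprod : p ∈ ∏ P ∈ S, (J ⊔ ptIdeal P ^ N) := by
      rw [Ideal.prod_eq_iInf_of_pairwise_isCoprime]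
      · simpa using hp
      · intro P _ Q _ hPQ
        have := (isCoprime_ptIdeal hPQ).pow (m := N) (n := N)
        rw [Function.onFun, Ideal.isCoprime_iff_sup_eq] at *
        exact top_le_iff.1 (this.ge.trans (sup_le_sup le_sup_right le_sup_right))
    have h1 := prod_sup_le J (fun P => ptIdeal P ^ N) S hprod
    rw [Finset.prod_pow] at h1
    exact (sup_le le_rfl hN) h1
  calc _ ≤ _ := LinearMap.finrank_le_finrank_of_injective hf
    _ = ∑ P : S, Module.finrank k (k[X][Y] ⧸ (J ⊔ ptIdeal P.1 ^ N)) :=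
        Module.finrank_pi_fintype k
    _ ≤ ∑ P : S, b P.1 := Finset.sum_le_sum fun P _ => hb P.1 P.2 N
    _ = _ := Finset.sum_coe_sort S b

/-- Bézout's inequality, for curves without common points at infinity. -/
theorem Good.mul_le_sum {u v : k[X][Y]} (hu : Good u) (hv : Good v) (hirr : Irreducible u)
    (huv : ¬ u ∣ v) (hrel : IsRelPrime (top u) (top v))
    (S : Finset (k × k)) (hS : ∀ P, ev P u = 0 → ev P v = 0 → P ∈ S) (b : k × k → ℕ)
    (hb : ∀ P ∈ S, LocLE u v P (b P)) :
    u.natDegree * v.natDegree ≤ ∑ P ∈ S, b P := by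
  have := hu.finite_quotient hirr huv
  exact (hu.mul_le_finrank hv hirr huv hrel).trans (finrank_quotient_le_sum S hS b hb)

end Bezout

section Reduction

variable {k A : Type*} [Field k] [CommRing A] [Algebra k A]

theorem aeval_mul_mem {S : Submodule k A} {p : k[X]} {e : ℕ} (hp : p.natDegree ≤ e) {ξ u : A}
    (h : ∀ i ≤ e, ξ ^ i * u ∈ S) : Polynomial.aeval ξ p * u ∈ S := by
  rw [Polynomial.aeval_eq_sum_range' (Nat.lt_succ_of_le hp), Finset.sum_mul]
  refine S.sum_mem fun i hi => ?_
  rw [smul_mul_assoc]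
  exact S.smul_mem _ (h i (Nat.lt_succ_iff.1 (Finset.mem_range.1 hi)))

/-- Monomials in three functions, subject to one monic relation of degree `d` for the second and
one of degree `d - 1` for the third, are reduced to bounded exponents. -/
theorem mon_mem_span {h : k[X][Y]} (hh : Good h) {d : ℕ} (hd : h.natDegree = d) {ξ η ζ : A}
    (hη : ∑ b ∈ Finset.range (d + 1), Polynomial.aeval ξ (h.coeff b) * η ^ b = 0)
    (hζ : ∑ b ∈ Finset.range (d + 1), Polynomial.aeval ξ (h.coeff b) *
      ∑ c ∈ Finset.range b, ζ ^ c * η ^ (b - 1 - c) = 0) (N : ℕ) {S : Submodule k A}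
    (hS : ∀ i j l, i ≤ N → j < d → l < d - 1 → ξ ^ i * η ^ j * ζ ^ l ∈ S) :
    ∀ i j l, i + j + l ≤ N → ξ ^ i * η ^ j * ζ ^ l ∈ S := by
  have hcoef : ∀ b ≤ d, (h.coeff b).natDegree ≤ d - b := by
    intro b hb
    by_contra! hlt
    have hne : (h.coeff b).coeff (h.coeff b).natDegree ≠ 0 := by
      rw [Polynomial.coeff_natDegree, Polynomial.leadingCoeff_ne_zero]
      rintro h0
      rw [h0, Polynomial.natDegree_zero] at hlt
      omega
    have := tdeg_le_iff.1 hh.tdeg_le _ _ hne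
    omega
  have hlead : h.coeff d = 1 := hd ▸ hh.monic.coeff_natDegree
  have step : ∀ l i j, i + j + l ≤ N → ξ ^ i * η ^ j * ζ ^ l ∈ S := by
    intro l
    induction l using Nat.strong_induction_on with
    | _ l ihl =>
    intro i j
    revert i
    induction j using Nat.strong_induction_on with
    | _ j ihj =>
    intro i hN
    by_cases hl : l < d - 1
    · by_cases hj : j < d
      · exact hS i j l (by omega) hj hl
      · rw [Finset.sum_range_succ, hlead, map_one, one_mul] at hη
        have hηd : η ^ d = -∑ b ∈ Finset.range d, Polynomial.aeval ξ (h.coeff b) * η ^ b :=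
          eq_neg_of_add_eq_zero_right hη
        have : ξ ^ i * η ^ j * ζ ^ l = -∑ b ∈ Finset.range d, Polynomial.aeval ξ (h.coeff b) *
            (ξ ^ i * η ^ (j - d + b) * ζ ^ l) := by
          rw [show j = j - d + d by omega, pow_add η (j - d) d, hηd, mul_neg, mul_neg, neg_mul,
            Finset.mul_sum, Finset.mul_sum, Finset.sum_mul]
          refine congrArg _ (Finset.sum_congr rfl fun b _ => ?_)
          rw [show j - d + d - d = j - d by omega, pow_add]
          ring
        rw [this]
        refine S.neg_mem (S.sum_mem fun b hb => ?_)
        rw [Finset.mem_range] at hb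
        refine aeval_mul_mem (hcoef b hb.le) fun e he => ?_
        rw [show ξ ^ e * (ξ ^ i * η ^ (j - d + b) * ζ ^ l) =
          ξ ^ (e + i) * η ^ (j - d + b) * ζ ^ l by rw [pow_add]; ring]
        exact ihj _ (by omega) _ (by omega)
    · by_cases hd0 : d = 0
      · subst hd0
        have h1 : (1 : A) = 0 := by simpa [hlead] using hη
        rw [show ξ ^ i * η ^ j * ζ ^ l = (1 : A) * (ξ ^ i * η ^ j * ζ ^ l) by ring, h1, zero_mul]
        exact S.zero_mem
      rw [Finset.sum_range_succ, hlead, map_one, one_mul] at hζ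
      have hd1 : d = (d - 1) + 1 := by omega
      have hζd : ζ ^ (d - 1) = -(∑ b ∈ Finset.range d, Polynomial.aeval ξ (h.coeff b) *
          ∑ c ∈ Finset.range b, ζ ^ c * η ^ (b - 1 - c) +
          ∑ c ∈ Finset.range (d - 1), ζ ^ c * η ^ (d - 1 - c)) := by
        refine eq_neg_of_add_eq_zero_right ?_
        rw [← hζ, add_assoc]
        congr 1
        conv_rhs => rw [hd1]
        rw [Finset.sum_range_succ]
        simp
      have : ξ ^ i * η ^ j * ζ ^ l = -(∑ b ∈ Finset.range d, Polynomial.aeval ξ (h.coeff b) *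
          (∑ c ∈ Finset.range b, ξ ^ i * η ^ (j + (b - 1 - c)) * ζ ^ (l - (d - 1) + c)) +
          ∑ c ∈ Finset.range (d - 1), ξ ^ i * η ^ (j + (d - 1 - c)) * ζ ^ (l - (d - 1) + c)) := by
        rw [show l = l - (d - 1) + (d - 1) by omega, pow_add ζ (l - (d - 1)) (d - 1), hζd,
          mul_neg, mul_neg, mul_add, mul_add]
        refine congrArg _ (congrArg₂ _ ?_ ?_)
        · rw [Finset.mul_sum, Finset.mul_sum]
          refine Finset.sum_congr rfl fun b _ => ?_
          rw [Finset.mul_sum, Finset.mul_sum, Finset.mul_sum, Finset.mul_sum]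
          refine Finset.sum_congr rfl fun c _ => ?_
          rw [show l - (d - 1) + (d - 1) - (d - 1) = l - (d - 1) by omega, pow_add, pow_add]
          ring
        · rw [Finset.mul_sum, Finset.mul_sum]
          refine Finset.sum_congr rfl fun c _ => ?_
          rw [show l - (d - 1) + (d - 1) - (d - 1) = l - (d - 1) by omega, pow_add, pow_add]
          ring
      rw [this]
      refine S.neg_mem (S.add_mem (S.sum_mem fun b hb => ?_) (S.sum_mem fun c hc => ?_))
      · rw [Finset.mem_range] at hb
        refine aeval_mul_mem (hcoef b hb.le) fun e he => ?_
        rw [Finset.mul_sum]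
        refine S.sum_mem fun c hc => ?_
        rw [Finset.mem_range] at hc
        rw [← mul_assoc, ← mul_assoc, ← pow_add]
        exact ihl _ (by omega) _ _ (by omega)
      · rw [Finset.mem_range] at hc
        exact ihl _ (by omega) _ _ (by omega)
  exact fun i j l => step l i j

/-- More vectors than a spanning set has elements are linearly dependent. -/
theorem exists_sum_smul_eq_zero {ι V : Type*} [AddCommGroup V] [Module k V] (s : Finset ι)
    (v : ι → V) (T : Finset V) (hv : ∀ i ∈ s, v i ∈ Submodule.span k (T : Set V))
    (hcard : T.card < s.card) : ∃ c : ι → k, ∑ i ∈ s, c i • v i = 0 ∧ ∃ i ∈ s, c i ≠ 0 := by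
  have hnot : ¬ LinearIndependent k (fun i : s => v i) := by
    intro hli
    have := linearIndependent_le_span' (fun i : s => v i) hli (T : Set V) (by
      rintro _ ⟨i, rfl⟩
      exact hv i.1 i.2)
    simp at this
    omega
  classical
  obtain ⟨g, hg, i, hi⟩ := Fintype.not_linearIndependent_iff.1 hnot
  refine ⟨fun i => if h : i ∈ s then g ⟨i, h⟩ else 0, ?_, i.1, i.2, by simpa using hi⟩
  rw [← hg, ← Finset.sum_coe_sort s]
  refine Finset.sum_congr rfl fun i _ => ?_
  simp

end Reduction

section Orders

variable {k : Type*} [Field k]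

/-- Coefficients of order less than `r` do not interfere with combinations of `r`-th powers. -/
theorem eq_zero_of_sum_mul_pow_eq_zero {p : ℕ} [Fact p.Prime] [CharP k p] {ι : Type*} (n : ℕ)
    (W : Submodule k (PowerSeries k))
    (hW : ∀ w ∈ W, w ≠ 0 → ¬ PowerSeries.X ^ p ^ n ∣ w) (J : Finset ι) :
    ∀ (ψ : ι → PowerSeries k), (∀ c : ι → k, ∑ j ∈ J, c j • ψ j = 0 → ∀ j ∈ J, c j = 0) →
      ∀ a : ι → PowerSeries k, (∀ j ∈ J, a j ∈ W) → ∑ j ∈ J, a j * ψ j ^ p ^ n = 0 →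
        ∀ j ∈ J, a j = 0 := by
  classical
  have : CharP (PowerSeries k) p := charP_of_injective_algebraMap
    (FaithfulSMul.algebraMap_injective k (PowerSeries k)) p
  induction hcard : J.card generalizing J with
  | zero => simp [Finset.card_eq_zero.1 hcard]
  | succ m ih =>
    intro ψ hψ a ha hsum
    have hne : ∀ j ∈ J, ψ j ≠ 0 := by
      intro j hj h0
      have := hψ (fun i => if i = j then 1 else 0) (by
        simp [ite_smul, h0]) j hj
      simp at this
    obtain ⟨j₀, hj₀, hmin⟩ := J.exists_min_image (fun j => (ψ j).order)
      (Finset.card_pos.1 (by omega))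
    obtain ⟨n₀, hn₀⟩ : ∃ n₀ : ℕ, (ψ j₀).order = n₀ :=
      ENat.ne_top_iff_exists.1 (mt PowerSeries.order_eq_top.1 (hne j₀ hj₀)) |>.imp fun _ h => h.symm
    have hco : PowerSeries.coeff n₀ (ψ j₀) ≠ 0 := (PowerSeries.order_eq_nat.1 hn₀).1
    let l : ι → k := fun j => PowerSeries.coeff n₀ (ψ j) / PowerSeries.coeff n₀ (ψ j₀)
    let ψ' : ι → PowerSeries k := fun j => ψ j - l j • ψ j₀
    have hdiv : ∀ j ∈ J, PowerSeries.X ^ (n₀ + 1) ∣ ψ' j := by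
      intro j hj
      rw [PowerSeries.X_pow_dvd_iff]
      intro m' hm'
      rw [map_sub, PowerSeries.coeff_smul]
      rcases Nat.lt_succ_iff_lt_or_eq.1 hm' with h | rfl
      · have h1 : (m' : ℕ∞) < (ψ j₀).order := by rw [hn₀]; exact_mod_cast h
        rw [PowerSeries.coeff_of_lt_order m' h1,
          PowerSeries.coeff_of_lt_order m' (h1.trans_le (hmin j hj)), smul_zero, sub_zero]
      · rw [smul_eq_mul, div_mul_cancel₀ _ hco, sub_self]
    have hpow : ∀ j, ψ j ^ p ^ n = ψ' j ^ p ^ n + (l j ^ p ^ n) • ψ j₀ ^ p ^ n := by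
      intro j
      rw [← smul_pow, ← add_pow_char_pow]
      simp [ψ']
    have hsplit := hsum
    rw [← Finset.add_sum_erase J _ hj₀] at hsplit
    let a' := a j₀ + ∑ j ∈ J.erase j₀, (l j ^ p ^ n) • a j
    have ha' : a' ∈ W := W.add_mem (ha j₀ hj₀) (W.sum_mem fun j hj =>
      W.smul_mem _ (ha j (Finset.mem_of_mem_erase hj)))
    have hsum' : a' * ψ j₀ ^ p ^ n + ∑ j ∈ J.erase j₀, a j * ψ' j ^ p ^ n = 0 := by
      rw [← hsplit, add_mul, add_assoc, Finset.sum_mul, ← Finset.sum_add_distrib]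
      congr 1
      refine Finset.sum_congr rfl fun j _ => ?_
      rw [hpow j, mul_add, smul_mul_assoc, mul_smul_comm, add_comm]
    have ha'0 : a' = 0 := by
      by_contra hne'
      refine hW a' ha' hne' ?_
      have h1 : PowerSeries.X ^ ((n₀ + 1) * p ^ n) ∣ a' * ψ j₀ ^ p ^ n := by
        rw [eq_neg_of_add_eq_zero_left hsum', dvd_neg]
        refine Finset.dvd_sum fun j hj => Dvd.dvd.mul_left ?_ _
        rw [pow_mul]
        exact pow_dvd_pow_of_dvd (hdiv j (Finset.mem_of_mem_erase hj)) _
      obtain ⟨u, hu⟩ := PowerSeries.X_pow_order_dvd (φ := ψ j₀)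
      rw [hn₀, ENat.toNat_natCast] at hu
      have hu0 : ¬ PowerSeries.X ∣ u := by
        rintro ⟨v, rfl⟩
        apply hco
        have : PowerSeries.X ^ (n₀ + 1) ∣ ψ j₀ := ⟨v, by rw [hu]; ring⟩
        exact PowerSeries.X_pow_dvd_iff.1 this n₀ (by omega)
      rw [hu, mul_pow, ← pow_mul, show a' * (PowerSeries.X ^ (n₀ * p ^ n) * u ^ p ^ n) =
        PowerSeries.X ^ (n₀ * p ^ n) * (a' * u ^ p ^ n) by ring, add_mul, pow_add, one_mul,
        mul_dvd_mul_iff_left (pow_ne_zero _ PowerSeries.X_ne_zero)] at h1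
      exact PowerSeries.X_prime.pow_dvd_of_dvd_mul_right _
        (fun h => hu0 (PowerSeries.X_prime.dvd_of_dvd_pow h)) h1
    rw [ha'0, zero_mul, zero_add] at hsum'
    have herase := ih (J.erase j₀) (by rw [Finset.card_erase_of_mem hj₀]; omega) ψ' (by
      intro c hc j hj
      have h1 := hψ (fun i => if i = j₀ then -∑ j ∈ J.erase j₀, c j * l j else c i) (by
        rw [← Finset.add_sum_erase J _ hj₀, if_pos rfl,
          Finset.sum_congr rfl (g := fun j => c j • ψ j)
          (fun j hj => by rw [if_neg (Finset.ne_of_mem_erase hj)]), ← hc, neg_smul, Finset.sum_smul,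
          ← Finset.sum_neg_distrib, ← Finset.sum_add_distrib]
        refine Finset.sum_congr rfl fun j _ => ?_
        simp only [ψ', smul_sub, mul_smul]
        abel) j (Finset.mem_of_mem_erase hj)
      simpa [Finset.ne_of_mem_erase hj] using h1) a
      (fun j hj => ha j (Finset.mem_of_mem_erase hj)) hsum'
    intro j hj
    by_cases hjj : j = j₀
    · subst hjj
      have : a' = a j := by
        simp only [a']
        rw [Finset.sum_eq_zero fun i hi => by rw [herase i hi, smul_zero], add_zero]
      rw [← this, ha'0]
    · exact herase j (Finset.mem_erase.2 ⟨hjj, hj⟩)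

end Orders

section Branch

variable {k : Type*} [Field k]

theorem aeval_add_X (a : k) (r : k[X]) :
    Polynomial.aeval (PowerSeries.C a + PowerSeries.X : PowerSeries k) r =
      (Polynomial.taylor a r : k[X]) := by
  induction r using Polynomial.induction_on' with
  | add p q hp hq => simp [hp, hq]
  | monomial n c =>
    rw [Polynomial.aeval_monomial, Polynomial.taylor_monomial]
    simp [add_comm]

theorem eq_zero_of_X_pow_dvd_aeval {a : k} {r : k[X]} {n : ℕ} (hn : r.natDegree < n)
    (h : PowerSeries.X ^ n ∣
      Polynomial.aeval (PowerSeries.C a + PowerSeries.X : PowerSeries k) r) : r = 0 := by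
  rw [aeval_add_X, PowerSeries.X_pow_dvd_iff] at h
  rw [← Polynomial.taylor_eq_zero a r]
  ext i
  by_cases hi : i < n
  · simpa using h i hi
  · rw [Polynomial.coeff_eq_zero_of_natDegree_lt (by rw [Polynomial.natDegree_taylor]; omega),
      Polynomial.coeff_zero]

theorem tdeg_derivative_le (p : k[X][Y]) : tdeg (Polynomial.derivative p) ≤ tdeg p := by
  rw [tdeg_le_iff]
  intro i j hij
  rw [Polynomial.coeff_derivative] at hij
  have h1 : (p.coeff (j + 1)).coeff i ≠ 0 := by
    intro h0
    apply hij
    rw [← Nat.cast_succ, ← nsmul_eq_mul', Polynomial.coeff_smul, h0, smul_zero]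
  have := tdeg_le_iff.1 (le_refl (tdeg p)) _ _ h1
  omega

theorem Good.not_dvd_derivative {h : k[X][Y]} (hh : Good h)
    (hder : Polynomial.derivative h ≠ 0) : ¬ h ∣ Polynomial.derivative h :=
  hh.monic.not_dvd_of_degree_lt hder (Polynomial.degree_derivative_lt hh.monic.ne_zero)

theorem ev_eq_eval_map (P : k × k) (p : k[X][Y]) :
    ev P p = (p.map (Polynomial.evalRingHom P.1)).eval P.2 := by
  induction p using mon_induction with
  | add p q hp hq => simp [hp, hq]
  | smul_mon c i j =>
    rw [map_smul, mon, map_mul, map_pow, map_pow, ev_xv, ev_yv, ← mon, smul_mon_eq]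
    simp [mul_assoc]

/-- A smooth branch of a plane curve. -/
theorem Good.exists_branch [IsAlgClosed k] {h : k[X][Y]} (hh : Good h) (hirr : Irreducible h)
    (hder : Polynomial.derivative h ≠ 0) :
    ∃ ψ : k[X][Y] →ₐ[k] PowerSeries k, ψ h = 0 ∧
      ∀ A, ¬ h ∣ A → ∀ a, tdeg A ≤ a → ¬ PowerSeries.X ^ (h.natDegree * a + 1) ∣ ψ A := by
  obtain ⟨r, hr0, -, b, c, hr⟩ := hh.exists_eliminant hirr (hh.not_dvd_derivative hder) le_rfl
  obtain ⟨x₀, hx₀⟩ : ∃ x₀, r.eval x₀ ≠ 0 := by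
    by_contra! hall
    exact hr0 (Polynomial.funext (by simpa using hall))
  have hdeg : h.natDegree ≠ 0 := by
    intro h0
    rw [Polynomial.natDegree_eq_zero] at h0
    obtain ⟨s, rfl⟩ := h0
    exact hder Polynomial.derivative_C
  obtain ⟨y₀, hy₀⟩ : ∃ y₀, ev (x₀, y₀) h = 0 := by
    simp only [ev_eq_eval_map]
    refine IsAlgClosed.exists_root _ ?_
    rw [Polynomial.degree_eq_natDegree (hh.monic.map _).ne_zero, hh.monic.natDegree_map]
    exact_mod_cast hdeg
  have hd0 : ev (x₀, y₀) (Polynomial.derivative h) ≠ 0 := by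
    intro h0
    have := congrArg (ev (x₀, y₀)) hr
    rw [map_add, map_mul, map_mul, hy₀, h0, ev_C] at this
    simp at this
    exact hx₀ this
  let φ : k[X] →ₐ[k] PowerSeries k := Polynomial.aeval (PowerSeries.C x₀ + PowerSeries.X)
  have hc : ∀ p : k[X], PowerSeries.constantCoeff (φ p) = p.eval x₀ := by
    intro p
    rw [aeval_add_X, ← PowerSeries.coeff_zero_eq_constantCoeff_apply, Polynomial.coeff_coe,
      Polynomial.taylor_coeff_zero]
  have hev : ∀ p : k[X][Y], PowerSeries.constantCoeff
      ((p.map φ.toRingHom).eval (PowerSeries.C y₀)) = ev (x₀, y₀) p := by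
    intro p
    rw [ev_eq_eval_map, Polynomial.eval_map, Polynomial.eval_map, Polynomial.hom_eval₂]
    congr 1
    ext a <;> simp [hc]
  have hhens : HenselianRing (PowerSeries k) (Ideal.span {PowerSeries.X}) :=
    IsAdicComplete.henselianRing _ _
  obtain ⟨y, hy, -⟩ := hhens.is_henselian (h.map φ.toRingHom) (hh.monic.map _) (PowerSeries.C y₀)
    (by rw [Ideal.mem_span_singleton, PowerSeries.X_dvd_iff, hev, hy₀])
    (by
      refine IsUnit.map _ ?_
      rw [PowerSeries.isUnit_iff_constantCoeff, Polynomial.derivative_map, hev]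
      exact isUnit_iff_ne_zero.2 hd0)
  have haev : ∀ p : k[X][Y], Polynomial.aevalAeval (PowerSeries.C x₀ + PowerSeries.X) y p =
      (p.map φ.toRingHom).eval y := by
    intro p
    induction p using mon_induction with
    | add p q hp hq => simp only [map_add, hp, hq, Polynomial.map_add, Polynomial.eval_add]
    | smul_mon c i j =>
      rw [map_smul, mon, map_mul, map_pow, map_pow, Polynomial.aevalAeval_X,
        Polynomial.aevalAeval_Y, ← mon, smul_mon_eq]
      simp [φ, Algebra.smul_def, mul_assoc, ← Polynomial.C_mul_X_pow_eq_monomial]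
  have hψ : Polynomial.aevalAeval (PowerSeries.C x₀ + PowerSeries.X) y h = 0 := by
    rw [haev]
    exact hy
  refine ⟨Polynomial.aevalAeval (PowerSeries.C x₀ + PowerSeries.X) y, hψ, ?_⟩
  · intro A hA a ha hdvd
    obtain ⟨r, hr0, hrd, b, c, hr⟩ := hh.exists_eliminant hirr hA ha
    refine hr0 (eq_zero_of_X_pow_dvd_aeval (Nat.lt_succ_of_le hrd) (a := x₀) ?_)
    have h1 := congrArg (Polynomial.aevalAeval (PowerSeries.C x₀ + PowerSeries.X) y) hr
    rw [map_add, map_mul, map_mul, hψ, mul_zero, zero_add, Polynomial.aevalAeval_C] at h1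
    exact h1 ▸ hdvd.mul_left _

end Branch

section Frobenius

variable {k : Type*} [Field k] [CharP k 2]

/-- The map raising all coefficients to the power `2 ^ n`. -/
noncomputable def sig (k : Type*) [Field k] [CharP k 2] (n : ℕ) : k[X][Y] →+* k[X][Y] :=
  Polynomial.mapRingHom (Polynomial.mapRingHom (iterateFrobenius k 2 n))

theorem coeff_sig (n : ℕ) (p : k[X][Y]) (i j : ℕ) :
    ((sig k n p).coeff j).coeff i = ((p.coeff j).coeff i) ^ 2 ^ n := by
  simp [sig, iterateFrobenius_def]

theorem ev_sig (n : ℕ) (x y : k) (p : k[X][Y]) :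
    ev (x ^ 2 ^ n, y ^ 2 ^ n) (sig k n p) = ev (x, y) p ^ 2 ^ n := by
  have : ((ev (x ^ 2 ^ n, y ^ 2 ^ n) : k[X][Y] →ₐ[k] k) : k[X][Y] →+* k).comp (sig k n) =
      (iterateFrobenius k 2 n).comp ((ev (x, y) : k[X][Y] →ₐ[k] k) : k[X][Y] →+* k) := by
    refine Polynomial.ringHom_ext' (Polynomial.ringHom_ext' ?_ ?_) ?_
    · refine RingHom.ext fun a => ?_
      simp [sig, ev_C, iterateFrobenius_def]
    · simp [sig, ev_C, iterateFrobenius_def]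
    · simp [sig, iterateFrobenius_def]
  exact RingHom.congr_fun this p

end Frobenius

section Stepanov

variable {k : Type*} [Field k]

theorem tdeg_smul_le (c : k) (p : k[X][Y]) : tdeg (c • p) ≤ tdeg p := by
  refine tdeg_le_iff.2 fun i j h => tdeg_le_iff.1 (le_refl (tdeg p)) i j fun h0 => h ?_
  rw [Polynomial.coeff_smul, Polynomial.coeff_smul, h0, smul_zero]

theorem tdeg_mon_le (i j : ℕ) : tdeg (mon i j : k[X][Y]) ≤ i + j := by
  refine tdeg_le_iff.2 fun a b h => ?_
  rw [coeff_mon, ne_eq, ite_eq_right_iff, Classical.not_imp] at h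
  omega

theorem tdeg_pow_le (p : k[X][Y]) (n : ℕ) : tdeg (p ^ n) ≤ n * tdeg p := by
  rw [tdeg, map_pow]
  exact Polynomial.natDegree_pow_le

theorem tdeg_sum_le {ι : Type*} (s : Finset ι) (f : ι → k[X][Y]) {n : ℕ}
    (h : ∀ i ∈ s, tdeg (f i) ≤ n) : tdeg (∑ i ∈ s, f i) ≤ n := by
  rw [tdeg, map_sum]
  exact Polynomial.natDegree_sum_le_of_forall_le s _ h

theorem coeff_sum_smul_mon (s : Finset (ℕ × ℕ)) (c : ℕ × ℕ → k) (e : ℕ × ℕ) :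
    ((∑ e ∈ s, c e • (mon e.1 e.2 : k[X][Y])).coeff e.2).coeff e.1 = if e ∈ s then c e else 0 := by
  classical
  rw [Polynomial.finsetSum_coeff, Polynomial.finsetSum_coeff]
  simp only [Polynomial.coeff_smul, coeff_mon, ← Prod.ext_iff, smul_eq_mul, mul_ite, mul_one,
    mul_zero]
  rw [Finset.sum_ite_eq]

theorem sum_smul_mon_mem_supp (s : Finset (ℕ × ℕ)) (c : ℕ × ℕ → k) :
    ∑ e ∈ s, c e • (mon e.1 e.2 : k[X][Y]) ∈ supp k s := by
  intro i j h
  have := coeff_sum_smul_mon s c (i, j)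
  by_contra hn
  rw [if_neg hn] at this
  exact h this

theorem eq_zero_of_sum_smul_mon_eq_zero {s : Finset (ℕ × ℕ)} {c : ℕ × ℕ → k}
    (h : ∑ e ∈ s, c e • (mon e.1 e.2 : k[X][Y]) = 0) : ∀ e ∈ s, c e = 0 := by
  intro e he
  have := coeff_sum_smul_mon s c e
  rwa [h, if_pos he, Polynomial.coeff_zero, Polynomial.coeff_zero, eq_comm] at this

theorem Good.eq_zero_of_dvd {h p : k[X][Y]} (hh : Good h) {N : ℕ}
    (hp : p ∈ supp k (tri h.natDegree N)) (hdvd : h ∣ p) : p = 0 := by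
  by_contra h0
  refine hh.monic.not_dvd_of_degree_lt h0 ?_ hdvd
  rw [Polynomial.degree_eq_natDegree hh.monic.ne_zero]
  exact (mem_supp_tri.1 hp).1

theorem le_card_tri (m s : ℕ) : m * s ≤ (tri m (m + s)).card := by
  rw [card_tri_add le_rfl]
  exact Nat.le_add_left _ _

theorem ev_eq_sum (P : k × k) {p : k[X][Y]} {d : ℕ} (hd : p.natDegree ≤ d) :
    ev P p = ∑ b ∈ Finset.range (d + 1), (p.coeff b).eval P.1 * P.2 ^ b := by
  rw [ev_eq_eval_map, Polynomial.eval_eq_sum_range' (n := d + 1)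
    (Nat.lt_succ_of_le (Polynomial.natDegree_map_le.trans hd))]
  simp

/-- Monomial functions on the pairs of distinct points of a plane curve in a common fiber. -/
theorem Good.exists_relation {h : k[X][Y]} (hh : Good h) {d : ℕ} (hd : h.natDegree = d)
    {ι : Type*} (s : Finset ι) (f : ι → ℕ × ℕ × ℕ) (N : ℕ)
    (hf : ∀ i ∈ s, (f i).1 + (f i).2.1 + (f i).2.2 ≤ N)
    (hcard : (N + 1) * (d * (d - 1)) < s.card) :
    ∃ c : ι → k, (∃ i ∈ s, c i ≠ 0) ∧ ∀ x y z, ev (x, y) h = 0 → ev (x, z) h = 0 → y ≠ z →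
      ∑ i ∈ s, c i * (x ^ (f i).1 * y ^ (f i).2.1 * z ^ (f i).2.2) = 0 := by
  classical
  let W := {w : k × k × k // ev (w.1, w.2.1) h = 0 ∧ ev (w.1, w.2.2) h = 0 ∧ w.2.1 ≠ w.2.2}
  let ξ : W → k := fun w => w.1.1
  let η : W → k := fun w => w.1.2.1
  let ζ : W → k := fun w => w.1.2.2
  have haev : ∀ (p : k[X]) (w : W), Polynomial.aeval ξ p w = p.eval w.1.1 := by
    intro p w
    have := (Polynomial.aeval_algHom_apply (Pi.evalAlgHom k (fun _ : W => k) w) ξ p)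
    rw [Polynomial.coe_aeval_eq_eval] at this
    exact this.symm
  have hη : ∑ b ∈ Finset.range (d + 1), Polynomial.aeval ξ (h.coeff b) * η ^ b = 0 := by
    funext w
    rw [Finset.sum_apply, Pi.zero_apply, ← w.2.1, ev_eq_sum _ hd.le]
    exact Finset.sum_congr rfl fun b _ => by rw [Pi.mul_apply, haev]; rfl
  have hζ : ∑ b ∈ Finset.range (d + 1), Polynomial.aeval ξ (h.coeff b) *
      ∑ c ∈ Finset.range b, ζ ^ c * η ^ (b - 1 - c) = 0 := by
    funext w
    refine (mul_eq_zero_iff_right (sub_ne_zero.2 w.2.2.2.symm)).1 ?_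
    have h1 := congrArg₂ (· - ·) w.2.2.1 w.2.1
    simp only [ev_eq_sum _ hd.le, sub_zero] at h1
    rw [Finset.sum_apply, Finset.sum_mul]
    refine Eq.trans ?_ h1
    rw [← Finset.sum_sub_distrib]
    refine Finset.sum_congr rfl fun b _ => ?_
    rw [Pi.mul_apply, haev, mul_assoc, ← mul_sub, ← geom_sum₂_mul, Finset.sum_apply]
    rfl
  let T : Finset (W → k) := (Finset.range (N + 1) ×ˢ (Finset.range d ×ˢ Finset.range (d - 1))).image
    fun e => ξ ^ e.1 * η ^ e.2.1 * ζ ^ e.2.2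
  have hmem := mon_mem_span (S := Submodule.span k (T : Set (W → k))) hh hd hη hζ N (by
    intro i j l hi hj hl
    refine Submodule.subset_span ?_
    rw [Finset.mem_coe, Finset.mem_image]
    exact ⟨(i, j, l), by simp; omega, rfl⟩)
  obtain ⟨c, hc, hne⟩ := exists_sum_smul_eq_zero s
    (fun i => ξ ^ (f i).1 * η ^ (f i).2.1 * ζ ^ (f i).2.2) T
    (fun i hi => hmem _ _ _ (hf i hi)) (lt_of_le_of_lt Finset.card_image_le (by simpa using hcard))
  refine ⟨c, hne, fun x y z h1 h2 h3 => ?_⟩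
  have := congrFun hc ⟨(x, y, z), h1, h2, h3⟩
  rw [Finset.sum_apply] at this
  exact this

/-- The auxiliary polynomial of Stepanov's method. -/
theorem Good.exists_auxiliary [IsAlgClosed k] [CharP k 2] {h : k[X][Y]} (hh : Good h)
    (hirr : Irreducible h) (hder : Polynomial.derivative h ≠ 0) {d ρ s : ℕ}
    (hd : h.natDegree = d) (hfix : sig k (s + ρ) h = h) (hρ : d * (d + 2 * d ^ 2) < 2 ^ ρ)
    (hs : 8 * d ^ 2 + 8 ≤ 2 ^ s) :
    ∃ G, ¬ h ∣ G ∧ tdeg G ≤ (d + 2 * d ^ 2) + 2 ^ ρ * (2 ^ s - 2) ∧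
      ∀ x y, ev (x, y) h = 0 → x ^ 2 ^ (s + ρ) = x → y ^ 2 ^ (s + ρ) ≠ y → ev (x, y) G = 0 := by
  classical
  have hd1 : 1 ≤ d := by
    by_contra! h0
    have h0 : h.natDegree = 0 := by omega
    rw [Polynomial.natDegree_eq_zero] at h0
    obtain ⟨s, rfl⟩ := h0
    exact hder Polynomial.derivative_C
  obtain ⟨ψ, hψ, hord⟩ := hh.exists_branch hirr hder
  obtain ⟨Q, hQ⟩ : ∃ Q, Q = 2 ^ s := ⟨_, rfl⟩
  obtain ⟨R, hR⟩ : ∃ R, R = 2 ^ ρ := ⟨_, rfl⟩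
  have hq : 2 ^ (s + ρ) = R * Q := by rw [pow_add, hQ, hR, mul_comm]
  rw [← hQ] at hs
  rw [← hR] at hρ
  have hdd : d ≤ d ^ 2 := by nlinarith
  obtain ⟨I, hI⟩ : ∃ I, I = tri d (d + 2 * d ^ 2) := ⟨_, rfl⟩
  obtain ⟨J, hJ⟩ : ∃ J, J = tri d (d + (Q - 2 - d)) := ⟨_, rfl⟩
  have hIc : d * (2 * d ^ 2) ≤ I.card := hI ▸ le_card_tri _ _
  have hJc : d * (Q - 2 - d) ≤ J.card := hJ ▸ le_card_tri _ _
  have hIm : ∀ e ∈ I, e.2 < d ∧ e.1 + e.2 < d + 2 * d ^ 2 := fun e he => mem_tri.1 (hI ▸ he)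
  have hJm : ∀ e ∈ J, e.2 < d ∧ e.1 + e.2 < Q - 2 := fun e he => by
    have := mem_tri.1 (hJ ▸ he)
    omega
  obtain ⟨c, hne, hc⟩ := hh.exists_relation hd (I ×ˢ J)
    (fun e => (Q * e.1.1 + e.2.1, Q * e.1.2, e.2.2)) (Q * (d + 2 * d ^ 2) - 1) (by
      rintro ⟨i, j⟩ he
      rw [Finset.mem_product] at he
      have h1 := hIm i he.1
      have h2 := hJm j he.2
      have h3 : Q * (i.1 + i.2) + Q ≤ Q * (d + 2 * d ^ 2) := by
        rw [← Nat.mul_succ]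
        exact Nat.mul_le_mul_left _ h1.2
      rw [mul_add] at h3
      simp only
      omega) (by
    rw [Finset.card_product]
    refine lt_of_lt_of_le ?_ (Nat.mul_le_mul hIc hJc)
    have : 1 ≤ Q * (d + 2 * d ^ 2) := Nat.mul_pos (by omega) (by omega)
    rw [Nat.sub_add_cancel this]
    obtain ⟨t, rfl⟩ : ∃ t, Q = t + 2 + d := ⟨Q - 2 - d, by omega⟩
    obtain ⟨r, rfl⟩ : ∃ r, d = r + 1 := ⟨d - 1, by omega⟩
    rw [show t + 2 + (r + 1) - 2 - (r + 1) = t by omega, show r + 1 - 1 = r by omega]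
    have : 6 * (r + 1) ^ 2 + 6 ≤ t := by nlinarith
    have h1 : (r + 1) ^ 2 * r * (2 * r + 3) * (t + 2 + (r + 1)) <
        (r + 1) ^ 2 * (2 * (r + 1) ^ 2 * t) := by
      rw [mul_assoc ((r + 1) ^ 2), mul_assoc ((r + 1) ^ 2)]
      refine Nat.mul_lt_mul_of_pos_left ?_ (by positivity)
      nlinarith
    calc _ = (r + 1) ^ 2 * r * (2 * r + 3) * (t + 2 + (r + 1)) := by ring
      _ < _ := h1
      _ = _ := by ring)
  choose c' hc' using fun e => IsAlgClosed.exists_pow_nat_eq (c e) (n := Q) (by omega)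
  have htri : ∀ p N, p ∈ supp k (tri d N) → ψ p = 0 → p = 0 := by
    intro p N hp h0
    by_contra hp0
    refine hord p (fun hdvd => hp0 (hh.eq_zero_of_dvd (hd ▸ hp) hdvd)) _ le_rfl ?_
    rw [h0]
    exact dvd_zero _
  refine ⟨∑ e ∈ I ×ˢ J, c' e • (mon e.1.1 e.1.2 * mon e.2.1 e.2.2 ^ R), ?_, ?_, ?_⟩
  · rintro ⟨w, hw⟩
    have h1 := congrArg ψ hw
    rw [map_mul, hψ, zero_mul, map_sum, Finset.sum_product_right] at h1
    have h2 := eq_zero_of_sum_mul_pow_eq_zero (p := 2) ρ ((supp k I).map ψ.toLinearMap) (by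
        rintro _ ⟨p, hp, rfl⟩ h0
        intro hdvd
        refine hord p (fun ⟨w, hw⟩ => h0 ?_) (d + 2 * d ^ 2)
          (tdeg_lt_of_mem_supp_tri (m := d) (by omega) (hI ▸ hp)).le
          ((pow_dvd_pow _ ?_).trans hdvd)
        · rw [hw]
          simp [hψ]
        · rw [hd, ← hR]
          omega) J (fun j => ψ (mon j.1 j.2)) (by
        intro b hb
        refine eq_zero_of_sum_smul_mon_eq_zero (htri _ (d + (Q - 2 - d)) (hJ ▸
          sum_smul_mon_mem_supp J b) ?_)
        rw [map_sum]
        simpa using hb)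
      (fun j => ψ (∑ i ∈ I, c' (i, j) • mon i.1 i.2))
      (fun j _ => ⟨_, sum_smul_mon_mem_supp I fun i => c' (i, j), rfl⟩) (by
        rw [← h1]
        refine Finset.sum_congr rfl fun j _ => ?_
        rw [map_sum, Finset.sum_mul]
        refine Finset.sum_congr rfl fun i _ => ?_
        rw [map_smul, map_smul, smul_mul_assoc, ← hR, ← map_pow ψ _ R, ← map_mul])
    obtain ⟨⟨i, j⟩, he, hne⟩ := hne
    rw [Finset.mem_product] at he
    apply hne
    rw [← hc']
    have h3 := htri (∑ i ∈ I, c' (i, j) • mon i.1 i.2) (d + 2 * d ^ 2) (by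
      rw [← hI]
      exact sum_smul_mon_mem_supp I fun i => c' (i, j)) (h2 j he.2)
    have h3 := eq_zero_of_sum_smul_mon_eq_zero h3 i he.1
    rw [h3, zero_pow (by omega)]
  · refine tdeg_sum_le _ _ fun e he => (tdeg_smul_le _ _).trans ((tdeg_mul_le _ _).trans ?_)
    rw [Finset.mem_product] at he
    rw [← hR, ← hQ]
    refine Nat.add_le_add ((tdeg_mon_le _ _).trans (hIm _ he.1).2.le)
      ((tdeg_pow_le _ _).trans (Nat.mul_le_mul_left _ ((tdeg_mon_le _ _).trans (hJm _ he.2).2.le)))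
  · intro x y h1 h2 h3
    have h4 : ev (x, y ^ 2 ^ (s + ρ)) h = 0 := by
      have := ev_sig (s + ρ) x y h
      rw [hfix, h1, h2, zero_pow (by positivity)] at this
      exact this
    have h5 := hc x y _ h1 h4 h3.symm
    refine eq_zero_of_pow_eq_zero (n := Q) ?_
    rw [← h5, map_sum, hQ, sum_pow_char_pow]
    refine Finset.sum_congr rfl fun e _ => ?_
    rw [← hQ, map_smul, smul_eq_mul, mul_pow, hc', map_mul, map_pow, mon, mon, map_mul, map_mul,
      map_pow, map_pow, map_pow, map_pow, ev_xv, ev_yv]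
    congr 1
    rw [mul_pow, ← pow_mul (x ^ e.2.1 * y ^ e.2.2), ← hq, mul_pow (x ^ e.2.1), ← pow_mul x e.2.1,
      mul_comm e.2.1, pow_mul x _ e.2.1, h2]
    simp only
    ring

end Stepanov

section RationalPoints

variable {k : Type*} [Field k]

theorem Good.card_roots_fiber [IsAlgClosed k] [DecidableEq k] {h : k[X][Y]} (hh : Good h) {x : k}
    (hx : ∀ y, ev (x, y) h = 0 → ev (x, y) (Polynomial.derivative h) ≠ 0) :
    (h.map (Polynomial.evalRingHom x)).roots.toFinset.card = h.natDegree := by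
  have hne : h.map (Polynomial.evalRingHom x) ≠ 0 := (hh.monic.map _).ne_zero
  have hnodup : (h.map (Polynomial.evalRingHom x)).roots.Nodup := by
    refine Polynomial.nodup_roots_iff_of_splits hne (IsAlgClosed.splits _) |>.2 ?_
    refine (isCoprime_of_dvd _ _ (fun h => hne h.1) fun z hz _ h1 h2 => ?_)
    obtain ⟨y, hy⟩ := IsAlgClosed.exists_root z (fun h0 => hz
      (Polynomial.isUnit_iff_degree_eq_zero.2 h0))
    refine hx y ?_ ?_
    · rw [ev_eq_eval_map]
      exact Polynomial.eval_eq_zero_of_dvd_of_eval_eq_zero h1 hy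
    · rw [ev_eq_eval_map, ← Polynomial.derivative_map]
      exact Polynomial.eval_eq_zero_of_dvd_of_eval_eq_zero h2 hy
  rw [Multiset.toFinset_card_of_nodup hnodup, ← (IsAlgClosed.splits _).natDegree_eq_card_roots,
    hh.monic.natDegree_map]

/-- A plane curve over a large finite field has rational points outside any given divisor. -/
theorem exists_rational_point (d E : ℕ) : ∃ N, ∀ (k : Type) [Field k] [IsAlgClosed k] [CharP k 2]
    (n : ℕ), N ≤ n → ∀ h g : k[X][Y], Good h → Irreducible h → Polynomial.derivative h ≠ 0 →
      h.natDegree = d → sig k n h = h → ¬ h ∣ g → tdeg g ≤ E →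
        ∃ x y, x ^ 2 ^ n = x ∧ y ^ 2 ^ n = y ∧ ev (x, y) h = 0 ∧ ev (x, y) g ≠ 0 := by
  obtain ⟨ρ, hρ⟩ : ∃ ρ, ρ = d * (d + 2 * d ^ 2) + 3 * d ^ 2 + d + E + 1 := ⟨_, rfl⟩
  refine ⟨ρ + (8 * d ^ 2 + 8), fun k _ _ _ n hn h g hh hirr hder hd hfix hg hgE => ?_⟩
  classical
  obtain ⟨s, rfl⟩ : ∃ s, n = s + ρ := ⟨n - ρ, by omega⟩
  have hRρ : ρ < 2 ^ ρ := Nat.lt_two_pow_self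
  have hQs : s < 2 ^ s := Nat.lt_two_pow_self
  obtain ⟨G, hG, hGd, hGz⟩ := hh.exists_auxiliary hirr hder hd hfix (by omega) (by omega)
  have hd1 : 1 ≤ d := by
    by_contra! h0
    have h0 : h.natDegree = 0 := by omega
    rw [Polynomial.natDegree_eq_zero] at h0
    obtain ⟨s, rfl⟩ := h0
    exact hder Polynomial.derivative_C
  obtain ⟨r, hr0, hrd, b, c, hr⟩ := hh.exists_eliminant hirr (hh.not_dvd_derivative hder)
    ((tdeg_derivative_le h).trans (hh.tdeg_le.trans hd.le))
  by_contra! hall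
  obtain ⟨q, hq⟩ : ∃ q, q = 2 ^ (s + ρ) := ⟨_, rfl⟩
  rw [← hq] at hall hGz
  have hq2 : 2 ≤ q := by
    rw [hq]
    exact Nat.le_self_pow (by omega) 2
  have hXq : (Polynomial.X ^ q - Polynomial.X : k[X]) ≠ 0 :=
    FiniteField.X_pow_card_sub_X_ne_zero k (by omega)
  obtain ⟨Fq, hFq⟩ : ∃ Fq, Fq = (Polynomial.X ^ q - Polynomial.X : k[X]).roots.toFinset := ⟨_, rfl⟩
  have hFqm : ∀ x ∈ Fq, x ^ q = x := by
    intro x hx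
    rw [hFq, Multiset.mem_toFinset, Polynomial.mem_roots hXq] at hx
    simpa [sub_eq_zero] using hx
  have hFqc : Fq.card = q := by
    have hsep : (Polynomial.X ^ q - Polynomial.X : k[X]).Separable :=
      galois_poly_separable 2 q (hq ▸ dvd_pow_self 2 (by omega))
    rw [hFq, Multiset.toFinset_card_of_nodup (Polynomial.nodup_roots hsep),
      ← (IsAlgClosed.splits _).natDegree_eq_card_roots, FiniteField.X_pow_card_sub_X_natDegree_eq]
    omega
  obtain ⟨U, hU⟩ : ∃ U, U = Fq.filter fun x => r.eval x ≠ 0 := ⟨_, rfl⟩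
  have hUc : q ≤ U.card + d * d := by
    have h1 := Finset.card_filter_add_card_filter_not (s := Fq) (fun x => r.eval x ≠ 0)
    have h2 : (Fq.filter fun x => ¬ r.eval x ≠ 0).card ≤ d * d := by
      rw [hd] at hrd
      refine le_trans (Finset.card_le_card (t := r.roots.toFinset) fun x hx => ?_)
        ((Multiset.toFinset_card_le _).trans ((Polynomial.card_roots' r).trans hrd))
      rw [Multiset.mem_toFinset, Polynomial.mem_roots hr0]
      exact not_not.1 (Finset.mem_filter.1 hx).2
    rw [← hU, hFqc] at h1
    omega
  let pts : Finset (k × k) := (U.sigma fun x =>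
    (h.map (Polynomial.evalRingHom x)).roots.toFinset).map (Equiv.sigmaEquivProd k k).toEmbedding
  have hpts : ∀ P ∈ pts, P.1 ^ q = P.1 ∧ ev P h = 0 := by
    intro P hP
    obtain ⟨⟨x, y⟩, he, rfl⟩ := Finset.mem_map.1 hP
    obtain ⟨h1, h2⟩ := Finset.mem_sigma.1 he
    rw [hU] at h1
    refine ⟨hFqm _ (Finset.mem_filter.1 h1).1, ?_⟩
    rw [ev_eq_eval_map]
    exact (Polynomial.mem_roots'.1 (Multiset.mem_toFinset.1 h2)).2
  have hcard : pts.card = U.card * d := by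
    rw [Finset.card_map, Finset.card_sigma, Finset.sum_const_nat]
    intro x hx
    rw [hh.card_roots_fiber, hd]
    intro y hy h0
    have := congrArg (ev (x, y)) hr
    rw [map_add, map_mul, map_mul, hy, h0, ev_C] at this
    rw [hU] at hx
    exact (Finset.mem_filter.1 hx).2 (by simpa using this)
  have h1 := hh.card_zeros_le hirr hG hGd (pts.filter fun P => ev P G = 0)
    (fun P hP => ⟨(hpts P (Finset.mem_filter.1 hP).1).2, (Finset.mem_filter.1 hP).2⟩)
  have h2 := hh.card_zeros_le hirr hg hgE (pts.filter fun P => ¬ ev P G = 0) (fun P hP => by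
    obtain ⟨hP1, hP2⟩ := Finset.mem_filter.1 hP
    obtain ⟨h3, h4⟩ := hpts P hP1
    refine ⟨h4, hall P.1 P.2 h3 (not_not.1 fun h5 => hP2 (hGz P.1 P.2 h4 h3 h5)) h4⟩)
  have h3 := Finset.card_filter_add_card_filter_not (s := pts) (fun P => ev P G = 0)
  rw [hcard] at h3
  rw [hd] at h1 h2
  have h4 : U.card * d ≤ (d + 2 * d ^ 2 + 2 ^ ρ * (2 ^ s - 2) + E) * d := by
    rw [← h3]
    nlinarith
  have h5 := Nat.le_of_mul_le_mul_right h4 (by omega)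
  have h6 : 2 ^ ρ * (2 ^ s - 2) + 2 ^ ρ * 2 = q := by
    rw [← mul_add, Nat.sub_add_cancel (by omega), hq, pow_add, mul_comm]
  nlinarith

end RationalPoints

section MonomialCurve

variable {k : Type*} [Field k]

theorem tdeg_xv_le : tdeg (xv : k[X][Y]) ≤ 1 := by
  have := tdeg_mon_le (k := k) 1 0
  rwa [mon, pow_one, pow_zero, mul_one] at this

theorem tdeg_yv_le : tdeg (yv : k[X][Y]) ≤ 1 := by
  have := tdeg_mon_le (k := k) 0 1
  rwa [mon, pow_one, pow_zero, one_mul] at this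

theorem tdeg_cst_le (a : k) (n : ℕ) : tdeg (cst a : k[X][Y]) ≤ n := by
  have := (tdeg_smul_le a (mon 0 0 : k[X][Y])).trans (tdeg_mon_le (k := k) 0 0)
  rw [mon, pow_zero, pow_zero, mul_one, ← Algebra.algebraMap_eq_smul_one] at this
  exact this.trans (Nat.zero_le n)

theorem monic_linear (a b : k) : (xv * cst a + yv + cst b : k[X][Y]).Monic ∧
    (xv * cst a + yv + cst b : k[X][Y]).natDegree = 1 := by
  have : (xv * cst a + yv + cst b : k[X][Y]) = yv + Polynomial.C (Polynomial.X * Polynomial.C a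
      + Polynomial.C b) := by
    simp only [cst, xv, yv, Polynomial.C_add, Polynomial.C_mul]; ring
  rw [this]
  exact ⟨Polynomial.monic_X_add_C _, Polynomial.natDegree_X_add_C _⟩

theorem prime_linear (a b : k) : Prime (xv * cst a + yv + cst b : k[X][Y]) := by
  have : (xv * cst a + yv + cst b : k[X][Y]) = yv - Polynomial.C (-(Polynomial.X * Polynomial.C a
      + Polynomial.C b)) := by
    simp only [cst, xv, yv, Polynomial.C_add, Polynomial.C_mul, Polynomial.C_neg]; ring
  rw [this]
  exact Polynomial.prime_X_sub_C _

theorem tdeg_linear_le (a b : k) : tdeg (xv * cst a + yv + cst b : k[X][Y]) ≤ 1 := by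
  refine tdeg_add_le (tdeg_add_le ?_ tdeg_yv_le) (tdeg_cst_le b 1)
  exact (tdeg_mul_le _ _).trans (add_le_add tdeg_xv_le (tdeg_cst_le a 0))

theorem natDegree_pow_mul_pow_le (i j : ℕ) :
    ((xv + yv + 1 : k[X][Y]) ^ i * yv ^ j).natDegree ≤ i + j ∧
      tdeg ((xv + yv + 1 : k[X][Y]) ^ i * yv ^ j) ≤ i + j ∧
      ((xv + yv + 1 : k[X][Y]) ^ i * yv ^ j).coeff (i + j) = 1 := by
  have h1 : (xv + yv + 1 : k[X][Y]) = xv * cst 1 + yv + cst 1 := by simp [cst]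
  have hm := monic_linear (1 : k) 1
  have hd : ((xv + yv + 1 : k[X][Y]) ^ i * yv ^ j).natDegree = i + j := by
    rw [h1, (hm.1.pow i).natDegree_mul (Polynomial.monic_X_pow j), hm.1.natDegree_pow, hm.2]
    simp
  refine ⟨hd.le, ?_, ?_⟩
  · refine (tdeg_mul_le _ _).trans (add_le_add ((tdeg_pow_le _ _).trans ?_)
      ((tdeg_pow_le _ _).trans ?_))
    · rw [h1]
      exact (Nat.mul_le_mul_left _ (tdeg_linear_le (1 : k) 1)).trans (by simp)
    · exact (Nat.mul_le_mul_left _ tdeg_yv_le).trans (by simp)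
  · rw [← hd, h1]
    exact ((hm.1.pow i).mul (Polynomial.monic_X_pow j)).coeff_natDegree

/-- The polynomial `x^t + y^t + 1 + (x + y + 1)^t`. -/
noncomputable def quad (k : Type*) [Field k] (t : ℕ) : k[X][Y] :=
  xv ^ t + yv ^ t + 1 + (xv + yv + 1) ^ t

variable [CharP k 2]

theorem exists_quad_eq {t : ℕ} (ht : Odd t) (h3 : 3 ≤ t) :
    ∃ g : k[X][Y], Good g ∧ g.natDegree = t - 3 ∧
      quad k t = (xv + 1) * ((yv + 1) * ((xv + yv) * g)) := by
  obtain ⟨G, hG⟩ : ∃ G : k[X][Y], G = ∑ i ∈ Finset.range t, (xv + yv + 1) ^ i * yv ^ (t - 1 - i) +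
    ∑ i ∈ Finset.range t, xv ^ i := ⟨_, rfl⟩
  have hF : quad k t = (xv + 1) * G := by
    have e1 := mul_geom_sum (xv : k[X][Y]) t
    have e2 := geom_sum₂_mul (xv + yv + 1 : k[X][Y]) yv t
    simp only [CharTwo.sub_eq_add] at e1 e2
    rw [show (xv + yv + 1 + yv : k[X][Y]) = xv + 1 by
      linear_combination CharTwo.add_self_eq_zero (yv : k[X][Y])] at e2
    rw [hG, mul_add, mul_comm _ (∑ i ∈ Finset.range t, (xv + yv + 1) ^ i * _), e2, e1, quad]
    ring
  have hcoeff : G.coeff (t - 1) = 1 := by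
    rw [hG, Polynomial.coeff_add, Polynomial.finsetSum_coeff,
      Finset.sum_congr rfl (g := fun _ => 1)]
    · rw [Polynomial.finsetSum_coeff, Finset.sum_eq_zero (s := Finset.range t) (f := fun i =>
        (xv ^ i : k[X][Y]).coeff (t - 1))]
      · obtain ⟨r, rfl⟩ := ht
        simp [CharTwo.two_eq_zero]
      · intro i _
        rw [xv, ← Polynomial.C_pow, Polynomial.coeff_C, if_neg (by omega)]
    · intro i hi
      have := Finset.mem_range.1 hi
      convert (natDegree_pow_mul_pow_le (k := k) i (t - 1 - i)).2.2 using 2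
      omega
  have hdeg : tdeg G ≤ t - 1 := by
    rw [hG]
    refine tdeg_add_le (tdeg_sum_le _ _ fun i hi => ?_) (tdeg_sum_le _ _ fun i hi => ?_)
    · have := Finset.mem_range.1 hi
      exact (natDegree_pow_mul_pow_le (k := k) i (t - 1 - i)).2.1.trans (by omega)
    · have := Finset.mem_range.1 hi
      refine (tdeg_pow_le _ _).trans ((Nat.mul_le_mul_left _ tdeg_xv_le).trans ?_)
      omega
  have hmonic : G.Monic := Polynomial.monic_of_natDegree_le_of_coeff_eq_one _
    ((natDegree_le_tdeg G).trans hdeg) hcoeff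
  have hnat : G.natDegree = t - 1 := le_antisymm ((natDegree_le_tdeg G).trans hdeg)
    (Polynomial.le_natDegree_of_ne_zero (by rw [hcoeff]; exact one_ne_zero))
  have hGood : Good G := ⟨hmonic, by rw [hnat]; exact hdeg⟩
  have p1 : Prime (yv + 1 : k[X][Y]) := by simpa [cst] using prime_linear (0 : k) 1
  have p2 : Prime (xv + yv : k[X][Y]) := by simpa [cst] using prime_linear (1 : k) 0
  have m1 : (yv + 1 : k[X][Y]).Monic ∧ (yv + 1 : k[X][Y]).natDegree = 1 := by
    simpa [cst] using monic_linear (0 : k) 1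
  have m2 : (xv + yv : k[X][Y]).Monic ∧ (xv + yv : k[X][Y]).natDegree = 1 := by
    simpa [cst] using monic_linear (1 : k) 0
  have two : (1 + 1 : k[X][Y]) = 0 := CharTwo.add_self_eq_zero 1
  have d1 : (yv + 1 : k[X][Y]) ∣ (xv + 1) * G := by
    rw [← hF]
    have h : (yv + 1 : k[X][Y]) ∣ (xv + yv + 1) ^ t - xv ^ t := by
      refine dvd_trans ?_ (sub_dvd_pow_sub_pow _ _ t)
      exact ⟨1, by ring⟩
    have h' : (yv + 1 : k[X][Y]) ∣ yv ^ t - 1 ^ t := by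
      refine dvd_trans ?_ (sub_dvd_pow_sub_pow _ _ t)
      exact ⟨1, by rw [CharTwo.sub_eq_add]; ring⟩
    have := dvd_add h h'
    simp only [CharTwo.sub_eq_add, one_pow] at this
    convert this using 1
    rw [quad]; ring
  have d2 : (xv + yv : k[X][Y]) ∣ (xv + 1) * G := by
    rw [← hF]
    have h : (xv + yv : k[X][Y]) ∣ (xv + yv + 1) ^ t - 1 ^ t := by
      refine dvd_trans ?_ (sub_dvd_pow_sub_pow _ _ t)
      exact ⟨1, by ring⟩
    have h' : (xv + yv : k[X][Y]) ∣ xv ^ t - yv ^ t := by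
      refine dvd_trans ?_ (sub_dvd_pow_sub_pow _ _ t)
      exact ⟨1, by rw [CharTwo.sub_eq_add]; ring⟩
    have := dvd_add h h'
    simp only [CharTwo.sub_eq_add, one_pow] at this
    convert this using 1
    rw [quad]; ring
  have n1 : ¬ (yv + 1 : k[X][Y]) ∣ xv + 1 := by
    rintro ⟨c, hc⟩
    have := congrArg (ev ((0 : k), (1 : k))) hc
    simp [CharTwo.add_self_eq_zero] at this
  have n2 : ¬ (xv + yv : k[X][Y]) ∣ xv + 1 := by
    rintro ⟨c, hc⟩
    have := congrArg (ev ((0 : k), (0 : k))) hc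
    simp at this
  have n3 : ¬ (xv + yv : k[X][Y]) ∣ yv + 1 := by
    rintro ⟨c, hc⟩
    have := congrArg (ev ((0 : k), (0 : k))) hc
    simp at this
  obtain ⟨G', hG'⟩ := (p1.dvd_or_dvd d1).resolve_left n1
  obtain ⟨g, hg⟩ := (p2.dvd_or_dvd (hG' ▸ (p2.dvd_or_dvd d2).resolve_left n2)).resolve_left n3
  subst hg
  have mG' : ((xv + yv) * g).Monic := m1.1.of_mul_monic_left (hG' ▸ hmonic)
  have mg : g.Monic := m2.1.of_mul_monic_left mG'
  refine ⟨g, hGood.of_dvd mg ⟨(yv + 1) * (xv + yv), by rw [hG']; ring⟩, ?_, by rw [hF, hG']⟩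
  rw [hG', m1.1.natDegree_mul mG', m2.1.natDegree_mul mg, m1.2, m2.2] at hnat
  omega

end MonomialCurve

section Multiplicity

variable {k : Type*} [Field k]

/-- The multiplicity of a point on a curve. -/
noncomputable def mult (P : k × k) (p : k[X][Y]) : ℕ := (loc P p).natTrailingDegree

/-- The initial form of a polynomial at a point. -/
noncomputable def ini (P : k × k) (p : k[X][Y]) : k[X][Y] := (loc P p).trailingCoeff

theorem loc_eq_zero {P : k × k} {p : k[X][Y]} : loc P p = 0 ↔ p = 0 :=
  map_eq_zero_iff (loc P) (loc_injective P)

theorem mult_mul {P : k × k} {p q : k[X][Y]} (hp : p ≠ 0) (hq : q ≠ 0) :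
    mult P (p * q) = mult P p + mult P q := by
  rw [mult, map_mul, Polynomial.natTrailingDegree_mul (loc_eq_zero.not.2 hp) (loc_eq_zero.not.2 hq)]
  rfl

theorem ini_mul (P : k × k) (p q : k[X][Y]) : ini P (p * q) = ini P p * ini P q := by
  rw [ini, map_mul, Polynomial.trailingCoeff_mul]; rfl

theorem X_pow_mult_dvd (P : k × k) (p : k[X][Y]) : Polynomial.X ^ mult P p ∣ loc P p :=
  Polynomial.X_pow_dvd_iff.2 fun _ h => Polynomial.coeff_eq_zero_of_lt_natTrailingDegree h

theorem mult_prod {ι : Type*} (P : k × k) (s : Finset ι) (f : ι → k[X][Y]) (h : ∀ i ∈ s, f i ≠ 0) :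
    mult P (∏ i ∈ s, f i) = ∑ i ∈ s, mult P (f i) := by
  classical
  induction s using Finset.induction_on with
  | empty => simp [mult]
  | insert a s ha ih =>
    rw [Finset.prod_insert ha, Finset.sum_insert ha,
      mult_mul (h a (by simp)) (Finset.prod_ne_zero_iff.2 fun i hi => h i (by simp [hi])),
      ih fun i hi => h i (by simp [hi])]

theorem hom_cst (a : k) : hom (cst a : k[X][Y]) = Polynomial.C (cst a) := hom.commutes a

@[simp]
theorem loc_cst (P : k × k) (a : k) : loc P (cst a : k[X][Y]) = Polynomial.C (cst a) :=
  (loc P).commutes a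

@[simp]
theorem loc_xv (P : k × k) : loc P (xv : k[X][Y]) =
    Polynomial.C (cst P.1) + Polynomial.C xv * Polynomial.X := by
  rw [loc, AlgHom.comp_apply, shift_xv, map_add, hom_xv, hom_cst, add_comm]

@[simp]
theorem loc_yv (P : k × k) : loc P (yv : k[X][Y]) =
    Polynomial.C (cst P.2) + Polynomial.C yv * Polynomial.X := by
  rw [loc, AlgHom.comp_apply, shift_yv, map_add, hom_yv, hom_cst, add_comm]

theorem loc_coeff_zero (P : k × k) (p : k[X][Y]) : (loc P p).coeff 0 = cst (ev P p) := by
  have : ((Polynomial.aeval (0 : k[X][Y])).restrictScalars k).comp (loc P) =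
      (Algebra.ofId k (k[X][Y])).comp (ev P) := by
    apply algHom_ext_xy
    · rw [AlgHom.comp_apply, loc_xv]
      simp [Algebra.ofId_apply]
    · rw [AlgHom.comp_apply, loc_yv]
      simp [Algebra.ofId_apply]
  have := congrArg (fun F : k[X][Y] →ₐ[k] k[X][Y] => F p) this
  simp only [AlgHom.comp_apply, AlgHom.restrictScalars_apply] at this
  rw [Polynomial.coeff_zero_eq_aeval_zero, this]
  rfl

theorem tdeg_coeff_loc_le (P : k × k) (p : k[X][Y]) (n : ℕ) : tdeg ((loc P p).coeff n) ≤ n := by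
  refine tdeg_le_iff.2 fun i j h => ?_
  rw [loc, AlgHom.comp_apply, coeff_hom, ne_eq, ite_eq_right_iff, Classical.not_imp] at h
  exact h.1.le

theorem mult_pos {P : k × k} {p : k[X][Y]} (hp : p ≠ 0) (h : ev P p = 0) : 0 < mult P p := by
  rw [Nat.pos_iff_ne_zero, mult, ne_eq, Polynomial.natTrailingDegree_eq_zero, loc_coeff_zero, h]
  simpa [cst, loc_eq_zero] using hp

theorem locLE_mult {u v : k[X][Y]} {P : k × k} (h : IsRelPrime (ini P u) (ini P v)) :
    LocLE u v P (mult P u * mult P v) :=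
  locLE_mul (X_pow_mult_dvd P u) (X_pow_mult_dvd P v) h

theorem isUnit_cst {a : k} (h : a ≠ 0) : IsUnit (cst a : k[X][Y]) :=
  ((isUnit_iff_ne_zero.2 h).map Polynomial.C).map Polynomial.C

theorem locLE_zero {u v : k[X][Y]} {P : k × k} (h : ¬ (ev P u = 0 ∧ ev P v = 0)) :
    LocLE u v P 0 := by
  have key : ∀ u v : k[X][Y], ev P u ≠ 0 → LocLE u v P 0 := by
    intro u v h
    have := locLE_mul (u := u) (v := v) (P := P) (r := 0) (s := 0) (by simp) (by simp) (by
      rw [loc_coeff_zero P u]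
      exact (isUnit_cst h).isRelPrime_left)
    simpa using this
  by_cases hu : ev P u = 0
  · exact (key v u fun hv => h ⟨hu, hv⟩).symm
  · exact key u v hu

end Multiplicity

section Expansion

theorem pow_expansion {A : Type*} [CommRing A] [CharP A 2] (a z : A) (i : ℕ) {l : ℕ} (hl : Odd l) :
    ∃ K : A[X], (Polynomial.C a + Polynomial.C z * Polynomial.X) ^ (2 ^ i * l + 1) =
      Polynomial.C (a ^ (2 ^ i * l + 1)) + Polynomial.C (a ^ (2 ^ i * l) * z) * Polynomial.X +
      Polynomial.C (a * (a ^ (l - 1)) ^ 2 ^ i * z ^ 2 ^ i) * Polynomial.X ^ 2 ^ i +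
      Polynomial.C ((a ^ (l - 1)) ^ 2 ^ i * z ^ (2 ^ i + 1)) * Polynomial.X ^ (2 ^ i + 1) +
      Polynomial.X ^ (2 * 2 ^ i) * K := by
  obtain ⟨K, hK⟩ := Polynomial.powAddExpansion
    ((Polynomial.C a) ^ 2 ^ i) ((Polynomial.C z * Polynomial.X) ^ 2 ^ i) l
  have h1 : (l : A[X]) = 1 := by
    obtain ⟨r, rfl⟩ := hl
    push_cast
    rw [CharTwo.two_eq_zero]; ring
  refine ⟨(Polynomial.C a + Polynomial.C z * Polynomial.X) * K * Polynomial.C z ^ (2 * 2 ^ i), ?_⟩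
  rw [pow_succ, pow_mul, add_pow_char_pow, hK, h1]
  simp only [map_mul, map_pow]
  ring

variable {k : Type*} [Field k] [CharP k 2]

theorem loc_quad (P : k × k) {i l : ℕ} (hi : 1 ≤ i) (hl : Odd l) :
    ∃ K, loc P (quad k (2 ^ i * l + 1)) =
      Polynomial.C (cst (P.1 ^ (2 ^ i * l + 1) + P.2 ^ (2 ^ i * l + 1) + 1 +
        (P.1 + P.2 + 1) ^ (2 ^ i * l + 1))) +
      Polynomial.C (cst (P.1 ^ (2 ^ i * l)) * xv + cst (P.2 ^ (2 ^ i * l)) * yv +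
        cst ((P.1 + P.2 + 1) ^ (2 ^ i * l)) * (xv + yv)) * Polynomial.X +
      Polynomial.C (cst (P.1 * (P.1 ^ (l - 1)) ^ 2 ^ i) * xv ^ 2 ^ i +
        cst (P.2 * (P.2 ^ (l - 1)) ^ 2 ^ i) * yv ^ 2 ^ i +
        cst ((P.1 + P.2 + 1) * ((P.1 + P.2 + 1) ^ (l - 1)) ^ 2 ^ i) * (xv + yv) ^ 2 ^ i) *
        Polynomial.X ^ 2 ^ i +
      Polynomial.C (cst ((P.1 ^ (l - 1)) ^ 2 ^ i) * xv ^ (2 ^ i + 1) +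
        cst ((P.2 ^ (l - 1)) ^ 2 ^ i) * yv ^ (2 ^ i + 1) +
        cst (((P.1 + P.2 + 1) ^ (l - 1)) ^ 2 ^ i) * (xv + yv) ^ (2 ^ i + 1)) *
        Polynomial.X ^ (2 ^ i + 1) +
      Polynomial.X ^ (2 ^ i + 2) * K := by
  obtain ⟨K1, h1⟩ := pow_expansion (cst P.1) (xv : k[X][Y]) i hl
  obtain ⟨K2, h2⟩ := pow_expansion (cst P.2) (yv : k[X][Y]) i hl
  obtain ⟨K3, h3⟩ := pow_expansion (cst (P.1 + P.2 + 1)) (xv + yv : k[X][Y]) i hl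
  obtain ⟨j, hj⟩ : ∃ j, 2 * 2 ^ i = 2 ^ i + 2 + j := Nat.exists_eq_add_of_le (by
    have := Nat.pow_le_pow_right (n := 2) (by norm_num) hi; omega)
  have hw : loc P (xv + yv + 1 : k[X][Y]) = Polynomial.C (cst (P.1 + P.2 + 1)) +
      Polynomial.C (xv + yv) * Polynomial.X := by
    rw [map_add, map_add, loc_xv, loc_yv, map_one]
    simp only [cst, map_add, map_one]
    ring
  refine ⟨Polynomial.X ^ j * (K1 + K2 + K3), ?_⟩
  rw [quad, map_add, map_add, map_add, map_pow, map_pow, map_pow, hw, loc_xv, loc_yv, h1, h2, h3,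
    hj,
    map_one]
  simp only [cst, map_add, map_mul, map_pow, map_one]
  ring

end Expansion

section LeadingForms

variable {k : Type*} [Field k]

theorem prime_xv : Prime (xv : k[X][Y]) := Polynomial.prime_C_iff.2 Polynomial.prime_X

theorem prime_linear_form {a b : k} (h : a ≠ 0 ∨ b ≠ 0) :
    Prime (cst a * xv + cst b * yv : k[X][Y]) := by
  by_cases hb : b = 0
  · have ha : a ≠ 0 := h.resolve_right (not_not.2 hb)
    have : Associated (xv : k[X][Y]) (cst a * xv + cst b * yv) :=
      ⟨(isUnit_cst ha).unit, by simp [hb, cst, mul_comm]⟩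
    exact this.prime prime_xv
  · have : Associated (xv * cst (b⁻¹ * a) + yv + cst 0 : k[X][Y]) (cst a * xv + cst b * yv) := by
      refine ⟨(isUnit_cst hb).unit, ?_⟩
      have h1 : (cst b * cst b⁻¹ : k[X][Y]) = 1 := by
        rw [cst, cst, ← Polynomial.C_mul, ← Polynomial.C_mul, mul_inv_cancel₀ hb]; simp
      simp only [IsUnit.unit_spec]
      have h2 : (cst (b⁻¹ * a) : k[X][Y]) = cst b⁻¹ * cst a := by simp [cst]
      rw [h2]
      simp only [cst, map_zero, add_zero] at h1 ⊢
      linear_combination (xv * Polynomial.C (Polynomial.C a)) * h1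
    exact this.prime (prime_linear _ _)

theorem one_le_tdeg_linear_form {a b : k} (h : a ≠ 0 ∨ b ≠ 0) :
    1 ≤ tdeg (cst a * xv + cst b * yv : k[X][Y]) := by
  rcases h with h | h
  · exact tdeg_le_iff.1 le_rfl 1 0 (by simpa [cst] using h)
  · exact tdeg_le_iff.1 le_rfl 0 1 (by simpa [cst] using h)

theorem not_dvd_xv_yv {p : k[X][Y]} (hp : ¬ IsUnit p) (hx : p ∣ xv) (hy : p ∣ yv) : False := by
  have h1 : p ∣ (yv : k[X][Y]) - xv := dvd_sub hy hx
  rcases (prime_xv (k := k)).irreducible.dvd_iff.1 hx with h | h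
  · exact hp h
  · obtain ⟨c, hc⟩ := h.dvd.trans hy
    have := congrArg (ev ((0 : k), (1 : k))) hc
    simp at this

variable [CharP k 2]

theorem squarefree_form {i : ℕ} (hi : 1 ≤ i) {A B C : k} (h : A * B + A * C + B * C ≠ 0) :
    Squarefree (cst (A ^ 2 ^ i) * xv ^ (2 ^ i + 1) + cst (B ^ 2 ^ i) * yv ^ (2 ^ i + 1) +
      cst (C ^ 2 ^ i) * (xv + yv) ^ (2 ^ i + 1) : k[X][Y]) := by
  obtain ⟨p, hp⟩ : ∃ p : k[X][Y], p = cst (A + C) * xv + cst C * yv := ⟨_, rfl⟩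
  obtain ⟨r, hr⟩ : ∃ r : k[X][Y], r = cst C * xv + cst (B + C) * yv := ⟨_, rfl⟩
  obtain ⟨H, hH⟩ : ∃ H : k[X][Y], H = cst (A ^ 2 ^ i) * xv ^ (2 ^ i + 1) +
    cst (B ^ 2 ^ i) * yv ^ (2 ^ i + 1) + cst (C ^ 2 ^ i) * (xv + yv) ^ (2 ^ i + 1) := ⟨_, rfl⟩
  rw [← hH]
  have hq : 2 ≤ 2 ^ i := by
    have := Nat.pow_le_pow_right (n := 2) (by norm_num) hi; omega
  have two : (2 : k[X][Y]) = 0 := CharTwo.two_eq_zero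
  have hHpr : H = xv * p ^ 2 ^ i + yv * r ^ 2 ^ i := by
    rw [hH, hp, hr]
    simp only [cst, add_pow_char_pow, mul_pow, map_pow, map_add, pow_succ]
    ring
  have hq1 : ((2 ^ i : ℕ) : k[X][Y]) = 0 := by
    push_cast; rw [two, zero_pow (by omega)]
  have hder : Polynomial.derivative H = r ^ 2 ^ i := by
    rw [hHpr]
    simp only [Polynomial.derivative_add, Polynomial.derivative_mul, Polynomial.derivative_pow,
      Polynomial.derivative_C, Polynomial.derivative_X, Polynomial.C_eq_natCast, hq1]
    ring
  have hdet : IsUnit (cst (A * B + A * C + B * C) : k[X][Y]) := isUnit_cst h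
  have hr0 : r ≠ 0 := by
    intro h0
    have h1 := congrArg (fun p : k[X][Y] => (p.coeff 0).coeff 1) (hr.symm.trans h0)
    have h2 := congrArg (fun p : k[X][Y] => (p.coeff 1).coeff 0) (hr.symm.trans h0)
    simp [cst] at h1 h2
    rw [h1, add_zero] at h2
    exact h (by rw [h1, h2]; ring)
  have hH0 : H ≠ 0 := fun h0 => pow_ne_zero _ hr0 (by rw [← hder, h0, Polynomial.derivative_zero])
  refine (squarefree_iff_irreducible_sq_not_dvd_of_ne_zero hH0).2 fun u hu hd => ?_
  have hup : Prime u := hu.prime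
  have h1 : u ∣ r := by
    obtain ⟨c, hc⟩ := hd
    refine hup.dvd_of_dvd_pow (n := 2 ^ i) ?_
    rw [← hder, hc]
    simp only [Polynomial.derivative_mul]
    exact ⟨Polynomial.derivative u * c + Polynomial.derivative u * c + u * Polynomial.derivative c,
      by ring⟩
  have h2 : u ^ 2 ∣ xv * p ^ 2 ^ i := by
    have h3 : u ^ 2 ∣ yv * r ^ 2 ^ i :=
      ((pow_dvd_pow_of_dvd h1 2).trans (pow_dvd_pow r hq)).mul_left _
    rw [← pow_two] at hd
    have := dvd_sub hd h3
    rwa [hHpr, add_sub_cancel_right] at this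
  have h3 : u ∣ p := by
    by_contra hn
    have h4 : u ^ 2 ∣ xv := hup.pow_dvd_of_dvd_mul_right 2 (fun h => hn (hup.dvd_of_dvd_pow h)) h2
    rw [pow_two] at h4
    exact hup.not_isUnit (prime_xv.irreducible.squarefree u h4)
  have hx : u ∣ cst (A * B + A * C + B * C) * xv := by
    have := dvd_add (h3.mul_left (cst (B + C))) (h1.mul_left (cst C))
    convert this using 1
    rw [hp, hr]
    simp only [cst, map_add, map_mul]
    linear_combination (-(Polynomial.C (Polynomial.C C)) ^ 2 * xv - Polynomial.C (Polynomial.C C) *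
      (Polynomial.C (Polynomial.C B) + Polynomial.C (Polynomial.C C)) * yv) * two
  have hy : u ∣ cst (A * B + A * C + B * C) * yv := by
    have := dvd_add (h3.mul_left (cst C)) (h1.mul_left (cst (A + C)))
    convert this using 1
    rw [hp, hr]
    simp only [cst, map_add, map_mul]
    linear_combination (-(Polynomial.C (Polynomial.C C)) ^ 2 * yv - Polynomial.C (Polynomial.C C) *
      (Polynomial.C (Polynomial.C A) + Polynomial.C (Polynomial.C C)) * xv) * two
  exact not_dvd_xv_yv hup.not_isUnit ((hdet.dvd_mul_left).1 hx) ((hdet.dvd_mul_left).1 hy)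

end LeadingForms

section Singularities

variable {k : Type*} [Field k] [CharP k 2]

/-- The possible singular points of the curve `quad`. -/
def IsSing (l : ℕ) (P : k × k) : Prop := P.1 ^ l = 1 ∧ P.2 ^ l = 1 ∧ (P.1 + P.2 + 1) ^ l = 1

theorem isSing_of_coeff {P : k × k} {i l : ℕ} (hi : 1 ≤ i) (hl : Odd l)
    (h0 : (loc P (quad k (2 ^ i * l + 1))).coeff 0 = 0)
    (h1 : (loc P (quad k (2 ^ i * l + 1))).coeff 1 = 0) : IsSing l P := by
  obtain ⟨K, hK⟩ := loc_quad P hi hl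
  have hq : 2 ≤ 2 ^ i := by
    have := Nat.pow_le_pow_right (n := 2) (by norm_num) hi; omega
  rw [hK] at h0 h1
  simp only [Polynomial.coeff_add, Polynomial.coeff_C_mul, Polynomial.coeff_C_zero,
    Polynomial.coeff_X_pow, Polynomial.coeff_X_zero, Polynomial.coeff_X_one,
    Polynomial.coeff_X_pow_mul', Polynomial.coeff_C_succ] at h0 h1
  rw [if_neg (by omega), if_neg (by omega), if_neg (by omega)] at h0 h1
  simp only [mul_zero, add_zero, mul_one, zero_add] at h0 h1
  have e0 := congrArg (ev (0, 0)) h0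
  have e1 := congrArg (ev (1, 0)) h1
  have e2 := congrArg (ev (0, 1)) h1
  simp only [map_add, map_mul, ev_cst, ev_xv, ev_yv, map_zero, mul_one, mul_zero, add_zero,
    zero_add] at e0 e1 e2
  obtain ⟨c, hc⟩ : ∃ c, c = (P.1 + P.2 + 1) ^ (2 ^ i * l) := ⟨_, rfl⟩
  have e1' : P.1 ^ (2 ^ i * l) = c := by rw [hc]; exact CharTwo.add_eq_zero.1 e1
  have e2' : P.2 ^ (2 ^ i * l) = c := by rw [hc]; exact CharTwo.add_eq_zero.1 e2
  have hc1 : c = 1 := by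
    rw [pow_succ, pow_succ, pow_succ, e1', e2', ← hc] at e0
    have : c + 1 = 0 := by
      linear_combination e0 - (c * P.1 + c * P.2) * (CharTwo.two_eq_zero (R := k))
    exact CharTwo.add_eq_zero.1 this
  have inj : ∀ a : k, a ^ (2 ^ i * l) = 1 → a ^ l = 1 := by
    intro a ha
    rw [mul_comm, pow_mul, ← iterateFrobenius_def] at ha
    exact (iterateFrobenius k 2 i).injective (ha.trans (map_one _).symm)
  exact ⟨inj _ (e1'.trans hc1), inj _ (e2'.trans hc1), inj _ (hc.symm.trans hc1)⟩

theorem IsSing.loc_quad {P : k × k} {i l : ℕ} (hi : 1 ≤ i) (hl : Odd l) (hP : IsSing l P) :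
    ∃ (A B C : k) (K : (k[X][Y])[X]), P.1 * A = 1 ∧ P.2 * B = 1 ∧ (P.1 + P.2 + 1) * C = 1 ∧
      loc P (quad k (2 ^ i * l + 1)) =
        (Polynomial.C (cst (P.1 * A ^ 2 ^ i + (P.1 + P.2 + 1) * C ^ 2 ^ i) * xv ^ 2 ^ i +
          cst (P.2 * B ^ 2 ^ i + (P.1 + P.2 + 1) * C ^ 2 ^ i) * yv ^ 2 ^ i) +
        Polynomial.C (cst (A ^ 2 ^ i) * xv ^ (2 ^ i + 1) + cst (B ^ 2 ^ i) * yv ^ (2 ^ i + 1) +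
          cst (C ^ 2 ^ i) * (xv + yv) ^ (2 ^ i + 1)) * Polynomial.X +
        Polynomial.X ^ 2 * K) * Polynomial.X ^ 2 ^ i := by
  obtain ⟨K, hK⟩ := PlaneCurve.loc_quad P hi hl
  obtain ⟨j, rfl⟩ : ∃ j, l = j + 1 := ⟨l - 1, by have := hl.pos; omega⟩
  have e : ∀ a : k, a ^ (j + 1) = 1 → a * a ^ j = 1 := fun a h => by rw [← pow_succ', h]
  have e' : ∀ a : k, a ^ (j + 1) = 1 → a ^ (2 ^ i * (j + 1)) = 1 := fun a h => by
    rw [mul_comm, pow_mul, h, one_pow]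
  refine ⟨P.1 ^ j, P.2 ^ j, (P.1 + P.2 + 1) ^ j, K, e _ hP.1, e _ hP.2.1, e _ hP.2.2, ?_⟩
  rw [hK]
  simp only [pow_succ _ (2 ^ i * (j + 1)), e' _ hP.1, e' _ hP.2.1, e' _ hP.2.2, one_mul,
    Nat.add_sub_cancel, show (P.1 + P.2 + 1 + (P.1 + P.2 + 1) : k) = 0 from
      CharTwo.add_self_eq_zero _]
  have two : (2 : k[X][Y]) = 0 := CharTwo.two_eq_zero
  have z : (cst (1 : k) * xv + cst 1 * yv + cst 1 * (xv + yv) : k[X][Y]) = 0 := by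
    simp only [cst, map_one]
    linear_combination (xv + yv) * two
  have z' : (cst (0 : k) : k[X][Y]) = 0 := by simp [cst]
  rw [z, z', add_pow_char_pow]
  simp only [cst, map_add, map_mul, map_pow, map_zero]
  ring

end Singularities

section Tangent

variable {k : Type*} [Field k]

theorem mult_eq_of_loc {P : k × k} {p : k[X][Y]} {Q : (k[X][Y])[X]} {n : ℕ}
    (h : loc P p = Q * Polynomial.X ^ n) (hQ : Q.coeff 0 ≠ 0) :
    mult P p = n ∧ ini P p = Q.coeff 0 := by
  have hQ0 : Q ≠ 0 := fun h0 => hQ (by simp [h0])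
  have h1 : mult P p = n := by
    rw [mult, h, Polynomial.natTrailingDegree_mul_X_pow hQ0, Polynomial.natTrailingDegree_eq_zero.2
      (Or.inr hQ), zero_add]
  refine ⟨h1, ?_⟩
  change (loc P p).coeff (mult P p) = _
  rw [h1, h]
  simpa using Polynomial.coeff_mul_X_pow Q n 0

theorem associated_pow_of_mul_eq_pow {R : Type*} [CommRing R] [IsDomain R] {p a b : R}
    (hp : Prime p) {n : ℕ} (h : a * b = p ^ n) : ∃ i, Associated a (p ^ i) := by
  obtain ⟨i, -, hi⟩ := (dvd_prime_pow hp n).1 (Dvd.intro _ h)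
  exact ⟨i, hi⟩

theorem le_of_associated_pow {p f : k[X][Y]} (hp1 : 1 ≤ tdeg p) (hf : f ≠ 0) {i r : ℕ}
    (h : Associated f (p ^ i)) (hr : tdeg f ≤ r) : i ≤ r := by
  obtain ⟨c, hc⟩ := h.dvd'
  have hp : p ≠ 0 := by rintro rfl; simp [tdeg] at hp1
  have hpi : tdeg (p ^ i) = i * tdeg p := by rw [tdeg, map_pow, Polynomial.natDegree_pow]; rfl
  have hc0 : c ≠ 0 := by rintro rfl; exact hf (by simpa using hc)
  rw [hc, tdeg_mul (pow_ne_zero _ hp) hc0, hpi] at hr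
  nlinarith

theorem associated_pow_of_mul_eq {p f g e : k[X][Y]} (hp : Prime p) (hp1 : 1 ≤ tdeg p) {r s m : ℕ}
    (h : f * g * e = p ^ (r + s + m)) (hf : tdeg f ≤ r) (hg : tdeg g ≤ s) (he : tdeg e ≤ m) :
    Associated f (p ^ r) ∧ Associated g (p ^ s) ∧ Associated e (p ^ m) := by
  have hne : f * g * e ≠ 0 := h ▸ pow_ne_zero _ hp.ne_zero
  have hf0 : f ≠ 0 := by rintro rfl; simp at hne
  have hg0 : g ≠ 0 := by rintro rfl; simp at hne
  have he0 : e ≠ 0 := by rintro rfl; simp at hne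
  obtain ⟨a, ha⟩ := associated_pow_of_mul_eq_pow hp (a := f) (b := g * e) (by rw [← h]; ring)
  obtain ⟨b, hb⟩ := associated_pow_of_mul_eq_pow hp (a := g) (b := f * e) (by rw [← h]; ring)
  obtain ⟨c, hc⟩ := associated_pow_of_mul_eq_pow hp (a := e) (b := f * g) (by rw [← h]; ring)
  have h1 := le_of_associated_pow hp1 hf0 ha hf
  have h2 := le_of_associated_pow hp1 hg0 hb hg
  have h3 := le_of_associated_pow hp1 he0 hc he
  have h4 : p ^ (r + s + m) ∣ p ^ (a + b + c) := by
    rw [← h, pow_add, pow_add]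
    exact ((ha.mul_mul hb).mul_mul hc).dvd
  have h5 := (pow_dvd_pow_iff hp.ne_zero hp.not_isUnit).1 h4
  obtain rfl : a = r := by omega
  obtain rfl : b = s := by omega
  obtain rfl : c = m := by omega
  exact ⟨ha, hb, hc⟩

theorem exists_cst_of_associated {f g : k[X][Y]} (h : Associated g f) :
    ∃ c : k, c ≠ 0 ∧ f = cst c * g := by
  obtain ⟨u, rfl⟩ := h
  obtain ⟨r, hr, hu⟩ := Polynomial.isUnit_iff.1 u.isUnit
  obtain ⟨c, hc, rfl⟩ := Polynomial.isUnit_iff.1 hr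
  exact ⟨c, hc.ne_zero, by rw [← hu, mul_comm]⟩

variable [CharP k 2]

theorem locLE_of_tangent {u v : k[X][Y]} {P : k × k} {a b : k} {j : ℕ} {U V : (k[X][Y])[X]}
    (hab : a ≠ 0 ∨ b ≠ 0)
    (hU : loc P u = Polynomial.X ^ (j + 1) * U) (hV : loc P v = Polynomial.X * V)
    (hU0 : Associated (U.coeff 0) ((cst a * xv + cst b * yv) ^ (j + 1)))
    (hV0 : Associated (V.coeff 0) (cst a * xv + cst b * yv))
    (h : ¬ (cst a * xv + cst b * yv) ^ 2 ∣ U.coeff 1 * V.coeff 0 + U.coeff 0 * V.coeff 1) :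
    LocLE u v P (j + 2) := by
  have hp := prime_linear_form hab
  obtain ⟨p, hpdef⟩ : ∃ p : k[X][Y], p = cst a * xv + cst b * yv := ⟨_, rfl⟩
  rw [← hpdef] at hU0 hV0 h hp
  obtain ⟨c1, hc1, e1⟩ := exists_cst_of_associated hU0.symm
  obtain ⟨c2, hc2, e2⟩ := exists_cst_of_associated hV0.symm
  obtain ⟨c, hc⟩ : ∃ c, c * c2 = c1 := ⟨c1 / c2, div_mul_cancel₀ _ hc2⟩
  have hcc : (cst c * cst c2 : k[X][Y]) = cst c1 := by rw [← hc]; simp [cst]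
  have two : (2 : k[X][Y]) = 0 := CharTwo.two_eq_zero
  obtain ⟨w, hw⟩ : ∃ w, loc P w = Polynomial.C (cst c * p ^ j) * Polynomial.X ^ j := by
    refine ⟨cst c * (cst a * (xv - cst P.1) + cst b * (yv - cst P.2)) ^ j, ?_⟩
    have hin : loc P (cst a * (xv - cst P.1) + cst b * (yv - cst P.2)) =
        Polynomial.C p * Polynomial.X := by
      simp only [map_mul, map_sub, map_add, loc_xv, loc_yv, loc_cst, hpdef]
      ring
    rw [map_mul, map_pow, hin, loc_cst, Polynomial.C_mul, Polynomial.C_pow]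
    ring
  have hloc : loc P (u - w * v) = Polynomial.X ^ (j + 1) *
      (U - Polynomial.C (cst c * p ^ j) * V) := by
    rw [map_sub, map_mul, hU, hV, hw]; ring
  obtain ⟨Q, hQ⟩ : Polynomial.X ∣ U - Polynomial.C (cst c * p ^ j) * V := by
    rw [Polynomial.X_dvd_iff, Polynomial.coeff_sub, Polynomial.coeff_C_mul, e1, e2, ← hcc]
    ring
  have hQ0 : Q.coeff 0 = U.coeff 1 - cst c * p ^ j * V.coeff 1 := by
    have := congrArg (fun p => Polynomial.coeff p 1) hQ
    simp only [Polynomial.coeff_sub, Polynomial.coeff_C_mul] at this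
    rw [this]
    exact (Polynomial.coeff_X_mul Q 0).symm
  have hl2 : loc P (u - w * v) = Polynomial.X ^ (j + 2) * Q := by rw [hloc, hQ]; ring
  refine LocLE.of_sub_mul (w := w) ?_
  have := locLE_mul (u := u - w * v) (v := v) (P := P) (r := j + 2) (s := 1) ⟨Q, hl2⟩
    ⟨V, by rw [hV, pow_one]⟩ ?_
  · simpa using this
  · have e3 : (loc P (u - w * v)).coeff (j + 2) = Q.coeff 0 := by
      rw [hl2]; simpa using Polynomial.coeff_X_pow_mul Q (j + 2) 0
    have e4 : (loc P v).coeff 1 = V.coeff 0 := by rw [hV]; simp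
    rw [e3, e4]
    refine IsRelPrime.symm ?_
    have hVp : Prime (V.coeff 0) := hV0.symm.prime hp
    refine hVp.irreducible.isRelPrime_iff_not_dvd.2 fun hd => h ?_
    obtain ⟨z, hz⟩ := hV0.dvd'.trans hd
    refine ⟨cst c2 * z, ?_⟩
    rw [e1, e2]
    rw [hQ0] at hz
    linear_combination (cst c2 * p) * hz + V.coeff 1 * p ^ (j + 1) * (- hcc + cst c * cst c2 * two)

theorem locLE_of_mul {u v w : k[X][Y]} {P : k × k} {a b : k} {q : ℕ} {H : k[X][Y]}
    {K : (k[X][Y])[X]} (hq : 2 ≤ q) (hab : a ≠ 0 ∨ b ≠ 0) (hH : Squarefree H)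
    (hloc : loc P (u * v * w) = (Polynomial.C ((cst a * xv + cst b * yv) ^ q) +
      Polynomial.C H * Polynomial.X + Polynomial.X ^ 2 * K) * Polynomial.X ^ q)
    (hu : ev P u = 0) (hv : ev P v = 0) (hne : u * v * w ≠ 0) :
    ev P w ≠ 0 ∧ (q = 2 → (cst a * xv + cst b * yv) ∣ H) ∧ LocLE u v P q := by
  have hp := prime_linear_form hab
  have hp1 := one_le_tdeg_linear_form hab
  have hu0 : u ≠ 0 := by rintro rfl; simp at hne
  have hv0 : v ≠ 0 := by rintro rfl; simp at hne
  have hw0 : w ≠ 0 := by rintro rfl; simp at hne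
  have hm := (mult_eq_of_loc hloc (by
    simp only [Polynomial.coeff_add, Polynomial.mul_coeff_zero, Polynomial.coeff_C_zero,
      Polynomial.coeff_X_zero, mul_zero, add_zero, Polynomial.coeff_X_pow]
    simpa only [OfNat.zero_ne_ofNat, if_false, zero_mul, add_zero] using
      pow_ne_zero q hp.ne_zero)).1
  rw [mult_mul (mul_ne_zero hu0 hv0) hw0, mult_mul hu0 hv0] at hm
  have hr := mult_pos (P := P) hu0 hu
  have hs := mult_pos (P := P) hv0 hv
  obtain ⟨U, hU⟩ := X_pow_mult_dvd P u
  obtain ⟨V, hV⟩ := X_pow_mult_dvd P v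
  obtain ⟨W, hW⟩ := X_pow_mult_dvd P w
  have tU : tdeg (U.coeff 0) ≤ mult P u := by
    have := tdeg_coeff_loc_le P u (mult P u)
    rw [hU] at this
    simpa using (congrArg tdeg (Polynomial.coeff_X_pow_mul U (mult P u) 0)).symm.le.trans
      (by simpa using this)
  have tV : tdeg (V.coeff 0) ≤ mult P v := by
    have := tdeg_coeff_loc_le P v (mult P v)
    rw [hV] at this
    simpa using (congrArg tdeg (Polynomial.coeff_X_pow_mul V (mult P v) 0)).symm.le.trans
      (by simpa using this)
  have tW : tdeg (W.coeff 0) ≤ mult P w := by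
    have := tdeg_coeff_loc_le P w (mult P w)
    rw [hW] at this
    simpa using (congrArg tdeg (Polynomial.coeff_X_pow_mul W (mult P w) 0)).symm.le.trans
      (by simpa using this)
  generalize mult P u = r at *
  generalize mult P v = s at *
  have hw1 : mult P w = 0 → ev P w ≠ 0 := fun h h0 => (mult_pos (P := P) hw0 h0).ne' h
  generalize mult P w = m at *
  subst hm
  have hprod : U * V * W = Polynomial.C ((cst a * xv + cst b * yv) ^ (r + s + m)) +
      Polynomial.C H * Polynomial.X + Polynomial.X ^ 2 * K := by
    have hX : (Polynomial.X : (k[X][Y])[X]) ^ (r + s + m) ≠ 0 := pow_ne_zero _ Polynomial.X_ne_zero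
    refine mul_right_cancel₀ hX ?_
    rw [← hloc, map_mul, map_mul, hU, hV, hW]
    ring
  have c0 := congrArg (fun p => Polynomial.coeff p 0) hprod
  have c1 := congrArg (fun p => Polynomial.coeff p 1) hprod
  simp only [Polynomial.coeff_add, Polynomial.mul_coeff_zero, Polynomial.coeff_C_zero,
    Polynomial.coeff_X_zero, mul_zero, add_zero, Polynomial.coeff_X_pow, OfNat.zero_ne_ofNat,
    if_false, zero_mul] at c0
  simp only [Polynomial.coeff_add, Polynomial.mul_coeff_one, Polynomial.mul_coeff_zero,
    Polynomial.coeff_X_one, Polynomial.coeff_X_pow, OfNat.one_ne_ofNat, OfNat.zero_ne_ofNat,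
    if_false, zero_mul, mul_zero, add_zero, mul_one, Polynomial.coeff_X_zero,
    Polynomial.coeff_C_zero, zero_add,
    (Polynomial.coeff_C_succ : (Polynomial.C _ : (k[X][Y])[X]).coeff (0 + 1) = 0)] at c1
  obtain ⟨p, hpdef⟩ : ∃ p : k[X][Y], p = cst a * xv + cst b * yv := ⟨_, rfl⟩
  rw [← hpdef] at hp hp1 c0
  have c1 : U.coeff 1 * V.coeff 0 * W.coeff 0 + U.coeff 0 * V.coeff 1 * W.coeff 0 +
      U.coeff 0 * V.coeff 0 * W.coeff 1 = H := by
    rw [← c1]; ring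
  have hsq : ¬ p ^ 2 ∣ H := fun hd => hp.not_isUnit (hH p (by rwa [pow_two] at hd))
  obtain ⟨aU, aV, aW⟩ := associated_pow_of_mul_eq hp hp1 c0 tU tV tW
  have hm0 : m = 0 := by
    by_contra hm0
    obtain ⟨x, hx⟩ := (dvd_pow_self p (by omega : r ≠ 0)).trans aU.dvd'
    obtain ⟨y, hy⟩ := (dvd_pow_self p (by omega : s ≠ 0)).trans aV.dvd'
    obtain ⟨z, hz⟩ := (dvd_pow_self p hm0).trans aW.dvd'
    refine hsq ⟨U.coeff 1 * y * z + x * V.coeff 1 * z + x * y * W.coeff 1, ?_⟩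
    rw [← c1, hx, hy, hz]; ring
  subst hm0
  rw [pow_zero] at aW
  obtain ⟨e, he⟩ := isUnit_iff_exists_inv.1 (aW.isUnit_iff.2 isUnit_one)
  have hrs : r = 1 ∨ s = 1 := by
    by_contra! hrs
    obtain ⟨x, hx⟩ := (pow_dvd_pow p (by omega : 2 ≤ r)).trans aU.dvd'
    obtain ⟨y, hy⟩ := (pow_dvd_pow p (by omega : 2 ≤ s)).trans aV.dvd'
    refine hsq ⟨U.coeff 1 * y * W.coeff 0 + x * V.coeff 1 * W.coeff 0 +
      p ^ 2 * x * y * W.coeff 1, ?_⟩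
    rw [← c1, hx, hy]; ring
  have htan : ¬ p ^ 2 ∣ U.coeff 1 * V.coeff 0 + U.coeff 0 * V.coeff 1 := by
    rintro ⟨z, hz⟩
    obtain ⟨x, hx⟩ := (dvd_pow_self p (by omega : r ≠ 0)).trans aU.dvd'
    obtain ⟨y, hy⟩ := (dvd_pow_self p (by omega : s ≠ 0)).trans aV.dvd'
    refine hsq ⟨z * W.coeff 0 + x * y * W.coeff 1, ?_⟩
    rw [← c1]
    linear_combination W.coeff 0 * hz + W.coeff 1 * (hx * V.coeff 0 + p * x * hy)
  refine ⟨hw1 rfl, fun h2 => ?_, ?_⟩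
  · obtain ⟨x, hx⟩ := (dvd_pow_self p (by omega : r ≠ 0)).trans aU.dvd'
    obtain ⟨y, hy⟩ := (dvd_pow_self p (by omega : s ≠ 0)).trans aV.dvd'
    rw [← hpdef, ← c1, hx, hy]
    exact ⟨U.coeff 1 * y * W.coeff 0 + x * V.coeff 1 * W.coeff 0 + p * x * y * W.coeff 1, by ring⟩
  · rcases hrs with rfl | rfl
    · obtain ⟨j, rfl⟩ : ∃ j, s = j + 1 := ⟨s - 1, by omega⟩
      have h1 : ¬ p ^ 2 ∣ V.coeff 1 * U.coeff 0 + V.coeff 0 * U.coeff 1 := fun hd => htan (by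
        rw [show U.coeff 1 * V.coeff 0 + U.coeff 0 * V.coeff 1 =
          V.coeff 1 * U.coeff 0 + V.coeff 0 * U.coeff 1 by ring]
        exact hd)
      rw [pow_one] at aU hU
      rw [hpdef] at aU aV h1
      have h2 := locLE_of_tangent hab hV hU aV aU h1
      rw [show 1 + (j + 1) + 0 = j + 2 by omega]
      exact h2.symm
    · obtain ⟨j, rfl⟩ : ∃ j, r = j + 1 := ⟨r - 1, by omega⟩
      rw [pow_one] at aV hV
      rw [hpdef] at aU aV htan
      exact locLE_of_tangent hab hU hV aU aV htan

end Tangent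

section Singular

variable {k : Type*} [Field k]

theorem cst_pow (a : k) (n : ℕ) : (cst (a ^ n) : k[X][Y]) = cst a ^ n := by simp [cst]

/-- Both coordinates lie in the field with `2 ^ i` elements. -/
def IsFix (i : ℕ) (P : k × k) : Prop := P.1 ^ 2 ^ i = P.1 ∧ P.2 ^ 2 ^ i = P.2

/-- The point lies on one of the three lines contained in every curve `quad`. -/
def OnLine (P : k × k) : Prop := P.1 = 1 ∨ P.2 = 1 ∨ P.1 = P.2

variable [CharP k 2]

theorem form_coeff_ne_zero {α β A B C : k} (hA : α * A = 1) (hB : β * B = 1)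
    (hC : (α + β + 1) * C = 1) : A * B + A * C + B * C ≠ 0 := by
  have two : (2 : k) = 0 := CharTwo.two_eq_zero
  intro h
  have h1 : (α + β + 1) * (α * (β * (A * B + A * C + B * C))) = 1 := by
    linear_combination (α + β + 1) * β * B * hA + (α + β + 1) * hB + (α * A * β + β * B * α) * hC +
      β * hA + α * hB + two * (α + β)
  rw [h] at h1
  simp at h1

theorem IsSing.mult_of_isFix {P : k × k} {i l : ℕ} (hi : 1 ≤ i) (hl : Odd l) (hP : IsSing l P)
    (hf : IsFix i P) : mult P (quad k (2 ^ i * l + 1)) = 2 ^ i + 1 ∧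
      Squarefree (ini P (quad k (2 ^ i * l + 1))) := by
  obtain ⟨A, B, C, K, hA, hB, hC, h⟩ := hP.loc_quad hi hl
  have e : ∀ a b : k, a ^ 2 ^ i = a → a * b = 1 → a * b ^ 2 ^ i = 1 := fun a b ha hab => by
    have h := congrArg (· ^ 2 ^ i) hab
    simpa only [mul_pow, ha, one_pow] using h
  have hγ : (P.1 + P.2 + 1) ^ 2 ^ i = P.1 + P.2 + 1 := by
    rw [add_pow_char_pow, add_pow_char_pow, hf.1, hf.2, one_pow]
  rw [e _ _ hf.1 hA, e _ _ hf.2 hB, e _ _ hγ hC, CharTwo.add_self_eq_zero] at h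
  obtain ⟨H, hH⟩ : ∃ H : k[X][Y], H = cst (A ^ 2 ^ i) * xv ^ (2 ^ i + 1) +
    cst (B ^ 2 ^ i) * yv ^ (2 ^ i + 1) + cst (C ^ 2 ^ i) * (xv + yv) ^ (2 ^ i + 1) := ⟨_, rfl⟩
  have hsq : Squarefree H := hH ▸ squarefree_form hi (form_coeff_ne_zero hA hB hC)
  rw [← hH] at h
  have h' : loc P (quad k (2 ^ i * l + 1)) =
      (Polynomial.C H + Polynomial.X * K) * Polynomial.X ^ (2 ^ i + 1) := by
    rw [h, show (cst (0 : k) : k[X][Y]) = 0 by simp [cst], zero_mul, zero_mul, add_zero, map_zero]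
    ring
  have hc : (Polynomial.C H + Polynomial.X * K).coeff 0 = H := by simp
  obtain ⟨h1, h2⟩ := mult_eq_of_loc h' (by rw [hc]; exact hsq.ne_zero)
  exact ⟨h1, by rw [h2, hc]; exact hsq⟩

theorem IsSing.loc_of_not_isFix [IsAlgClosed k] {P : k × k} {i l : ℕ} (hi : 1 ≤ i) (hl : Odd l)
    (hP : IsSing l P) (hf : ¬ IsFix i P) :
    ∃ (a b : k) (H : k[X][Y]) (K : (k[X][Y])[X]), (a ≠ 0 ∨ b ≠ 0) ∧ Squarefree H ∧
      loc P (quad k (2 ^ i * l + 1)) = (Polynomial.C ((cst a * xv + cst b * yv) ^ 2 ^ i) +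
        Polynomial.C H * Polynomial.X + Polynomial.X ^ 2 * K) * Polynomial.X ^ 2 ^ i ∧
      (i = 1 → ¬ OnLine P → ¬ (cst a * xv + cst b * yv) ∣ H) := by
  obtain ⟨A, B, C, K, hA, hB, hC, h⟩ := hP.loc_quad hi hl
  have two : (2 : k) = 0 := CharTwo.two_eq_zero
  have hq : 2 ^ i ≠ 0 := by positivity
  obtain ⟨a, ha⟩ := IsAlgClosed.exists_pow_nat_eq
    (P.1 * A ^ 2 ^ i + (P.1 + P.2 + 1) * C ^ 2 ^ i) (Nat.pos_of_ne_zero hq)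
  obtain ⟨b, hb⟩ := IsAlgClosed.exists_pow_nat_eq
    (P.2 * B ^ 2 ^ i + (P.1 + P.2 + 1) * C ^ 2 ^ i) (Nat.pos_of_ne_zero hq)
  have key : ∀ a b d : k, a * b = 1 → a * b ^ 2 ^ i = d → a = d * a ^ 2 ^ i := fun a b d h1 h2 => by
    rw [← h2, mul_assoc, ← mul_pow, mul_comm b, h1, one_pow, mul_one]
  refine ⟨a, b, cst (A ^ 2 ^ i) * xv ^ (2 ^ i + 1) + cst (B ^ 2 ^ i) * yv ^ (2 ^ i + 1) +
    cst (C ^ 2 ^ i) * (xv + yv) ^ (2 ^ i + 1), K, ?_,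
    squarefree_form hi (form_coeff_ne_zero hA hB hC), ?_, ?_⟩
  · by_contra! hab
    rw [hab.1, zero_pow hq] at ha
    rw [hab.2, zero_pow hq] at hb
    obtain ⟨d, hd⟩ : ∃ d, d = (P.1 + P.2 + 1) * C ^ 2 ^ i := ⟨_, rfl⟩
    rw [← hd] at ha hb
    have h1 := key _ _ d hA (CharTwo.add_eq_zero.1 ha.symm)
    have h2 := key _ _ d hB (CharTwo.add_eq_zero.1 hb.symm)
    have h3 := key _ _ d hC hd.symm
    rw [add_pow_char_pow, add_pow_char_pow, one_pow] at h3
    have hd1 : d = 1 := by linear_combination h1 + h2 - h3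
    rw [hd1, one_mul] at h1 h2
    exact hf ⟨h1.symm, h2.symm⟩
  · rw [h, add_pow_char_pow, mul_pow, mul_pow, ← cst_pow, ← cst_pow, ha, hb]
  · rintro rfl hl hd
    simp only [pow_one] at ha hb hd
    obtain ⟨w, hw⟩ := hd
    have e := congrArg (ev (b, a)) hw
    simp only [map_add, map_mul, map_pow, ev_cst, ev_xv, ev_yv] at e
    have h0 : a * b + b * a = 0 := by linear_combination two * a * b
    rw [h0, zero_mul] at e
    have ha' : a ^ 2 = A + C := by linear_combination ha + A * hA + C * hC
    have hb' : b ^ 2 = B + C := by linear_combination hb + B * hB + C * hC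
    have e2 : A ^ 4 * (B + C) ^ 3 + B ^ 4 * (A + C) ^ 3 + C ^ 4 * (A + B) ^ 3 = 0 := by
      have hs : (a + b) ^ 2 = A + B := by
        rw [CharTwo.add_sq, ha', hb']; linear_combination two * C
      rw [← ha', ← hb', ← hs]
      have := congrArg (· ^ 2) e
      simp only [CharTwo.add_sq] at this
      rw [zero_pow two_ne_zero] at this
      linear_combination this
    have e3 : (A + B) * (B + C) * (C + A) * (A * B + A * C + B * C) ^ 2 = 0 := by
      linear_combination e2 + two * (A * B ^ 3 * C ^ 3 * 3 + A ^ 2 * B ^ 2 * C ^ 3 * 5 +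
        A ^ 2 * B ^ 3 * C ^ 2 * 5 + A ^ 3 * B * C ^ 3 * 3 + A ^ 3 * B ^ 2 * C ^ 2 * 5 +
        A ^ 3 * B ^ 3 * C * 3)
    have inj : ∀ x y z w : k, x * z = 1 → y * w = 1 → z + w = 0 → x = y :=
        fun x y z w h1 h2 h3 => by
      rw [CharTwo.add_eq_zero] at h3
      subst h3
      have : z ≠ 0 := right_ne_zero_of_mul_eq_one h1
      exact mul_right_cancel₀ this (h1.trans h2.symm)
    simp only [mul_eq_zero, pow_eq_zero_iff two_ne_zero] at e3
    rcases e3 with ((e3 | e3) | e3) | e3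
    · exact hl (Or.inr (Or.inr (inj _ _ _ _ hA hB e3)))
    · have := inj _ _ _ _ hB hC e3
      exact hl (Or.inl (by linear_combination -this - two*(P.1+1) + two * P.1))
    · have := inj _ _ _ _ hC hA e3
      exact hl (Or.inr (Or.inl (by linear_combination this - two)))
    · exact form_coeff_ne_zero hA hB hC e3

theorem isSing_of_eq_mul {P : k × k} {i l : ℕ} {u v w : k[X][Y]} (hi : 1 ≤ i) (hl : Odd l)
    (h : quad k (2 ^ i * l + 1) = u * v * w) (hu : ev P u = 0) (hv : ev P v = 0) : IsSing l P := by
  have cu : (loc P u).coeff 0 = 0 := by rw [loc_coeff_zero, hu]; simp [cst]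
  have cv : (loc P v).coeff 0 = 0 := by rw [loc_coeff_zero, hv]; simp [cst]
  refine isSing_of_coeff hi hl ?_ ?_
  · rw [h, map_mul, map_mul, Polynomial.mul_coeff_zero, Polynomial.mul_coeff_zero, cu]
    ring
  · rw [h, map_mul, map_mul, Polynomial.mul_coeff_one, Polynomial.mul_coeff_zero,
      Polynomial.mul_coeff_one, cu, cv]
    ring

theorem locLE_of_isFix {P : k × k} {i l : ℕ} {u v w : k[X][Y]} (hi : 1 ≤ i) (hl : Odd l)
    (h : quad k (2 ^ i * l + 1) = u * v * w) (hP : IsSing l P)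
    (hf : IsFix i P) : LocLE u v P (mult P u * mult P v) := by
  have hsq := (hP.mult_of_isFix hi hl hf).2
  rw [h, ini_mul, ini_mul] at hsq
  exact locLE_mult (IsRelPrime.of_squarefree_mul hsq.of_mul_left)

theorem locLE_of_not_isFix [IsAlgClosed k] {P : k × k} {i l : ℕ} {u v w : k[X][Y]} (hi : 1 ≤ i)
    (hl : Odd l) (h : quad k (2 ^ i * l + 1) = u * v * w) (h0 : u * v * w ≠ 0)
    (hf : ¬ IsFix i P) (hu : ev P u = 0) (hv : ev P v = 0) :
    ev P w ≠ 0 ∧ (i = 1 → OnLine P) ∧ LocLE u v P (2 ^ i) := by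
  have hP := isSing_of_eq_mul hi hl h hu hv
  obtain ⟨a, b, H, K, hab, hH, hloc, hd⟩ := hP.loc_of_not_isFix hi hl hf
  rw [h] at hloc
  have hq : 2 ≤ 2 ^ i := by
    have := Nat.pow_le_pow_right (n := 2) (by norm_num) hi; omega
  obtain ⟨h1, h2, h3⟩ := locLE_of_mul hq hab hH hloc hu hv h0
  refine ⟨h1, fun hi1 => ?_, h3⟩
  by_contra hn
  exact hd hi1 hn (h2 (by rw [hi1, pow_one]))

end Singular

section Combinatorics

theorem sq_sum_le_of_fixedPointFree {ι α : Type*} [DecidableEq ι] (U : Finset ι) (σ : ι → ι)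
    (hσ : ∀ u ∈ U, σ u ∈ U) (hinj : Set.InjOn σ U) (hfix : ∀ u ∈ U, σ u ≠ u) (d : ι → ℕ)
    (hd : ∀ u ∈ U, d (σ u) = d u) (S : Finset α) (κ : α → ℕ) (m : α → ι → ℕ)
    (hb : ∀ u ∈ U, ∀ v ∈ U, u ≠ v → d u * d v ≤ ∑ P ∈ S, κ P * m P u * m P v) :
    (∑ u ∈ U, d u) ^ 2 ≤ ∑ P ∈ S, κ P * (∑ u ∈ U, m P u) ^ 2 := by
  have himg : U.image σ = U := Finset.eq_of_subset_of_card_le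
    (Finset.image_subset_iff.2 hσ) (Finset.card_image_of_injOn hinj).ge
  have hP : ∀ P ∈ S, ∑ u ∈ U, (∑ v ∈ U.erase u, κ P * m P u * m P v + κ P * m P u * m P (σ u)) ≤
      κ P * (∑ u ∈ U, m P u) ^ 2 := by
    intro P _
    have h1 : ∑ u ∈ U, m P u * m P (σ u) ≤ ∑ u ∈ U, m P u * m P u := by
      have h2 : ∑ u ∈ U, m P (σ u) * m P (σ u) = ∑ u ∈ U, m P u * m P u := by
        conv_rhs => rw [← himg, Finset.sum_image hinj]
      have h3 : ∑ u ∈ U, 2 * (m P u * m P (σ u)) ≤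
          ∑ u ∈ U, (m P u * m P u + m P (σ u) * m P (σ u)) := by
        refine Finset.sum_le_sum fun u _ => ?_
        zify
        nlinarith [sq_nonneg ((m P u : ℤ) - m P (σ u))]
      rw [Finset.sum_add_distrib, h2, ← Finset.mul_sum] at h3
      omega
    have h4 : ∑ u ∈ U, (∑ v ∈ U.erase u, κ P * m P u * m P v + κ P * m P u * m P (σ u)) =
        κ P * (∑ u ∈ U, m P u * ∑ v ∈ U.erase u, m P v + ∑ u ∈ U, m P u * m P (σ u)) := by
      simp only [mul_add, Finset.sum_add_distrib, Finset.mul_sum, mul_assoc]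
    rw [h4]
    refine Nat.mul_le_mul_left _ ?_
    calc _ ≤ ∑ u ∈ U, m P u * ∑ v ∈ U.erase u, m P v + ∑ u ∈ U, m P u * m P u := by omega
      _ = ∑ u ∈ U, m P u * (∑ v ∈ U.erase u, m P v + m P u) := by
        rw [← Finset.sum_add_distrib]; simp only [mul_add]
      _ = ∑ u ∈ U, m P u * ∑ v ∈ U, m P v := Finset.sum_congr rfl fun u hu => by
        rw [Finset.sum_erase_add _ _ hu]
      _ = _ := by rw [← Finset.sum_mul, pow_two]
  calc (∑ u ∈ U, d u) ^ 2 = ∑ u ∈ U, (∑ v ∈ U.erase u, d u * d v + d u * d (σ u)) := by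
        rw [pow_two, Finset.sum_mul]
        refine Finset.sum_congr rfl fun u hu => ?_
        rw [hd u hu, Finset.sum_erase_add _ _ hu, Finset.mul_sum]
    _ ≤ ∑ u ∈ U, (∑ v ∈ U.erase u, ∑ P ∈ S, κ P * m P u * m P v +
          ∑ P ∈ S, κ P * m P u * m P (σ u)) := by
        refine Finset.sum_le_sum fun u hu => add_le_add (Finset.sum_le_sum fun v hv => ?_) ?_
        · exact hb u hu v (Finset.mem_of_mem_erase hv) (Finset.ne_of_mem_erase hv).symm
        · exact hb u hu _ (hσ u hu) (hfix u hu).symm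
    _ = ∑ P ∈ S, ∑ u ∈ U, (∑ v ∈ U.erase u, κ P * m P u * m P v + κ P * m P u * m P (σ u)) := by
        rw [Finset.sum_comm]
        refine Finset.sum_congr rfl fun u _ => ?_
        rw [Finset.sum_add_distrib, Finset.sum_comm]
    _ ≤ _ := Finset.sum_le_sum hP

theorem dvd_coeff_mul {R : Type*} [CommRing R] {c : R} {p r : R[X]} {a b : ℕ}
    (hp : ∀ i, a ≤ i → c ∣ p.coeff i) (hr : ∀ i, b ≤ i → c ∣ r.coeff i) {n : ℕ}
    (hn : a + b ≤ n + 1) : c ∣ (p * r).coeff n := by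
  rw [Polynomial.coeff_mul]
  refine Finset.dvd_sum fun ij hij => ?_
  rw [Finset.HasAntidiagonal.mem_antidiagonal] at hij
  by_cases h : a ≤ ij.1
  · exact dvd_mul_of_dvd_left (hp _ h) _
  · exact dvd_mul_of_dvd_right (hr _ (by omega)) _

theorem dvd_coeff_mul_of_natDegree_le {R : Type*} [CommRing R] {c : R} {p r : R[X]} {a b : ℕ}
    (hp : ∀ i, a ≤ i → c ∣ p.coeff i) (hr : r.natDegree ≤ b) {n : ℕ}
    (hn : a + b ≤ n) : c ∣ (p * r).coeff n := by
  rw [Polynomial.coeff_mul]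
  refine Finset.dvd_sum fun ij hij => ?_
  rw [Finset.HasAntidiagonal.mem_antidiagonal] at hij
  by_cases h : a ≤ ij.1
  · exact dvd_mul_of_dvd_left (hp _ h) _
  · rw [Polynomial.coeff_eq_zero_of_natDegree_lt (by omega : r.natDegree < ij.2), mul_zero]
    exact dvd_zero _

theorem dvd_coeff_of_dvd_leadingCoeff {R : Type*} [CommRing R] {c : R} {p : R[X]}
    (h : c ∣ p.leadingCoeff) {i : ℕ} (hi : p.natDegree ≤ i) : c ∣ p.coeff i := by
  rcases hi.eq_or_lt with rfl | hi
  · exact h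
  · rw [Polynomial.coeff_eq_zero_of_natDegree_lt hi]
    exact dvd_zero _

theorem exists_multiset_prod_of_monic {R : Type*} [CommRing R] [IsDomain R] (g : R[X])
    (hg : g.Monic) : ∃ s : Multiset R[X], (∀ u ∈ s, u.Monic ∧ Irreducible u) ∧ s.prod = g := by
  induction hn : g.natDegree using Nat.strong_induction_on generalizing g with
  | _ n ih =>
  subst hn
  by_cases h1 : g = 1
  · exact ⟨0, by simp, by simp [h1]⟩
  by_cases hirr : Irreducible g
  · exact ⟨{g}, by simpa using ⟨hg, hirr⟩, by simp⟩
  rw [Polynomial.irreducible_of_monic hg h1] at hirr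
  push Not at hirr
  obtain ⟨a, b, ha, hb, hab, ha1, hb1⟩ := hirr
  have hd := ha.natDegree_mul hb
  rw [hab] at hd
  have ha' : 0 < a.natDegree := Nat.pos_of_ne_zero (ha.natDegree_eq_zero.not.2 ha1)
  have hb' : 0 < b.natDegree := Nat.pos_of_ne_zero (hb.natDegree_eq_zero.not.2 hb1)
  obtain ⟨s, hs, rfl⟩ := ih a.natDegree (by omega) a ha rfl
  obtain ⟨t, ht, rfl⟩ := ih b.natDegree (by omega) b hb rfl
  refine ⟨s + t, fun u hu => ?_, by rw [Multiset.prod_add, hab]⟩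
  rcases Multiset.mem_add.1 hu with h | h
  exacts [hs u h, ht u h]

theorem exists_finset_prod_of_monic {R : Type*} [CommRing R] [IsDomain R] {g : R[X]}
    (hg : g.Monic) (hsq : ∀ u w : R[X], u.Monic → Irreducible u → g ≠ u * u * w) :
    ∃ U : Finset R[X], (∀ u ∈ U, u.Monic ∧ Irreducible u) ∧ ∏ u ∈ U, u = g := by
  classical
  obtain ⟨s, hs, rfl⟩ := exists_multiset_prod_of_monic g hg
  have hnd : s.Nodup := by
    rw [Multiset.nodup_iff_le]
    intro u hu
    obtain ⟨t, rfl⟩ := Multiset.le_iff_exists_add.1 hu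
    obtain ⟨h1, h2⟩ := hs u (by simp)
    exact hsq u t.prod h1 h2 (by simp [mul_assoc])
  exact ⟨⟨s, hnd⟩, hs, by simp [Finset.prod]⟩

end Combinatorics

section Tops

variable {k : Type*} [Field k]

theorem hom_quad (t : ℕ) : hom (quad k t) = Polynomial.C (xv ^ t + yv ^ t) * Polynomial.X ^ t + 1 +
    (Polynomial.C (xv + yv) * Polynomial.X + 1) ^ t := by
  simp only [quad, map_add, map_pow, map_one, hom_xv, hom_yv]
  ring

theorem coeff_linear_pow (c : k[X][Y]) (t n : ℕ) :
    ((Polynomial.C c * Polynomial.X + 1) ^ t).coeff n = c ^ n * (t.choose n : k[X][Y]) := by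
  have h : (Polynomial.C c * Polynomial.X + 1) ^ t =
      ((Polynomial.X + 1) ^ t).comp (Polynomial.C c * Polynomial.X) := by simp
  rw [h, Polynomial.comp_C_mul_X_coeff, Polynomial.coeff_X_add_one_pow, mul_comm]

variable [CharP k 2]

theorem isRelPrime_top {t : ℕ} (ht : Odd t) (h3 : 3 ≤ t) {u v w : k[X][Y]}
    (h : quad k t = u * v * w) (h0 : u * v * w ≠ 0) (hu1 : 0 < tdeg u) :
    IsRelPrime (top u) (top v) := by
  have hu : u ≠ 0 := by rintro rfl; simp at h0
  have hv : v ≠ 0 := by rintro rfl; simp at h0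
  have hw : w ≠ 0 := by rintro rfl; simp at h0
  have two : (2 : k[X][Y]) = 0 := CharTwo.two_eq_zero
  have htk : ∀ (K : Type _) [CommRing K] [CharP K 2], (t : K) = 1 := fun K _ _ => by
    obtain ⟨j, rfl⟩ := ht
    push_cast
    rw [CharTwo.two_eq_zero, zero_mul, zero_add]
  have hdeg : tdeg u + tdeg v + tdeg w ≤ t := by
    rw [← tdeg_mul hu hv, ← tdeg_mul (mul_ne_zero hu hv) hw, ← h, tdeg, hom_quad]
    compute_degree
  have hF : hom (quad k t) = hom u * hom v * hom w := by rw [h, map_mul, map_mul]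
  have c1 : (hom (quad k t)).coeff (t - 1) = (xv + yv) ^ (t - 1) := by
    rw [hom_quad, Polynomial.coeff_add, Polynomial.coeff_add, coeff_linear_pow,
      Polynomial.coeff_C_mul, Polynomial.coeff_X_pow, Polynomial.coeff_one, if_neg (by omega),
      if_neg (by omega), Nat.choose_symm (by omega : 1 ≤ t), Nat.choose_one_right, htk]
    ring
  have c0 : (hom (quad k t)).coeff t = xv ^ t + yv ^ t + (xv + yv) ^ t := by
    rw [hom_quad, Polynomial.coeff_add, Polynomial.coeff_add, coeff_linear_pow,
      Polynomial.coeff_C_mul, Polynomial.coeff_X_pow, Polynomial.coeff_one, if_pos rfl,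
      if_neg (by omega), Nat.choose_self]
    simp
  have hp : Prime (xv + yv : k[X][Y]) := by
    simpa [cst] using prime_linear_form (k := k) (a := 1) (b := 1) (Or.inl one_ne_zero)
  refine WfDvdMonoid.isRelPrime_of_no_irreducible_factors (fun h' => hu (top_eq_zero.1 h'.1)) ?_
  intro z hz hzu hzv
  have hz1 : z ∣ (xv + yv) ^ (t - 1) := by
    rw [← c1, hF]
    refine dvd_coeff_mul_of_natDegree_le (a := tdeg u + tdeg v - 1) (b := tdeg w) (fun i hi =>
      dvd_coeff_mul (a := tdeg u) (b := tdeg v) (fun i hi => dvd_coeff_of_dvd_leadingCoeff hzu hi)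
        (fun i hi => dvd_coeff_of_dvd_leadingCoeff hzv hi) (by omega)) le_rfl ?_
    omega
  have hzp : Associated z (xv + yv) := by
    exact hz.associated_of_dvd hp.irreducible (hz.prime.dvd_of_dvd_pow hz1)
  have hpu := hzp.dvd'.trans hzu
  have hpv := hzp.dvd'.trans hzv
  have hp2 : (xv + yv) ^ 2 ∣ (xv ^ t + yv ^ t + (xv + yv) ^ t : k[X][Y]) := by
    rw [← c0, hF]
    refine dvd_coeff_mul_of_natDegree_le (a := tdeg u + tdeg v) (b := tdeg w) (fun i hi => ?_) le_rfl
      hdeg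
    rcases hi.eq_or_lt with rfl | hi
    · rw [tdeg, tdeg, Polynomial.coeff_mul_degree_add_degree, pow_two]
      exact mul_dvd_mul hpu hpv
    · rw [Polynomial.coeff_eq_zero_of_natDegree_lt (lt_of_le_of_lt Polynomial.natDegree_mul_le hi)]
      exact dvd_zero _
  obtain ⟨r, hr⟩ : (xv + yv) ^ 2 ∣ (xv ^ t + yv ^ t : k[X][Y]) := by
    refine (dvd_add_left ?_).1 hp2
    exact pow_dvd_pow _ (by omega)
  have hd := congrArg (fun p => ev (1, 1) (Polynomial.derivative p)) hr
  simp only [Polynomial.derivative_mul, Polynomial.derivative_pow,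
    Polynomial.derivative_C, Polynomial.derivative_X, map_add, map_mul, map_pow, ev_xv, ev_yv,
    CharTwo.add_self_eq_zero] at hd
  simp [htk] at hd

end Tops

section Sig

variable {k : Type*} [Field k] [CharP k 2] [IsAlgClosed k]

theorem sig_bijective (n : ℕ) : Function.Bijective (sig k n) := by
  have h : Function.Surjective (iterateFrobenius k 2 n) := fun a => by
    obtain ⟨z, hz⟩ := IsAlgClosed.exists_pow_nat_eq a (n := 2 ^ n) (by positivity)
    exact ⟨z, by rw [iterateFrobenius_def, hz]⟩
  refine ⟨?_, ?_⟩
  · exact Polynomial.map_injective _ (Polynomial.map_injective _ (iterateFrobenius k 2 n).injective)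
  · exact Polynomial.map_surjective _ (Polynomial.map_surjective _ h)

theorem irreducible_sig {u : k[X][Y]} (hu : Irreducible u) (n : ℕ) : Irreducible (sig k n u) :=
  (MulEquiv.irreducible_iff (RingEquiv.ofBijective (sig k n) (sig_bijective n))).2 hu

end Sig

section SigBasic

variable {k : Type*} [Field k] [CharP k 2]

theorem monic_sig {u : k[X][Y]} (hu : u.Monic) (n : ℕ) : (sig k n u).Monic := hu.map _

theorem natDegree_sig (u : k[X][Y]) (n : ℕ) : (sig k n u).natDegree = u.natDegree :=
  Polynomial.natDegree_map_eq_of_injective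
    (Polynomial.map_injective _ (iterateFrobenius k 2 n).injective) _

theorem sig_xv (n : ℕ) : sig k n xv = xv := by simp [sig]

theorem sig_yv (n : ℕ) : sig k n yv = yv := by simp [sig]

theorem sig_quad (n t : ℕ) : sig k n (quad k t) = quad k t := by
  simp only [quad, map_add, map_pow, map_one, sig_xv, sig_yv]

end SigBasic

section Weights

variable {k : Type*} [Field k] [CharP k 2]

open Classical in
/-- The local contribution of a singular point to the intersection numbers. -/
noncomputable def bound (i : ℕ) (P : k × k) : ℕ :=
  if IsFix i P then
    if P.1 = 1 ∧ P.2 = 1 then (2 ^ i - 2) ^ 2 else if OnLine P then (2 ^ i) ^ 2 else (2 ^ i + 1) ^ 2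
  else if OnLine P ∨ i = 1 then 0 else 4 * 2 ^ i

theorem mult_lines (P : k × k) {g : k[X][Y]} (hg : g ≠ 0) :
    (P.1 = 1 ∧ P.2 = 1 → mult P g + 3 ≤ mult P ((xv + 1) * ((yv + 1) * ((xv + yv) * g)))) ∧
    (OnLine P → mult P g + 1 ≤ mult P ((xv + 1) * ((yv + 1) * ((xv + yv) * g)))) ∧
    mult P g ≤ mult P ((xv + 1) * ((yv + 1) * ((xv + yv) * g))) := by
  have hx : (xv + 1 : k[X][Y]) ≠ 0 := fun h => by
    simpa using congrArg (ev ((0 : k), (0 : k))) h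
  have hy : (yv + 1 : k[X][Y]) ≠ 0 := fun h => by
    simpa using congrArg (ev ((0 : k), (0 : k))) h
  have hxy : (xv + yv : k[X][Y]) ≠ 0 := fun h => by
    simpa using congrArg (ev ((1 : k), (0 : k))) h
  rw [mult_mul hx (mul_ne_zero hy (mul_ne_zero hxy hg)), mult_mul hy (mul_ne_zero hxy hg),
    mult_mul hxy hg]
  have h1 : P.1 = 1 → 0 < mult P (xv + 1) := fun h => mult_pos hx (by
    simp [h, CharTwo.add_self_eq_zero])
  have h2 : P.2 = 1 → 0 < mult P (yv + 1) := fun h => mult_pos hy (by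
    simp [h, CharTwo.add_self_eq_zero])
  have h3 : P.1 = P.2 → 0 < mult P (xv + yv) := fun h => mult_pos hxy (by
    simp [h, CharTwo.add_self_eq_zero])
  refine ⟨fun h => ?_, fun h => ?_, by omega⟩
  · have := h1 h.1
    have := h2 h.2
    have := h3 (h.1.trans h.2.symm)
    omega
  · rcases h with h | h | h
    · have := h1 h; omega
    · have := h2 h; omega
    · have := h3 h; omega

theorem exists_weights [IsAlgClosed k] {P : k × k} {i l : ℕ} (hi : 1 ≤ i) (hl : Odd l)
    (hP : IsSing l P) (U : Finset k[X][Y]) (hU : ∀ u ∈ U, u ≠ 0)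
    (h : quad k (2 ^ i * l + 1) = (xv + 1) * ((yv + 1) * ((xv + yv) * ∏ u ∈ U, u)))
    (h0 : quad k (2 ^ i * l + 1) ≠ 0) :
    ∃ (κ : ℕ) (m : k[X][Y] → ℕ), (∀ u ∈ U, ∀ v ∈ U, u ≠ v → LocLE u v P (κ * m u * m v)) ∧
      κ * (∑ u ∈ U, m u) ^ 2 ≤ bound i P := by
  classical
  have hw : ∀ u ∈ U, ∀ v ∈ U, u ≠ v → quad k (2 ^ i * l + 1) =
      u * v * ((xv + 1) * ((yv + 1) * ((xv + yv) * ∏ u ∈ (U.erase u).erase v, u))) := by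
    intro u hu v hv huv
    rw [h, ← Finset.mul_prod_erase U _ hu,
      ← Finset.mul_prod_erase (U.erase u) _ (Finset.mem_erase.2 ⟨huv.symm, hv⟩)]
    ring
  have hprod : ∏ u ∈ U, u ≠ 0 := Finset.prod_ne_zero_iff.2 hU
  by_cases hf : IsFix i P
  · refine ⟨1, mult P, fun u hu v hv huv => ?_, ?_⟩
    · rw [one_mul]
      exact locLE_of_isFix hi hl (hw u hu v hv huv) hP hf
    · rw [one_mul, ← mult_prod P U (fun u => u) hU, bound, if_pos hf]
      have hm := (hP.mult_of_isFix hi hl hf).1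
      rw [h] at hm
      obtain ⟨h1, h2, h3⟩ := mult_lines P hprod
      rw [hm] at h1 h2 h3
      split_ifs with c1 c2
      · exact Nat.pow_le_pow_left (by have := h1 c1; omega) 2
      · exact Nat.pow_le_pow_left (by have := h2 c2; omega) 2
      · exact Nat.pow_le_pow_left h3 2
  · have key : ∀ u ∈ U, ∀ v ∈ U, u ≠ v → ev P u = 0 → ev P v = 0 →
        ¬ OnLine P ∧ i ≠ 1 ∧ LocLE u v P (2 ^ i) ∧ ∀ z ∈ (U.erase u).erase v, ev P z ≠ 0 := by
      intro u hu v hv huv eu evv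
      have h1 := hw u hu v hv huv
      obtain ⟨a1, a2, a3⟩ := locLE_of_not_isFix hi hl h1 (by rwa [← h1]) hf eu evv
      have hno : ¬ OnLine P := by
        intro ho
        apply a1
        rcases ho with ho | ho | ho <;> simp [ho, CharTwo.add_self_eq_zero]
      refine ⟨hno, fun h => hno (a2 h), a3, fun z hz hz0 => a1 ?_⟩
      rw [map_mul, map_mul, map_mul, map_prod, Finset.prod_eq_zero hz hz0]
      ring
    by_cases hc : OnLine P ∨ i = 1
    · refine ⟨0, fun _ => 0, fun u hu v hv huv => locLE_zero ?_, by simp⟩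
      rintro ⟨eu, evv⟩
      obtain ⟨a1, a2, -⟩ := key u hu v hv huv eu evv
      exact hc.elim a1 a2
    · refine ⟨2 ^ i, fun u => if ev P u = 0 then 1 else 0, fun u hu v hv huv => ?_, ?_⟩
      · by_cases he : ev P u = 0 ∧ ev P v = 0
        · dsimp only
          rw [if_pos he.1, if_pos he.2, mul_one, mul_one]
          exact (key u hu v hv huv he.1 he.2).2.2.1
        · exact (locLE_zero he).mono (Nat.zero_le _)
      · rw [bound, if_neg hf, if_neg hc, mul_comm]
        refine Nat.mul_le_mul_right _ ?_
        rw [← Finset.card_filter]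
        suffices hc2 : (U.filter fun u => ev P u = 0).card ≤ 2 from Nat.pow_le_pow_left hc2 2
        by_contra! hcard
        obtain ⟨a, b, c, ha, hb, hc', hab, hac, hbc⟩ := Finset.two_lt_card_iff.1 hcard
        rw [Finset.mem_filter] at ha hb hc'
        exact (key a ha.1 b hb.1 hab ha.2 hb.2).2.2.2 c
          (Finset.mem_erase.2 ⟨hbc.symm, Finset.mem_erase.2 ⟨hac.symm, hc'.1⟩⟩) hc'.2

theorem sq_le_sum_bound [IsAlgClosed k] {i l : ℕ} (hi : 1 ≤ i) (hl : Odd l) {g : k[X][Y]}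
    (hg : Good g)
    (h : quad k (2 ^ i * l + 1) = (xv + 1) * ((yv + 1) * ((xv + yv) * g)))
    (hno : ∀ u : k[X][Y], u.Monic → Irreducible u → u ∣ g → sig k 1 u ≠ u)
    (S : Finset (k × k)) (hS : ∀ P, IsSing l P → P ∈ S) (hS' : ∀ P ∈ S, IsSing l P) :
    g.natDegree ^ 2 ≤ ∑ P ∈ S, bound i P := by
  classical
  have hlpos := hl.pos
  have ht : Odd (2 ^ i * l + 1) := by
    refine Even.add_one (Even.mul_right ?_ _)
    exact (Nat.even_pow.2 ⟨even_two, by omega⟩)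
  have h3 : 3 ≤ 2 ^ i * l + 1 := by
    have : 2 ≤ 2 ^ i := by
      have := Nat.pow_le_pow_right (n := 2) (by norm_num) hi; omega
    nlinarith
  have hx : (xv + 1 : k[X][Y]) ≠ 0 := fun h => by
    simpa using congrArg (ev ((0 : k), (0 : k))) h
  have hy : (yv + 1 : k[X][Y]) ≠ 0 := fun h => by
    simpa using congrArg (ev ((0 : k), (0 : k))) h
  have hxy : (xv + yv : k[X][Y]) ≠ 0 := fun h => by
    simpa using congrArg (ev ((1 : k), (0 : k))) h
  have h0 : quad k (2 ^ i * l + 1) ≠ 0 := by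
    rw [h]
    exact mul_ne_zero hx (mul_ne_zero hy (mul_ne_zero hxy hg.monic.ne_zero))
  have hpos : ∀ u : k[X][Y], u.Monic → Irreducible u → 0 < u.natDegree := fun u hm hi =>
    Nat.pos_of_ne_zero fun h0 => hi.not_isUnit (by rw [hm.natDegree_eq_zero.1 h0]; exact isUnit_one)
  obtain ⟨U, hU, rfl⟩ := exists_finset_prod_of_monic hg.monic (fun u w hm hirr he => by
    obtain ⟨y, hy⟩ := IsAlgClosed.exists_root (u.map (Polynomial.evalRingHom (0 : k))) (by
      rw [hm.degree_map, Polynomial.degree_eq_natDegree hm.ne_zero]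
      exact_mod_cast (hpos u hm hirr).ne')
    have he0 : ev ((0 : k), y) u = 0 := by rw [ev_eq_eval_map]; exact hy
    have := isSing_of_eq_mul hi hl (w := (xv + 1) * (yv + 1) * (xv + yv) * w)
      (by rw [h, he]; ring) he0 he0
    have h1 := this.1
    simp only at h1
    rw [zero_pow hlpos.ne'] at h1
    exact zero_ne_one h1)
  have hgood : ∀ u ∈ U, Good u := fun u hu => hg.of_dvd (hU u hu).1 (Finset.dvd_prod_of_mem _ hu)
  have hfix : sig k 1 (∏ u ∈ U, u) = ∏ u ∈ U, u := by
    have h1 := sig_quad (k := k) 1 (2 ^ i * l + 1)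
    rw [h] at h1
    simp only [map_mul, map_add, map_one, sig_xv, sig_yv] at h1
    exact mul_left_cancel₀ hxy (mul_left_cancel₀ hy (mul_left_cancel₀ hx h1))
  have hne : ∀ u ∈ U, ∀ v ∈ U, u ≠ v → ¬ u ∣ v := fun u hu v hv huv hd =>
    huv (Polynomial.eq_of_monic_of_associated (hU u hu).1 (hU v hv).1
      ((hU u hu).2.associated_of_dvd (hU v hv).2 hd))
  have hw : ∀ P ∈ S, ∃ (κ : ℕ) (m : k[X][Y] → ℕ),
      (∀ u ∈ U, ∀ v ∈ U, u ≠ v → LocLE u v P (κ * m u * m v)) ∧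
        κ * (∑ u ∈ U, m u) ^ 2 ≤ bound i P := fun P hP =>
    exists_weights hi hl (hS' P hP) U (fun u hu => (hU u hu).1.ne_zero) h h0
  choose! κ m hm1 hm2 using hw
  rw [Polynomial.natDegree_prod_of_monic _ _ fun u hu => (hU u hu).1]
  refine (sq_sum_le_of_fixedPointFree U (sig k 1) ?_ ((sig_bijective 1).1.injOn) (fun u hu =>
    hno u (hU u hu).1 (hU u hu).2 (Finset.dvd_prod_of_mem _ hu)) _ (fun u _ => natDegree_sig u 1)
    S κ m ?_).trans (Finset.sum_le_sum hm2)
  · intro u hu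
    have hd : sig k 1 u ∣ ∏ u ∈ U, u := by
      rw [← hfix]; exact map_dvd _ (Finset.dvd_prod_of_mem _ hu)
    have hs := irreducible_sig (hU u hu).2 1
    obtain ⟨v, hv, hdv⟩ := (Prime.dvd_finsetProd_iff hs.prime _).1 hd
    rw [Polynomial.eq_of_monic_of_associated (monic_sig (hU u hu).1 1) (hU v hv).1
      (hs.associated_of_dvd (hU v hv).2 hdv)]
    exact hv
  · intro u hu v hv huv
    have hq : quad k (2 ^ i * l + 1) =
      u * v * ((xv + 1) * ((yv + 1) * ((xv + yv) * ∏ u ∈ (U.erase u).erase v, u))) := by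
      rw [h, ← Finset.mul_prod_erase U _ hu,
        ← Finset.mul_prod_erase (U.erase u) _ (Finset.mem_erase.2 ⟨huv.symm, hv⟩)]
      ring
    refine (hgood u hu).mul_le_sum (hgood v hv) (hU u hu).2 (hne u hu v hv huv)
      (isRelPrime_top ht h3 hq (by rwa [← hq]) ?_) S (fun P h1 h2 => hS P ?_) _
      (fun P hP => hm1 P hP u hu v hv huv)
    · rw [(hgood u hu).tdeg_eq]; exact hpos u (hU u hu).1 (hU u hu).2
    · exact isSing_of_eq_mul hi hl hq h1 h2

end Weights

section Counting

variable {k : Type*} [Field k]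

theorem card_nthRootsFinset_le (l : ℕ) : (Polynomial.nthRootsFinset l (1 : k)).card ≤ l := by
  classical
  rw [Polynomial.nthRootsFinset_def]
  exact (Multiset.toFinset_card_le _).trans (Polynomial.card_nthRoots l 1)

theorem even_card_of_involution {α : Type*} (s : Finset α) (f : α → α) (h1 : ∀ a ∈ s, f a ∈ s)
    (h2 : ∀ a ∈ s, f a ≠ a) (h3 : ∀ a ∈ s, f (f a) = a) : Even s.card := by
  have h : ∑ _a ∈ s, (1 : ZMod 2) = 0 := Finset.sum_involution (fun a _ => f a)
    (fun _ _ => by decide) (fun a ha _ => h2 a ha) (fun a ha => h1 a ha) (fun a ha => h3 a ha)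
  rw [Finset.sum_const, nsmul_eq_mul, mul_one] at h
  exact (ZMod.natCast_eq_zero_iff_even).1 h

theorem card_onLine_le [DecidableEq k] (E : Finset k) (A : Finset (k × k))
    (h : ∀ P ∈ A, P.1 ∈ E ∧ P.2 ∈ E ∧ OnLine P ∧ ¬ (P.1 = 1 ∧ P.2 = 1)) :
    A.card ≤ 3 * (E.erase 1).card := by
  have hsub : A ⊆ (E.erase 1).image (fun b => (1, b)) ∪ ((E.erase 1).image (fun a => (a, 1)) ∪
      (E.erase 1).image (fun a => (a, a))) := by
    rintro ⟨a, b⟩ hP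
    obtain ⟨ha, hb, ho, hn⟩ := h _ hP
    simp only [OnLine] at ha hb ho hn
    simp only [Finset.mem_union, Finset.mem_image, Finset.mem_erase, Prod.mk.injEq]
    rcases ho with rfl | rfl | rfl
    · exact Or.inl ⟨b, ⟨fun h => hn ⟨rfl, h⟩, hb⟩, rfl, rfl⟩
    · exact Or.inr (Or.inl ⟨a, ⟨fun h => hn ⟨h, rfl⟩, ha⟩, rfl, rfl⟩)
    · exact Or.inr (Or.inr ⟨a, ⟨fun h => hn ⟨h, h⟩, ha⟩, rfl, rfl⟩)
  refine (Finset.card_le_card hsub).trans ((Finset.card_union_le _ _).trans ?_)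
  have h1 := Finset.card_union_le ((E.erase 1).image (fun a => (a, (1 : k))))
    ((E.erase 1).image (fun a => (a, a)))
  have h2 := Finset.card_image_le (s := E.erase 1) (f := fun b => ((1 : k), b))
  have h3 := Finset.card_image_le (s := E.erase 1) (f := fun a => (a, (1 : k)))
  have h4 := Finset.card_image_le (s := E.erase 1) (f := fun a => (a, a))
  omega

variable [CharP k 2]

theorem card_not_onLine_le [DecidableEq k] (E : Finset k) (h1 : 1 ∈ E) {e : ℕ} (he : Odd e)
    (hE : E.card ≤ e) (B : Finset (k × k))
    (h : ∀ P, P ∈ B ↔ P.1 ∈ E ∧ P.2 ∈ E ∧ P.1 + P.2 + 1 ∈ E ∧ ¬ OnLine P) :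
    B.card ≤ (e - 3) * (E.erase 1).card := by
  have two : (2 : k) = 0 := CharTwo.two_eq_zero
  refine (Finset.card_le_mul_card_image (f := Prod.fst) B (e - 3) ?_).trans
    (Nat.mul_le_mul_left _ (Finset.card_le_card ?_))
  · intro a ha
    obtain ⟨P, hP, rfl⟩ := Finset.mem_image.1 ha
    obtain ⟨ha, -, -, hl⟩ := (h P).1 hP
    have ha1 : P.1 ≠ 1 := fun h => hl (Or.inl h)
    have heven : Even (B.filter fun Q => Q.1 = P.1).card := by
      refine even_card_of_involution _ (fun Q => (Q.1, Q.1 + Q.2 + 1)) ?_ ?_ ?_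
      · intro Q hQ
        rw [Finset.mem_filter, h] at hQ ⊢
        obtain ⟨⟨q1, q2, q3, q4⟩, q5⟩ := hQ
        refine ⟨⟨q1, q3, ?_, ?_⟩, q5⟩
        · rw [show Q.1 + (Q.1 + Q.2 + 1) + 1 = Q.2 by linear_combination (Q.1 + 1) * two]
          exact q2
        · rintro (ho | ho | ho) <;> simp only at ho
          · exact q4 (Or.inl ho)
          · exact q4 (Or.inr (Or.inr (by linear_combination ho - Q.2 * two)))
          · exact q4 (Or.inr (Or.inl (by linear_combination -ho - two)))
      · intro Q hQ he
        have := (Prod.ext_iff.1 he).2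
        simp only at this
        rw [Finset.mem_filter] at hQ
        exact ha1 (hQ.2 ▸ (by linear_combination this - two : Q.1 = 1))
      · intro Q _
        refine Prod.ext rfl ?_
        simp only
        linear_combination (Q.1 + 1) * two
    have hsub : (B.filter fun Q => Q.1 = P.1) ⊆ ((E.erase 1).erase P.1).image
        fun b => (P.1, b) := by
      intro Q hQ
      rw [Finset.mem_filter, h] at hQ
      obtain ⟨⟨q1, q2, q3, q4⟩, q5⟩ := hQ
      refine Finset.mem_image.2 ⟨Q.2, Finset.mem_erase.2 ⟨fun h => q4 (Or.inr (Or.inr ?_)),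
        Finset.mem_erase.2 ⟨fun h => q4 (Or.inr (Or.inl h)), q2⟩⟩, Prod.ext q5.symm rfl⟩
      rw [q5, h]
    have hc := (Finset.card_le_card hsub).trans Finset.card_image_le
    rw [Finset.card_erase_of_mem (Finset.mem_erase.2 ⟨ha1, ha⟩), Finset.card_erase_of_mem h1] at hc
    obtain ⟨c, hc'⟩ := heven
    obtain ⟨d, hd⟩ := he
    change (B.filter fun Q => Q.1 = P.1).card ≤ _
    omega
  · intro a ha
    obtain ⟨P, hP, rfl⟩ := Finset.mem_image.1 ha
    obtain ⟨ha, -, -, hl⟩ := (h P).1 hP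
    exact Finset.mem_erase.2 ⟨fun h => hl (Or.inl h), ha⟩

theorem exists_sing_sum_le {i l : ℕ} (hi : 1 ≤ i) (hl : Odd l) :
    ∃ S : Finset (k × k), (∀ P, P ∈ S ↔ IsSing l P) ∧
      ∑ P ∈ S, bound i P ≤ (2 ^ i - 2) ^ 2 + 3 * (l.gcd (2 ^ i - 1) - 1) * (2 ^ i) ^ 2 +
        (l.gcd (2 ^ i - 1) - 3) * (l.gcd (2 ^ i - 1) - 1) * (2 ^ i + 1) ^ 2 +
        if l ∣ 2 ^ i - 1 ∨ i = 1 then 0 else (l - 1) * (l - 2) * (4 * 2 ^ i) := by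
  classical
  have hlpos := hl.pos
  obtain ⟨T, hT⟩ : ∃ T, T = Polynomial.nthRootsFinset l (1 : k) := ⟨_, rfl⟩
  obtain ⟨e, he⟩ : ∃ e, e = l.gcd (2 ^ i - 1) := ⟨_, rfl⟩
  obtain ⟨E, hE⟩ : ∃ E, E = Polynomial.nthRootsFinset e (1 : k) := ⟨_, rfl⟩
  have hepos : 0 < e := he ▸ Nat.gcd_pos_of_pos_left _ hlpos
  have hTc : T.card ≤ l := hT ▸ card_nthRootsFinset_le l
  have hEc : E.card ≤ e := hE ▸ card_nthRootsFinset_le e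
  have memT : ∀ a, a ∈ T ↔ a ^ l = 1 := fun a => by
    rw [hT, Polynomial.mem_nthRootsFinset hlpos]
  have memE : ∀ a, a ∈ E ↔ a ^ e = 1 := fun a => by
    rw [hE, Polynomial.mem_nthRootsFinset hepos]
  have hq : 2 ≤ 2 ^ i := by
    have := Nat.pow_le_pow_right (n := 2) (by norm_num) hi; omega
  have fixiff : ∀ a : k, a ^ l = 1 → (a ^ 2 ^ i = a ↔ a ∈ E) := by
    intro a ha
    have ha0 : a ≠ 0 := by rintro rfl; rw [zero_pow hlpos.ne'] at ha; exact zero_ne_one ha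
    have h1 : a ^ 2 ^ i = a ↔ a ^ (2 ^ i - 1) = 1 := by
      conv_lhs => rw [show 2 ^ i = (2 ^ i - 1) + 1 by omega, pow_succ]
      exact mul_eq_right₀ ha0
    rw [h1, memE, he, ← orderOf_dvd_iff_pow_eq_one, ← orderOf_dvd_iff_pow_eq_one, Nat.dvd_gcd_iff,
      and_iff_right (orderOf_dvd_of_pow_eq_one ha)]
  have hodd : Odd e := Odd.of_dvd_nat hl (he ▸ Nat.gcd_dvd_left _ _)
  have h1E : (1 : k) ∈ E := by rw [memE, one_pow]
  have hET : ∀ a ∈ E, a ∈ T := fun a ha => by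
    rw [memE] at ha
    rw [memT]
    obtain ⟨c, hc⟩ : e ∣ l := he ▸ Nat.gcd_dvd_left _ _
    rw [hc, pow_mul, ha, one_pow]
  have hS : ∀ P, P ∈ (T ×ˢ T).filter (IsSing l) ↔ IsSing l P := fun P => by
    rw [Finset.mem_filter, Finset.mem_product, memT, memT]
    exact ⟨fun h => h.2, fun h => ⟨⟨h.1, h.2.1⟩, h⟩⟩
  refine ⟨(T ×ˢ T).filter (IsSing l), hS, ?_⟩
  rw [← he]
  generalize (T ×ˢ T).filter (IsSing l) = S at hS
  rw [← Finset.sum_filter_add_sum_filter_not S (IsFix i)]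
  refine add_le_add ?_ ?_
  · have hfix : ∀ P, P ∈ S.filter (IsFix i) ↔ P.1 ∈ E ∧ P.2 ∈ E ∧ P.1 + P.2 + 1 ∈ E := by
      intro P
      rw [Finset.mem_filter, hS]
      constructor
      · rintro ⟨⟨h1, h2, h3⟩, h4, h5⟩
        refine ⟨(fixiff _ h1).1 h4, (fixiff _ h2).1 h5, (fixiff _ h3).1 ?_⟩
        rw [add_pow_char_pow, add_pow_char_pow, h4, h5, one_pow]
      · rintro ⟨h1, h2, h3⟩
        have h1' := (memT _).1 (hET _ h1)
        have h2' := (memT _).1 (hET _ h2)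
        have h3' := (memT _).1 (hET _ h3)
        exact ⟨⟨h1', h2', h3'⟩, (fixiff _ h1').2 h1, (fixiff _ h2').2 h2⟩
    have hb : ∀ P ∈ S.filter (IsFix i), bound i P = if P.1 = 1 ∧ P.2 = 1 then (2 ^ i - 2) ^ 2
        else if OnLine P then (2 ^ i) ^ 2 else (2 ^ i + 1) ^ 2 := fun P hP => by
      rw [bound, if_pos (Finset.mem_filter.1 hP).2]
    rw [Finset.sum_congr rfl hb, Finset.sum_ite, Finset.sum_ite, Finset.sum_const,
      Finset.sum_const, Finset.sum_const, smul_eq_mul, smul_eq_mul, smul_eq_mul, ← add_assoc]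
    refine add_le_add (add_le_add ?_ ?_) ?_
    · refine (Nat.mul_le_mul_right _ (Finset.card_le_one_iff.2 ?_)).trans (one_mul _).le
      intro P Q hP hQ
      rw [Finset.mem_filter] at hP hQ
      exact Prod.ext (hP.2.1.trans hQ.2.1.symm) (hP.2.2.trans hQ.2.2.symm)
    · refine Nat.mul_le_mul_right _ ((card_onLine_le E _ ?_).trans ?_)
      · intro P hP
        rw [Finset.mem_filter, Finset.mem_filter, hfix] at hP
        exact ⟨hP.1.1.1, hP.1.1.2.1, hP.2, hP.1.2⟩
      · rw [Finset.card_erase_of_mem h1E]; omega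
    · refine Nat.mul_le_mul_right _ ((card_not_onLine_le E h1E hodd hEc _ ?_).trans
        (Nat.mul_le_mul_left _ ?_))
      · intro P
        rw [Finset.mem_filter, Finset.mem_filter, hfix]
        constructor
        · rintro ⟨⟨h1, h2⟩, h3⟩
          exact ⟨h1.1, h1.2.1, h1.2.2, h3⟩
        · rintro ⟨h1, h2, h3, h4⟩
          exact ⟨⟨⟨h1, h2, h3⟩, fun h => h4 (Or.inl h.1)⟩, h4⟩
      · rw [Finset.card_erase_of_mem h1E]; omega
  · have hb : ∀ P ∈ S.filter (fun P => ¬ IsFix i P), bound i P =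
        if OnLine P ∨ i = 1 then 0 else 4 * 2 ^ i := fun P hP => by
      rw [bound, if_neg (Finset.mem_filter.1 hP).2]
    rw [Finset.sum_congr rfl hb, Finset.sum_ite, Finset.sum_const_zero, zero_add, Finset.sum_const,
      smul_eq_mul]
    split_ifs with hc
    · refine (Nat.mul_eq_zero.2 (Or.inl (Finset.card_eq_zero.2 ?_))).le
      refine Finset.filter_eq_empty_iff.2 fun P hP => not_not.2 ?_
      rw [Finset.mem_filter, hS] at hP
      rcases hc with hc | hc
      · have hle : e = l := by rw [he]; exact Nat.gcd_eq_left hc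
        refine absurd ⟨(fixiff _ hP.1.1).2 ?_, (fixiff _ hP.1.2.1).2 ?_⟩ hP.2
        · rw [memE, hle]; exact hP.1.1
        · rw [memE, hle]; exact hP.1.2.1
      · exact Or.inr hc
    · refine Nat.mul_le_mul_right _ ?_
      have h1T : (1 : k) ∈ T := by rw [memT, one_pow]
      refine (Finset.card_le_card (t := (T.erase 1).offDiag) ?_).trans ?_
      · intro P hP
        rw [Finset.mem_filter, Finset.mem_filter, hS] at hP
        obtain ⟨⟨h1, -⟩, h2⟩ := hP
        rw [Finset.mem_offDiag, Finset.mem_erase, Finset.mem_erase, memT, memT]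
        exact ⟨⟨fun h => h2 (Or.inl (Or.inl h)), h1.1⟩,
          ⟨fun h => h2 (Or.inl (Or.inr (Or.inl h))), h1.2.1⟩,
          fun h => h2 (Or.inl (Or.inr (Or.inr h)))⟩
      · rw [Finset.offDiag_card, Finset.card_erase_of_mem h1T, ← Nat.mul_sub_one]
        exact Nat.mul_le_mul (by omega) (by omega)

end Counting

section Numeric

theorem numeric_lt {i l : ℕ} (hi : 1 ≤ i) (hl : Odd l) (h3 : 3 ≤ l) (hne : l ≠ 2 ^ i - 1) :
    (2 ^ i - 2) ^ 2 + 3 * (l.gcd (2 ^ i - 1) - 1) * (2 ^ i) ^ 2 +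
        (l.gcd (2 ^ i - 1) - 3) * (l.gcd (2 ^ i - 1) - 1) * (2 ^ i + 1) ^ 2 +
        (if l ∣ 2 ^ i - 1 ∨ i = 1 then 0 else (l - 1) * (l - 2) * (4 * 2 ^ i)) <
      (2 ^ i * l - 2) ^ 2 := by
  have hq : 2 ≤ 2 ^ i := by
    have := Nat.pow_le_pow_right (n := 2) (by norm_num) hi; omega
  have hqe : Even (2 ^ i) := Nat.even_pow.2 ⟨even_two, by omega⟩
  have hi8 : 2 ^ i = 2 ∧ i = 1 ∨ 2 ^ i = 4 ∧ i ≠ 1 ∨ 8 ≤ 2 ^ i ∧ i ≠ 1 := by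
    by_cases h1 : i = 1
    · left; subst h1; simp
    by_cases h2 : i = 2
    · right; left; subst h2; simp
    · right; right
      have := Nat.pow_le_pow_right (n := 2) (by norm_num) (show 3 ≤ i by omega)
      omega
  obtain ⟨e, he⟩ : ∃ e, e = l.gcd (2 ^ i - 1) := ⟨_, rfl⟩
  rw [← he]
  have hepos : 0 < e := he ▸ Nat.gcd_pos_of_pos_left _ (by omega)
  obtain ⟨m, hm⟩ : e ∣ l := he ▸ Nat.gcd_dvd_left _ _
  obtain ⟨r, hr⟩ : e ∣ 2 ^ i - 1 := he ▸ Nat.gcd_dvd_right _ _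
  have hdvd : l ∣ 2 ^ i - 1 ↔ e = l := by rw [he]; exact Nat.gcd_eq_left_iff_dvd.symm
  simp only [hdvd]
  clear hdvd he
  generalize 2 ^ i = q at *
  have hoe : Odd e := Odd.of_dvd_nat hl ⟨m, hm⟩
  by_cases hel : e = l
  · rw [if_pos (Or.inl hel)]
    subst hel
    have hr1 : r ≠ 1 := by rintro rfl; omega
    have hr2 : r ≠ 2 := by
      rintro rfl
      obtain ⟨c, hc⟩ := hqe
      omega
    have hr0 : r ≠ 0 := by rintro rfl; omega
    have hq3 : 3 * e + 1 ≤ q := by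
      have : e * 3 ≤ e * r := Nat.mul_le_mul_left _ (by omega)
      omega
    obtain ⟨x, rfl⟩ : ∃ x, e = x + 3 := ⟨e - 3, by omega⟩
    obtain ⟨y, rfl⟩ : ∃ y, q = y + (3 * (x + 3) + 1) := ⟨_, (Nat.sub_add_cancel hq3).symm⟩
    zify [show 2 ≤ y + (3 * (x + 3) + 1) by omega, show 3 ≤ x + 3 by omega,
      show 1 ≤ x + 3 by omega, show 2 ≤ (y + (3 * (x + 3) + 1)) * (x + 3) by nlinarith]
    have hx : (0 : ℤ) ≤ x := Int.natCast_nonneg x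
    have hy : (0 : ℤ) ≤ y := Int.natCast_nonneg y
    generalize (x : ℤ) = x at *
    generalize (y : ℤ) = y at *
    rw [← sub_pos]
    ring_nf
    positivity
  · have hm3 : 3 ≤ m := by
      have h1 : m ≠ 1 := by rintro rfl; omega
      have h2 : m ≠ 2 := by
        rintro rfl
        obtain ⟨c, hc⟩ := hl
        omega
      have h0 : m ≠ 0 := by rintro rfl; omega
      omega
    have h3e : 3 * e ≤ l := by
      rw [hm, mul_comm]; exact Nat.mul_le_mul_left _ hm3
    rcases hi8 with ⟨hq2, hi1⟩ | ⟨hq4, hi1⟩ | ⟨hq8, hi1⟩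
    · rw [if_pos (Or.inr hi1)]
      subst hq2
      have : e = 1 := Nat.eq_one_of_mul_eq_one_right (by omega : e * r = 1)
      subst this
      have : 0 < (2 * l - 2) ^ 2 := pow_pos (by omega) 2
      simpa using this
    · rw [if_neg (by tauto)]
      subst hq4
      have : e = 1 ∨ e = 3 := (Nat.dvd_prime Nat.prime_three).1 ⟨r, by omega⟩
      obtain ⟨x, rfl⟩ : ∃ x, l = x + 3 := ⟨l - 3, by omega⟩
      rw [show x + 3 - 1 = x + 2 by omega, show x + 3 - 2 = x + 1 by omega,
        show 4 * (x + 3) - 2 = 4 * x + 10 by omega]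
      rcases this with rfl | rfl
      · norm_num; nlinarith
      · norm_num; nlinarith
    · rw [if_neg (by tauto)]
      have hA : (q - 2) ^ 2 + 3 * (e - 1) * q ^ 2 + (e - 3) * (e - 1) * (q + 1) ^ 2 ≤
          e ^ 2 * (q + 1) ^ 2 := by
        obtain ⟨z, rfl⟩ : ∃ z, q = z + 2 := ⟨q - 2, by omega⟩
        obtain ⟨c, hc⟩ := hoe
        rcases Nat.eq_zero_or_pos c with rfl | hc0
        · subst hc
          simp
          nlinarith
        · obtain ⟨y, rfl⟩ : ∃ y, e = y + 3 := ⟨e - 3, by omega⟩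
          rw [show y + 3 - 1 = y + 2 by omega, show y + 3 - 3 = y by omega,
            show z + 2 - 2 = z by omega]
          nlinarith [Nat.zero_le (y * z), Nat.zero_le (y * z ^ 2), Nat.zero_le (y ^ 2 * z)]
      refine lt_of_le_of_lt (add_le_add_left hA _) ?_
      have h1 : 64 * (q + 1) ^ 2 ≤ 81 * q ^ 2 := by nlinarith
      have h2 : 9 * e ^ 2 ≤ l ^ 2 := by nlinarith
      have h4 := Nat.mul_le_mul h2 h1
      have h5 : 8 * (q * l ^ 2) ≤ q ^ 2 * l ^ 2 := by nlinarith [Nat.zero_le (q * l ^ 2)]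
      obtain ⟨x, rfl⟩ : ∃ x, l = x + 3 := ⟨l - 3, by omega⟩
      rw [show x + 3 - 1 = x + 2 by omega, show x + 3 - 2 = x + 1 by omega]
      zify [show 2 ≤ q * (x + 3) by nlinarith]
      zify at h4 h5
      have hx : (0 : ℤ) ≤ x := Int.natCast_nonneg x
      have hqq : (8 : ℤ) ≤ q := by exact_mod_cast hq8
      have h6 : (0 : ℤ) ≤ q * x := by positivity
      have h7 : (0 : ℤ) < (q : ℤ) ^ 2 * ((x : ℤ) + 3) ^ 2 := by positivity
      nlinarith

end Numeric

section Factor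

variable {k : Type*} [Field k] [CharP k 2] [IsAlgClosed k]

theorem exists_sig_fixed_factor {i l : ℕ} (hi : 1 ≤ i) (hl : Odd l) (h3 : 3 ≤ l)
    (hne : l ≠ 2 ^ i - 1) {g : k[X][Y]} (hg : Good g) (hdeg : g.natDegree = 2 ^ i * l + 1 - 3)
    (h : quad k (2 ^ i * l + 1) = (xv + 1) * ((yv + 1) * ((xv + yv) * g))) :
    ∃ u : k[X][Y], u.Monic ∧ Irreducible u ∧ u ∣ g ∧ sig k 1 u = u := by
  by_contra! hno
  obtain ⟨S, hS, hsum⟩ := exists_sing_sum_le (k := k) hi hl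
  have h1 := sq_le_sum_bound hi hl hg h (fun u a b c => hno u a b c) S (fun P => (hS P).2)
    (fun P => (hS P).1)
  have h2 := numeric_lt hi hl h3 hne
  rw [hdeg, show 2 ^ i * l + 1 - 3 = 2 ^ i * l - 2 by omega] at h1
  omega

end Factor

section Lines

variable {k : Type*} [Field k]

theorem tdeg_lines_le : tdeg ((xv + 1) * ((yv + 1) * (xv + yv)) : k[X][Y]) ≤ 3 := by
  have h1 : tdeg (1 : k[X][Y]) ≤ 1 := by simpa [cst] using tdeg_cst_le (1 : k) 1
  have := tdeg_mul_le (xv + 1 : k[X][Y]) ((yv + 1) * (xv + yv))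
  have := tdeg_mul_le (yv + 1 : k[X][Y]) (xv + yv)
  have := tdeg_add_le (tdeg_xv_le (k := k)) h1
  have := tdeg_add_le (tdeg_yv_le (k := k)) h1
  have := tdeg_add_le (tdeg_xv_le (k := k)) (tdeg_yv_le (k := k))
  omega

end Lines

section RationalPoint

variable {k : Type*} [Field k] [CharP k 2]

theorem derivative_quad {t : ℕ} (ht : Odd t) : Polynomial.derivative (quad k t) =
    yv ^ (t - 1) + (xv + yv + 1) ^ (t - 1) := by
  have h : ((t : ℕ) : k[X][Y]) = 1 := by
    obtain ⟨c, rfl⟩ := ht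
    push_cast
    linear_combination (c : k[X][Y]) * (CharTwo.two_eq_zero : (2 : k[X][Y]) = 0)
  simp [quad, Polynomial.derivative_pow, xv, yv]
  rw [h]
  simp

theorem exists_isPrimitiveRoot_of_odd [IsAlgClosed k] {l : ℕ} (hl : Odd l) :
    ∃ z : k, IsPrimitiveRoot z l := by
  have : NeZero (l : k) := ⟨by
    obtain ⟨c, rfl⟩ := hl
    push_cast
    rw [CharTwo.two_eq_zero, zero_mul, zero_add]
    exact one_ne_zero⟩
  exact HasEnoughRootsOfUnity.exists_primitiveRoot k l

theorem not_dvd_derivative_quad [IsAlgClosed k] {i l : ℕ} (hi : 1 ≤ i) (hl : Odd l) (h3 : 3 ≤ l)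
    {u : k[X][Y]} (hm : u.Monic) (hu : Irreducible u) (hdvd : u ∣ quad k (2 ^ i * l + 1)) :
    ¬ u ∣ Polynomial.derivative (quad k (2 ^ i * l + 1)) := by
  have two : (2 : k[X][Y]) = 0 := CharTwo.two_eq_zero
  have hx : ¬ u ∣ xv + 1 := fun h => by
    have h1 : (xv + 1 : k[X][Y]) = Polynomial.C (Polynomial.X + Polynomial.C 1) := by
      simp [xv]
    rw [h1] at h
    have h2 := Polynomial.natDegree_le_of_dvd h
      (Polynomial.C_ne_zero.2 (Polynomial.X_add_C_ne_zero 1))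
    rw [Polynomial.natDegree_C, Nat.le_zero] at h2
    exact hu.not_isUnit (hm.natDegree_eq_zero.1 h2 ▸ isUnit_one)
  have ht : Odd (2 ^ i * l + 1) := by
    have : Even (2 ^ i) := Nat.even_pow.2 ⟨even_two, by omega⟩
    exact (this.mul_right l).add_one
  intro h
  rw [derivative_quad ht, Nat.add_sub_cancel, mul_comm (2 ^ i) l, pow_mul, pow_mul,
    ← add_pow_char_pow] at h
  have h := hu.prime.dvd_of_dvd_pow h
  obtain ⟨z, hz⟩ := exists_isPrimitiveRoot_of_odd (k := k) hl
  have hzR : IsPrimitiveRoot (cst z : k[X][Y]) l :=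
    hz.map_of_injective (f := Polynomial.C.comp Polynomial.C)
      (Polynomial.C_injective.comp Polynomial.C_injective)
  have : NeZero l := ⟨by omega⟩
  rw [← CharTwo.sub_eq_add, hzR.pow_sub_pow_eq_prod_sub_mul _ _ (by omega),
    hu.prime.dvd_finsetProd_iff] at h
  obtain ⟨ζ, hζ, h⟩ := h
  rw [Polynomial.mem_nthRootsFinset (by omega)] at hζ
  obtain ⟨j, -, rfl⟩ := hzR.eq_pow_of_pow_eq_one hζ
  rw [← cst_pow] at h
  generalize z ^ j = c at h
  by_cases hc : c = 1
  · apply hx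
    have e : (xv + 1 : k[X][Y]) = -(yv - cst c * (xv + yv + 1)) := by
      rw [hc]; simp only [cst, map_one]; ring
    rw [e]; exact h.neg_right
  have hc1 : 1 + c ≠ 0 := fun h0 => hc (by rw [← CharTwo.add_eq_zero]; rw [add_comm]; exact h0)
  obtain ⟨b, hb⟩ : ∃ b, (1 + c) * b = c := ⟨(1 + c)⁻¹ * c, by field_simp⟩
  have e : (yv - cst c * (xv + yv + 1) : k[X][Y]) = cst (1 + c) * (xv * cst b + yv + cst b) := by
    have : (cst c : k[X][Y]) = (1 + cst c) * cst b := by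
      conv_lhs => rw [← hb]
      simp [cst]
    have h1 : (cst (1 + c) : k[X][Y]) = 1 + cst c := by simp [cst]
    rw [h1]
    linear_combination (xv + 1) * this - cst c * (xv + yv + 1) * two
  rw [e] at h
  have hunit : IsUnit (cst (1 + c) : k[X][Y]) :=
    (((isUnit_iff_ne_zero.2 hc1).map Polynomial.C).map Polynomial.C)
  have h := (hunit.dvd_mul_left).1 h
  have h := (hu.dvd_symm (prime_linear b b).irreducible h).trans hdvd
  obtain ⟨w, hw⟩ := h
  let φ : k[X][Y] →+* k[X] := Polynomial.eval₂RingHom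
    (Polynomial.eval₂RingHom Polynomial.C (1 + Polynomial.X)) (Polynomial.C b * Polynomial.X)
  have hφx : φ xv = 1 + Polynomial.X := by simp [φ, xv]
  have hφy : φ yv = Polynomial.C b * Polynomial.X := by simp [φ, yv]
  have hφc : ∀ a, φ (cst a) = Polynomial.C a := fun a => by simp [φ, cst]
  have hw := congrArg φ hw
  have two' : (2 : k[X]) = 0 := CharTwo.two_eq_zero
  have hl0 : φ (xv * cst b + yv + cst b) = 0 := by
    simp only [map_add, map_mul, hφx, hφy, hφc]
    linear_combination (Polynomial.C b * (1 + Polynomial.X)) * two'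
  have hs : (1 + Polynomial.X + Polynomial.C b * Polynomial.X + 1 : k[X]) =
      Polynomial.C (1 + b) * Polynomial.X := by
    simp only [map_add, map_one]
    linear_combination two'
  rw [map_mul, hl0, zero_mul, quad] at hw
  simp only [map_add, map_pow, map_one, hφx, hφy] at hw
  rw [hs, mul_pow, mul_pow, ← map_pow, ← map_pow] at hw
  have hw := congrArg (fun p => p.coeff 1) hw
  have hne : (1 : ℕ) ≠ 2 ^ i * l + 1 := by
    have : 0 < 2 ^ i * l := Nat.mul_pos (by positivity) (by omega)
    omega
  simp only [Polynomial.coeff_add, Polynomial.coeff_C_mul, Polynomial.coeff_X_pow, if_neg hne,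
    Polynomial.coeff_one_add_X_pow, Polynomial.coeff_one, Polynomial.coeff_zero] at hw
  obtain ⟨c', hc'⟩ := ht
  rw [hc'] at hw
  simp [CharTwo.two_eq_zero] at hw

theorem sig_eq_of_sig_one {u : k[X][Y]} (hu : sig k 1 u = u) (n : ℕ) : sig k n u = u := by
  refine Polynomial.ext fun j => Polynomial.ext fun i => ?_
  have h := coeff_sig 1 u i j
  rw [hu, pow_one] at h
  rw [coeff_sig]
  induction n with
  | zero => simp
  | succ n ih => rw [pow_succ, pow_mul, ih, ← h]

theorem exists_rational_point_of_natDegree_le (d E : ℕ) : ∃ N, ∀ (k : Type) [Field k]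
    [IsAlgClosed k] [CharP k 2] (n : ℕ), N ≤ n → ∀ h g : k[X][Y], Good h → Irreducible h →
      Polynomial.derivative h ≠ 0 → h.natDegree ≤ d → sig k n h = h → ¬ h ∣ g → tdeg g ≤ E →
        ∃ x y, x ^ 2 ^ n = x ∧ y ^ 2 ^ n = y ∧ ev (x, y) h = 0 ∧ ev (x, y) g ≠ 0 := by
  choose N hN using fun d => exists_rational_point d E
  refine ⟨(Finset.range (d + 1)).sup N, fun k _ _ _ n hn h g h1 h2 h3 h4 => ?_⟩
  exact hN _ k n ((Finset.le_sup (Finset.mem_range.2 (Nat.lt_succ_of_le h4))).trans hn) h g h1 h2 h3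
    rfl

theorem exists_rational_zero_quad {i l : ℕ} (hi : 1 ≤ i) (hl : Odd l) (h3 : 3 ≤ l)
    (hne : l ≠ 2 ^ i - 1) : ∃ N, ∀ (k : Type) [Field k] [IsAlgClosed k] [CharP k 2] (n : ℕ),
      N ≤ n → ∃ x y : k, x ^ 2 ^ n = x ∧ y ^ 2 ^ n = y ∧ x ≠ 1 ∧ y ≠ 1 ∧ x ≠ y ∧
        ev (x, y) (quad k (2 ^ i * l + 1)) = 0 ∧
        ev (x, y) (Polynomial.derivative (quad k (2 ^ i * l + 1))) ≠ 0 := by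
  have h2 : 2 ≤ 2 ^ i := by
    have := Nat.pow_le_pow_right (n := 2) (by norm_num) hi; omega
  have ht : Odd (2 ^ i * l + 1) := by
    have : Even (2 ^ i) := Nat.even_pow.2 ⟨even_two, by omega⟩
    exact (this.mul_right l).add_one
  have ht3 : 3 ≤ 2 ^ i * l + 1 := by nlinarith
  obtain ⟨N, hN⟩ := exists_rational_point_of_natDegree_le (2 ^ i * l) (3 + 2 ^ i * l)
  refine ⟨N, fun k _ _ _ n hn => ?_⟩
  obtain ⟨g, hg, hgd, hgq⟩ := exists_quad_eq (k := k) ht ht3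
  obtain ⟨u, hum, hu, hug, hsig⟩ := exists_sig_fixed_factor hi hl h3 hne hg hgd hgq
  have huq : u ∣ quad k (2 ^ i * l + 1) := by
    rw [hgq]
    exact ((hug.mul_left _).mul_left _).mul_left _
  have hder := not_dvd_derivative_quad hi hl h3 hum hu huq
  have hlines : ¬ u ∣ (xv + 1) * ((yv + 1) * (xv + yv)) := fun h => by
    obtain ⟨v, hv⟩ := h
    obtain ⟨w, hw⟩ := hug
    have : quad k (2 ^ i * l + 1) = u * (u * (v * w)) := by
      rw [hgq, hw]
      linear_combination u * w * hv
    apply hder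
    rw [this, Polynomial.derivative_mul, Polynomial.derivative_mul]
    exact dvd_add ((dvd_mul_right u _).mul_left _) (dvd_mul_right u _)
  have hud : Polynomial.derivative u ≠ 0 := fun h => by
    obtain ⟨w, hw⟩ := huq
    apply hder
    rw [hw, Polynomial.derivative_mul, h, zero_mul, zero_add]
    exact dvd_mul_right u _
  have hud' : u.natDegree ≤ 2 ^ i * l := by
    have := Polynomial.natDegree_le_of_dvd hug hg.monic.ne_zero
    omega
  obtain ⟨x, y, hx, hy, h0, hne⟩ := hN k n hn u
    ((xv + 1) * ((yv + 1) * (xv + yv)) * Polynomial.derivative (quad k (2 ^ i * l + 1)))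
    (hg.of_dvd hum hug) hu hud hud' (sig_eq_of_sig_one hsig n)
    (fun h => (hu.prime.dvd_or_dvd h).elim hlines hder) (by
      refine (tdeg_mul_le _ _).trans (add_le_add tdeg_lines_le ?_)
      have h1 : tdeg (1 : k[X][Y]) ≤ 1 := by simpa [cst] using tdeg_cst_le (1 : k) 1
      rw [derivative_quad ht, Nat.add_sub_cancel]
      refine tdeg_add_le ((tdeg_pow_le _ _).trans ?_) ((tdeg_pow_le _ _).trans ?_)
      · exact (Nat.mul_le_mul_left _ tdeg_yv_le).trans (by omega)
      · exact (Nat.mul_le_mul_left _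
          (tdeg_add_le (tdeg_add_le tdeg_xv_le tdeg_yv_le) h1)).trans (by omega))
  rw [map_mul, map_mul, map_mul, map_add, map_add, map_add, map_one, ev_xv, ev_yv] at hne
  refine ⟨x, y, hx, hy, ?_, ?_, ?_, ?_, right_ne_zero_of_mul hne⟩
  · rintro rfl
    exact hne (by simp only [CharTwo.add_self_eq_zero, zero_mul])
  · rintro rfl
    exact hne (by simp only [CharTwo.add_self_eq_zero, zero_mul, mul_zero])
  · rintro rfl
    exact hne (by simp only [CharTwo.add_self_eq_zero, zero_mul, mul_zero])
  · obtain ⟨w, hw⟩ := huq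
    rw [hw, map_mul, h0, zero_mul]

end RationalPoint

section Cone

variable {k : Type*} [Field k]

/-- `x ^ j + yv ^ j + 1 + (x + yv + 1) ^ j` in the variable `yv`, written so that its degree is
visible. -/
noncomputable def slice (x : k) (j : ℕ) : k[X][Y] :=
  cst (x ^ j + 1) + cst (x + 1) *
    ∑ i ∈ Finset.range j, yv ^ i * (yv + cst (x + 1)) ^ (j - 1 - i)

/-- The surface attached to the polynomial with coefficients `c`, cut along the cone over a line
through the point at infinity with first coordinate `x`. -/
noncomputable def cone (c : ℕ → k) (x : k) (d : ℕ) : k[X][Y] :=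
  ∑ j ∈ Finset.range (d + 1), Polynomial.C (Polynomial.C (c j) * Polynomial.X ^ (d - j)) * slice x j

theorem tdeg_slice_le (x : k) (j : ℕ) : tdeg (slice x j) ≤ j - 1 := by
  refine tdeg_add_le (tdeg_cst_le _ _) ((tdeg_mul_le _ _).trans ?_)
  refine (add_le_add (tdeg_cst_le _ 0) (tdeg_sum_le _ _ (n := j - 1)
    fun i hi => (tdeg_mul_le _ _).trans ?_)).trans_eq (Nat.zero_add _)
  have h1 := Nat.mul_le_mul_left i (tdeg_yv_le (k := k))
  have h2 := Nat.mul_le_mul_left (j - 1 - i)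
    (tdeg_add_le (tdeg_yv_le (k := k)) (tdeg_cst_le (x + 1) 1))
  have h3 := tdeg_pow_le (yv : k[X][Y]) i
  have h4 := tdeg_pow_le (yv + cst (x + 1) : k[X][Y]) (j - 1 - i)
  have := Finset.mem_range.1 hi
  omega

theorem coeff_slice (x : k) {d : ℕ} (hd : 2 ≤ d) :
    (slice x d).coeff (d - 1) = Polynomial.C ((x + 1) * d) := by
  have hm : (yv + cst (x + 1) : k[X][Y]).Monic ∧ (yv + cst (x + 1) : k[X][Y]).natDegree = 1 := by
    simpa [cst] using monic_linear (0 : k) (x + 1)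
  have : ∀ i ∈ Finset.range d,
      (yv ^ i * (yv + cst (x + 1)) ^ (d - 1 - i) : k[X][Y]).coeff (d - 1) = 1 := by
    intro i hi
    have hi := Finset.mem_range.1 hi
    have h1 := (Polynomial.monic_X_pow (R := k[X]) i).mul (hm.1.pow (d - 1 - i))
    have h2 := (Polynomial.monic_X_pow (R := k[X]) i).natDegree_mul (hm.1.pow (d - 1 - i))
    rw [Polynomial.natDegree_X_pow, hm.1.natDegree_pow, hm.2, mul_one,
      show i + (d - 1 - i) = d - 1 by omega] at h2
    have h3 := h1.coeff_natDegree
    rwa [h2] at h3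
  rw [slice, Polynomial.coeff_add, cst, cst, Polynomial.coeff_C, if_neg (by omega), zero_add,
    Polynomial.coeff_C_mul, Polynomial.finsetSum_coeff, Finset.sum_congr rfl this]
  simp

variable [CharP k 2]

theorem slice_eq (x : k) (j : ℕ) :
    slice x j = cst x ^ j + yv ^ j + 1 + (yv + cst (x + 1)) ^ j := by
  have two : (2 : k[X][Y]) = 0 := CharTwo.two_eq_zero
  have h := geom_sum₂_mul (yv : k[X][Y]) (yv + cst (x + 1)) j
  have h1 : (cst (x ^ j + 1) : k[X][Y]) = cst x ^ j + 1 := by simp [cst]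
  rw [slice, h1]
  generalize (cst (x + 1) : k[X][Y]) = b at h ⊢
  linear_combination -h - yv ^ j * two

theorem good_cone (c : ℕ → k) (x : k) {d : ℕ} (hd : Odd d) (h3 : 3 ≤ d) (hc : c d * (x + 1) = 1) :
    Good (cone c x d) ∧ (cone c x d).natDegree = d - 1 := by
  have ht : tdeg (cone c x d) ≤ d - 1 := by
    refine tdeg_sum_le _ _ fun j hj => ?_
    have hj := Finset.mem_range.1 hj
    rcases Nat.eq_zero_or_pos j with rfl | hj0
    · rw [show slice x 0 = 0 by simp [slice, CharTwo.add_self_eq_zero], mul_zero]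
      simp [tdeg]
    · refine (tdeg_mul_le _ _).trans ?_
      have h1 := tdeg_slice_le x j
      have h2 : tdeg (Polynomial.C (Polynomial.C (c j) * Polynomial.X ^ (d - j)) : k[X][Y]) ≤
          d - j := by
        rw [Polynomial.C_mul, Polynomial.C_pow]
        refine (tdeg_mul_le _ _).trans ?_
        have h4 := tdeg_cst_le (c j) 0
        have h5 := (tdeg_pow_le (xv : k[X][Y]) (d - j)).trans (Nat.mul_le_mul_left _ tdeg_xv_le)
        rw [cst] at h4
        rw [xv] at h5
        omega
      omega
  have hco : (cone c x d).coeff (d - 1) = 1 := by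
    rw [cone, Polynomial.finsetSum_coeff, Finset.sum_range_succ, Finset.sum_eq_zero, zero_add,
      Polynomial.coeff_C_mul, coeff_slice x (by omega)]
    · have : (d : k) = 1 := by
        obtain ⟨e, rfl⟩ := hd
        push_cast
        rw [CharTwo.two_eq_zero, zero_mul, zero_add]
      rw [this, Nat.sub_self, pow_zero, mul_one, mul_one, ← Polynomial.C_mul, hc, Polynomial.C_1]
    · intro j hj
      have hj := Finset.mem_range.1 hj
      have h1 := tdeg_slice_le x j
      have h2 := natDegree_le_tdeg (slice x j)
      rcases Nat.eq_zero_or_pos j with rfl | hj0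
      · rw [show slice x 0 = 0 by simp [slice, CharTwo.add_self_eq_zero], mul_zero,
          Polynomial.coeff_zero]
      · rw [Polynomial.coeff_C_mul, Polynomial.coeff_eq_zero_of_natDegree_lt (by omega), mul_zero]
  have hn := (natDegree_le_tdeg _).trans ht
  have hn' : (cone c x d).natDegree = d - 1 :=
    le_antisymm hn (Polynomial.le_natDegree_of_ne_zero (by rw [hco]; exact one_ne_zero))
  exact ⟨⟨Polynomial.monic_of_natDegree_le_of_coeff_eq_one _ hn hco, hn' ▸ ht⟩, hn'⟩

theorem ev_cone (c : ℕ → k) (x s y : k) (d : ℕ) : ev (s, y) (cone c x d) =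
    ∑ j ∈ Finset.range (d + 1), c j * s ^ (d - j) * (x ^ j + y ^ j + 1 + (y + (x + 1)) ^ j) := by
  rw [cone, map_sum]
  refine Finset.sum_congr rfl fun j _ => ?_
  rw [map_mul, ev_C, slice_eq]
  simp only [map_add, map_pow, map_one, ev_cst, ev_yv, Polynomial.eval_mul, Polynomial.eval_C,
    Polynomial.eval_pow, Polynomial.eval_X]

theorem ev_cone_zero (c : ℕ → k) (x y : k) (d : ℕ) : ev (0, y) (cone c x d) =
    c d * ev (x, y) (quad k d) := by
  rw [ev_cone, Finset.sum_range_succ, Finset.sum_eq_zero, quad]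
  · simp only [map_add, map_pow, map_one, ev_xv, ev_yv, Nat.sub_self, pow_zero]
    ring
  · intro j hj
    have hj := Finset.mem_range.1 hj
    rw [zero_pow (by omega), mul_zero, zero_mul]

theorem ev_derivative_cone_zero (c : ℕ → k) (x y : k) {d : ℕ} (hd : Odd d) :
    ev (0, y) (Polynomial.derivative (cone c x d)) =
      c d * ev (x, y) (Polynomial.derivative (quad k d)) := by
  have hd1 : (d : k[X][Y]) = 1 := by
    obtain ⟨e, rfl⟩ := hd
    push_cast
    rw [CharTwo.two_eq_zero, zero_mul, zero_add]
  have hs : Polynomial.derivative (slice x d) = yv ^ (d - 1) + (yv + cst (x + 1)) ^ (d - 1) := by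
    rw [slice_eq]
    simp [Polynomial.derivative_pow, cst, yv]
    rw [hd1]
    simp
  rw [cone, map_sum, map_sum, Finset.sum_range_succ, Finset.sum_eq_zero, zero_add,
    Polynomial.derivative_C_mul, map_mul, ev_C, hs, derivative_quad hd]
  · simp only [map_add, map_pow, map_one, ev_xv, ev_yv, ev_cst, Nat.sub_self, pow_zero, mul_one,
      Polynomial.eval_C]
    ring
  · intro j hj
    have hj := Finset.mem_range.1 hj
    rw [Polynomial.derivative_C_mul, map_mul, ev_C, Polynomial.eval_mul, Polynomial.eval_pow,
      Polynomial.eval_X, zero_pow (by omega), mul_zero, zero_mul]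

theorem sig_cone {c : ℕ → k} {x : k} {n : ℕ} (hc : ∀ j, c j ^ 2 ^ n = c j) (hx : x ^ 2 ^ n = x)
    (d : ℕ) : sig k n (cone c x d) = cone c x d := by
  have hcst : ∀ a, sig k n (cst a) = cst (a ^ 2 ^ n) := fun a => by
    simp [sig, cst, iterateFrobenius_def]
  have h1 : (x + 1) ^ 2 ^ n = x + 1 := by rw [add_pow_char_pow, hx, one_pow]
  rw [cone, map_sum]
  refine Finset.sum_congr rfl fun j _ => ?_
  have h2 : (Polynomial.C (Polynomial.C (c j) * Polynomial.X ^ (d - j)) : k[X][Y]) =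
      cst (c j) * xv ^ (d - j) := by simp [cst, xv]
  rw [map_mul, slice_eq, h2]
  simp only [map_add, map_mul, map_pow, map_one, hcst, sig_xv, sig_yv, hc, hx, h1]

end Cone

section Branch

variable {k : Type*} [Field k] [CharP k 2] [IsAlgClosed k]

/-- A curve fixed by Frobenius has a component fixed by Frobenius through each fixed smooth
point. -/
theorem Good.exists_component {F : k[X][Y]} (hF : Good F) {n : ℕ} (hsig : sig k n F = F) {x y : k}
    (hx : x ^ 2 ^ n = x) (hy : y ^ 2 ^ n = y) (h0 : ev (x, y) F = 0)
    (h1 : ev (x, y) (Polynomial.derivative F) ≠ 0) :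
    ∃ h, Good h ∧ Irreducible h ∧ h ∣ F ∧ sig k n h = h ∧ Polynomial.derivative h ≠ 0 ∧
      ev (x, y) h = 0 := by
  obtain ⟨s, hs, hsF⟩ := exists_multiset_prod_of_monic F hF.monic
  have : (s.map fun u => ev (x, y) u).prod = 0 := by
    rw [← h0, ← hsF, map_multiset_prod]
  rw [Multiset.prod_eq_zero_iff, Multiset.mem_map] at this
  obtain ⟨h, hhs, hh0⟩ := this
  obtain ⟨hm, hirr⟩ := hs h hhs
  have hdvd : h ∣ F := hsF ▸ Multiset.dvd_prod hhs
  obtain ⟨v, rfl⟩ := hdvd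
  rw [Polynomial.derivative_mul, map_add, map_mul, map_mul, hh0, zero_mul, add_zero] at h1
  refine ⟨h, hF.of_dvd hm (dvd_mul_right _ _), hirr, dvd_mul_right _ _, ?_, ?_, hh0⟩
  · by_contra hne
    have h2 : sig k n h ∣ h * v := hsig ▸ map_dvd (sig k n) (dvd_mul_right h v)
    have h3 : ev (x, y) (sig k n h) = 0 := by
      have := ev_sig n x y h
      rwa [hx, hy, hh0, zero_pow (by positivity)] at this
    rcases (irreducible_sig hirr n).prime.dvd_or_dvd h2 with h4 | h4
    · exact hne (Polynomial.eq_of_monic_of_associated (monic_sig hm n) hm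
        ((irreducible_sig hirr n).associated_of_dvd hirr h4))
    · obtain ⟨w, rfl⟩ := h4
      rw [map_mul, h3, zero_mul, mul_zero] at h1
      exact h1 rfl
  · intro h2
    rw [h2, map_zero, zero_mul] at h1
    exact h1 rfl

end Branch

section Collision

theorem exists_collision {i l : ℕ} (hi : 1 ≤ i) (hl : Odd l) (h3 : 3 ≤ l) (hne : l ≠ 2 ^ i - 1) :
    ∃ N, ∀ (k : Type) [Field k] [IsAlgClosed k] [CharP k 2] (n : ℕ), N ≤ n → ∀ f : k[X],
      f.natDegree = 2 ^ i * l + 1 → (∀ j, f.coeff j ^ 2 ^ n = f.coeff j) →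
      ∃ p q r : k, p ^ 2 ^ n = p ∧ q ^ 2 ^ n = q ∧ r ^ 2 ^ n = r ∧ p ≠ q ∧ p ≠ r ∧ q ≠ r ∧
        f.eval p + f.eval q + f.eval r + f.eval (p + q + r) = 0 := by
  have h2 : 2 ≤ 2 ^ i := by
    have := Nat.pow_le_pow_right (n := 2) (by norm_num) hi; omega
  have hd : Odd (2 ^ i * l + 1) := by
    have : Even (2 ^ i) := Nat.even_pow.2 ⟨even_two, by omega⟩
    exact (this.mul_right l).add_one
  have hd3 : 3 ≤ 2 ^ i * l + 1 := by nlinarith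
  obtain ⟨N₁, hN₁⟩ := exists_rational_zero_quad hi hl h3 hne
  obtain ⟨d, hd'⟩ : ∃ d, d = 2 ^ i * l + 1 := ⟨_, rfl⟩
  rw [← hd'] at hd hd3 hN₁ ⊢
  obtain ⟨N₂, hN₂⟩ := exists_rational_point_of_natDegree_le (d - 1) 3
  refine ⟨max N₁ N₂, fun k _ _ _ n hn f hfd hf => ?_⟩
  obtain ⟨x, y, hx, hy, hx1, hy1, hxy, h0, h1⟩ := hN₁ k n (le_of_max_le_left hn)
  have hx1' : x + 1 ≠ 0 := fun h => hx1 (CharTwo.add_eq_zero.1 h)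
  have hlead : f.coeff d ≠ 0 := by
    rw [← hfd, Polynomial.coeff_natDegree, Polynomial.leadingCoeff_ne_zero]
    rintro rfl
    rw [Polynomial.natDegree_zero] at hfd
    omega
  obtain ⟨e, he⟩ : ∃ e, e = (f.coeff d * (x + 1))⁻¹ := ⟨_, rfl⟩
  have he1 : e * f.coeff d * (x + 1) = 1 := by
    rw [he]; field_simp
  have he0 : e ≠ 0 := left_ne_zero_of_mul (left_ne_zero_of_mul (he1 ▸ one_ne_zero))
  have hec : e * f.coeff d ≠ 0 := mul_ne_zero he0 hlead
  have hesig : e ^ 2 ^ n = e := by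
    rw [he, inv_pow, mul_pow, hf, add_pow_char_pow, hx, one_pow]
  obtain ⟨c, hc⟩ : ∃ c : ℕ → k, c = fun j => e * f.coeff j := ⟨_, rfl⟩
  obtain ⟨hgood, hdeg⟩ := good_cone c x hd hd3 (by rw [hc]; exact he1)
  obtain ⟨h, hh, hirr, hdvd, hsig, hder, hev⟩ := hgood.exists_component (n := n) (x := 0) (y := y)
    (sig_cone (fun j => by rw [hc, mul_pow, hesig, hf]) hx d) (zero_pow (by positivity)) hy
    (by rw [ev_cone_zero, h0, mul_zero])
    (by rw [ev_derivative_cone_zero _ _ _ hd]; exact mul_ne_zero (by rw [hc]; exact hec) h1)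
  obtain ⟨s, z, hs, hz, hsz, hne0⟩ := hN₂ k n (le_of_max_le_right hn) h
    (xv * ((yv + 1) * (yv + cst x))) hh hirr hder
    (hdeg ▸ Polynomial.natDegree_le_of_dvd hdvd hgood.monic.ne_zero) hsig (by
      intro hd
      rcases hirr.prime.dvd_or_dvd hd with hd | hd
      · have h2 := Polynomial.natDegree_le_of_dvd hd (Polynomial.C_ne_zero.2 Polynomial.X_ne_zero)
        rw [Polynomial.natDegree_C, Nat.le_zero] at h2
        exact hirr.not_isUnit (hh.monic.natDegree_eq_zero.1 h2 ▸ isUnit_one)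
      · obtain ⟨w, hw⟩ := hd
        have := congrArg (ev (0, y)) hw
        rw [map_mul, map_mul, hev, zero_mul, map_add, map_add, ev_yv, ev_cst, map_one,
          mul_eq_zero, CharTwo.add_eq_zero, CharTwo.add_eq_zero] at this
        exact this.elim hy1 fun h => hxy h.symm) (by
      have := tdeg_add_le (tdeg_yv_le (k := k)) (tdeg_cst_le 1 1)
      have e1 : (cst 1 : k[X][Y]) = 1 := by simp [cst]
      rw [e1] at this
      have := tdeg_add_le (tdeg_yv_le (k := k)) (tdeg_cst_le x 1)
      have := tdeg_xv_le (k := k)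
      have := tdeg_mul_le (yv + 1 : k[X][Y]) (yv + cst x)
      have := tdeg_mul_le (xv : k[X][Y]) ((yv + 1) * (yv + cst x))
      omega)
  rw [map_mul, map_mul, map_add, map_add, map_one, ev_xv, ev_yv, ev_cst] at hne0
  have hs0 : s ≠ 0 := left_ne_zero_of_mul hne0
  have hz1 : z ≠ 1 := fun h => left_ne_zero_of_mul (right_ne_zero_of_mul hne0)
    (CharTwo.add_eq_zero.2 h)
  have hzx : z ≠ x := fun h => right_ne_zero_of_mul (right_ne_zero_of_mul hne0)
    (CharTwo.add_eq_zero.2 h)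
  have hsum : ev (s, z) (cone c x d) = 0 := by
    obtain ⟨w, hw⟩ := hdvd
    rw [hw, map_mul, hsz, zero_mul]
  have hi0 : s⁻¹ ≠ 0 := inv_ne_zero hs0
  refine ⟨s⁻¹ * x, s⁻¹ * z, s⁻¹, by rw [mul_pow, inv_pow, hs, hx], by rw [mul_pow, inv_pow, hs, hz],
    by rw [inv_pow, hs], fun h => hzx (mul_left_cancel₀ hi0 h).symm,
    fun h => hx1 (mul_left_cancel₀ hi0 (h.trans (mul_one _).symm)),
    fun h => hz1 (mul_left_cancel₀ hi0 (h.trans (mul_one _).symm)), ?_⟩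
  rw [ev_cone] at hsum
  have key : s ^ d * e * (f.eval (s⁻¹ * x) + f.eval (s⁻¹ * z) + f.eval s⁻¹ +
      f.eval (s⁻¹ * x + s⁻¹ * z + s⁻¹)) = 0 := by
    rw [← hsum]
    simp only [Polynomial.eval_eq_sum_range, hfd, ← Finset.sum_add_distrib, Finset.mul_sum]
    refine Finset.sum_congr rfl fun j hj => ?_
    have hj := Finset.mem_range.1 hj
    rw [show s⁻¹ * x + s⁻¹ * z + s⁻¹ = s⁻¹ * (z + (x + 1)) by ring, hc]
    have : s ^ d * s⁻¹ ^ j = s ^ (d - j) := by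
      rw [inv_pow, pow_sub₀ _ hs0 (by omega)]
    rw [← this, mul_pow, mul_pow, mul_pow]
    ring
  exact (mul_eq_zero.1 key).resolve_left (mul_ne_zero (pow_ne_zero _ hs0) he0)

end Collision

section Assembly

theorem not_isAPN_of_collision {M : Type} [Field M] [Fintype M] [CharP M 2] {g : M → M} {p q r : M}
    (hpq : p ≠ q) (hpr : p ≠ r) (hqr : q ≠ r) (h : g p + g q + g r + g (p + q + r) = 0) :
    ¬ IsAPN g := by
  intro hg
  have two : (2 : M) = 0 := CharTwo.two_eq_zero
  have h1 := hg (p + q) (g p + g q) fun h => hpq (CharTwo.add_eq_zero.1 h)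
  have h2 : ({p, q, r} : Set M) ⊆ {x | g (x + (p + q)) + g x = g p + g q} := by
    rintro x (rfl | rfl | rfl)
    · change g (x + (x + q)) + g x = _
      rw [show x + (x + q) = q by linear_combination x * two, add_comm]
    · change g (x + (p + x)) + g x = _
      rw [show x + (p + x) = p by linear_combination x * two]
    · change g (x + (p + q)) + g x = _
      rw [add_comm x]
      linear_combination h - (g p + g q) * two
  have h3 := Set.ncard_le_ncard h2 (Set.toFinite _)
  rw [Set.ncard_eq_three.2 ⟨p, q, r, hpq, hpr, hqr, rfl⟩] at h3
  omega

theorem exists_algebraMap_eq_of_pow_card {M K : Type*} [Field M] [Fintype M] [Field K] [Algebra M K]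
    {x : K} (hx : x ^ Fintype.card M = x) : ∃ a : M, algebraMap M K a = x := by
  classical
  have h0 := FiniteField.X_pow_card_sub_X_ne_zero K (Fintype.one_lt_card (α := M))
  have hmem : ∀ y : K, y ∈ (Polynomial.X ^ Fintype.card M - Polynomial.X : K[X]).roots.toFinset ↔
      y ^ Fintype.card M = y := fun y => by
    rw [Multiset.mem_toFinset, Polynomial.mem_roots h0, Polynomial.IsRoot.def, Polynomial.eval_sub,
      Polynomial.eval_pow, Polynomial.eval_X, sub_eq_zero]
  have hsub : Finset.univ.image (algebraMap M K) ⊆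
      (Polynomial.X ^ Fintype.card M - Polynomial.X : K[X]).roots.toFinset := by
    intro y hy
    obtain ⟨a, -, rfl⟩ := Finset.mem_image.1 hy
    rw [hmem, ← map_pow, FiniteField.pow_card]
  have heq := Finset.eq_of_subset_of_card_le hsub (by
    rw [Finset.card_image_of_injective _ (algebraMap M K).injective, Finset.card_univ]
    refine (Multiset.toFinset_card_le _).trans ((Polynomial.card_roots' _).trans ?_)
    rw [FiniteField.X_pow_card_sub_X_natDegree_eq K Fintype.one_lt_card])
  have := (hmem x).2 hx
  rw [← heq] at this
  obtain ⟨a, -, ha⟩ := Finset.mem_image.1 this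
  exact ⟨a, ha⟩

theorem exists_not_isAPN {i l : ℕ} (hi : 1 ≤ i) (hl : Odd l) (h3 : 3 ≤ l) (hne : l ≠ 2 ^ i - 1) :
    ∃ N, ∀ (M : Type) [Field M] [Fintype M] [CharP M 2] (n : ℕ), N ≤ n → Fintype.card M = 2 ^ n →
      ∀ f : M[X], f.natDegree = 2 ^ i * l + 1 → ¬ IsAPN (fun x => f.eval x) := by
  obtain ⟨N, hN⟩ := exists_collision hi hl h3 hne
  refine ⟨N, fun M _ _ _ n hn hM f hf => ?_⟩
  have hinj := (algebraMap M (AlgebraicClosure M)).injective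
  have : CharP (AlgebraicClosure M) 2 := charP_of_injective_ringHom hinj 2
  obtain ⟨p, q, r, hp, hq, hr, hpq, hpr, hqr, h⟩ := hN (AlgebraicClosure M) n hn
    (f.map (algebraMap M (AlgebraicClosure M))) (by rw [Polynomial.natDegree_map, hf]) fun j => by
      rw [Polynomial.coeff_map, ← map_pow, ← hM, FiniteField.pow_card]
  rw [← hM] at hp hq hr
  obtain ⟨p, rfl⟩ := exists_algebraMap_eq_of_pow_card hp
  obtain ⟨q, rfl⟩ := exists_algebraMap_eq_of_pow_card hq
  obtain ⟨r, rfl⟩ := exists_algebraMap_eq_of_pow_card hr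
  refine not_isAPN_of_collision (ne_of_apply_ne _ hpq) (ne_of_apply_ne _ hpr)
    (ne_of_apply_ne _ hqr) (hinj ?_)
  rw [← map_add, ← map_add] at h
  simp only [Polynomial.eval_map_apply] at h
  simp only [map_add, map_zero]
  exact h

theorem not_isAPN_of_natDegree_eq_one {M : Type} [Field M] [Fintype M] [CharP M 2]
    (hM : 2 < Fintype.card M) {f : M[X]} (hf : f.natDegree = 1) :
    ¬ IsAPN (fun x => f.eval x) := by
  obtain ⟨p, q, r, hpq, hpr, hqr⟩ := Fintype.two_lt_card_iff.1 hM
  obtain ⟨a, -, b, rfl⟩ := Polynomial.natDegree_eq_one.1 hf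
  refine not_isAPN_of_collision hpq hpr hqr ?_
  simp only [Polynomial.eval_add, Polynomial.eval_mul, Polynomial.eval_C, Polynomial.eval_X]
  linear_combination (a * (p + q + r) + 2 * b) * (CharTwo.two_eq_zero : (2 : M) = 0)

theorem exists_eq_two_pow_mul_add_one {d : ℕ} (hd : Odd d) (h1 : d ≠ 1)
    (hgold : ¬ ∃ k : ℕ, 0 < k ∧ d = 2 ^ k + 1)
    (hkw : ¬ ∃ k : ℕ, 0 < k ∧ d = 2 ^ (2 * k) - 2 ^ k + 1) :
    ∃ i l, 1 ≤ i ∧ Odd l ∧ 3 ≤ l ∧ l ≠ 2 ^ i - 1 ∧ d = 2 ^ i * l + 1 := by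
  obtain ⟨c, hc⟩ := hd
  obtain ⟨i, l, hl, h⟩ := Nat.exists_eq_two_pow_mul_odd (show d - 1 ≠ 0 by omega)
  have hi : i ≠ 0 := by
    rintro rfl
    obtain ⟨e, he⟩ := hl
    omega
  have hd' : d = 2 ^ i * l + 1 := by omega
  refine ⟨i, l, by omega, hl, ?_, ?_, hd'⟩
  · by_contra hlt
    obtain ⟨e, he⟩ := hl
    obtain rfl : l = 1 := by omega
    exact hgold ⟨i, by omega, by rw [hd', mul_one]⟩
  · rintro rfl
    exact hkw ⟨i, by omega, by rw [hd', Nat.mul_sub, mul_one, two_mul, pow_add]⟩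

theorem exists_extension {L : Type} [Field L] [Fintype L] [CharP L 2] {m : ℕ} (hm : m ≠ 0) :
    ∃ (M : Type) (_ : Field M) (_ : Fintype M) (_ : L →+* M),
      Fintype.card M = Fintype.card L ^ m := by
  have : NeZero m := ⟨hm⟩
  have hfin := Fintype.ofFinite (FiniteField.Extension L 2 m)
  refine ⟨FiniteField.Extension L 2 m, inferInstance, hfin, algebraMap _ _, ?_⟩
  rw [Fintype.card_eq_nat_card, Fintype.card_eq_nat_card, FiniteField.natCard_extension]

theorem notAPNOnAllLargeExtensions {n : ℕ} (hn : 0 < n) {L : Type} [Field L] [Fintype L]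
    [CharP L 2] (hcard : Fintype.card L = 2 ^ n) (f : L[X])
    (hodd : Odd f.natDegree)
    (hgold : ¬ ∃ k : ℕ, 0 < k ∧ f.natDegree = 2 ^ k + 1)
    (hkw : ¬ ∃ k : ℕ, 0 < k ∧ f.natDegree = 2 ^ (2 * k) - 2 ^ k + 1) :
    NotAPNOnAllLargeExtensions f := by
  by_cases h1 : f.natDegree = 1
  · refine ⟨2, fun m hm M _ _ e hM => ?_⟩
    have : CharP M 2 := charP_of_injective_ringHom e.injective 2
    refine not_isAPN_of_natDegree_eq_one ?_ (by rw [Polynomial.natDegree_map, h1])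
    rw [hM, hcard, ← pow_mul]
    calc 2 < 2 ^ 2 := by norm_num
      _ ≤ 2 ^ (n * m) := Nat.pow_le_pow_right two_pos (hm.trans (Nat.le_mul_of_pos_left m hn))
  · obtain ⟨i, l, hi, hl, h3, hne, hd⟩ := exists_eq_two_pow_mul_add_one hodd h1 hgold hkw
    obtain ⟨N, hN⟩ := exists_not_isAPN hi hl h3 hne
    refine ⟨N, fun m hm M _ _ e hM => ?_⟩
    have : CharP M 2 := charP_of_injective_ringHom e.injective 2
    exact hN M (n * m) (hm.trans (Nat.le_mul_of_pos_left m hn)) (by rw [hM, hcard, ← pow_mul]) _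
      (by rw [Polynomial.natDegree_map, hd])

end Assembly

end PlaneCurve

/-- Let `L = F_q`, `q = 2^n`, and `f ∈ L[x]` of odd degree `d` which is
neither a Gold number `2^k + 1` nor a Kasami-Welch number `2^{2k} - 2^k + 1`. Then
there is `N` such that for all `m ≥ N` the function induced by `f` on `F_{q^m}` is
not APN; in particular, `f` is not exceptional APN. -/
theorem not_exceptional_of_odd_degree_not_gold_kasami {n : ℕ} (hn : 0 < n) (L : Type)
    [Field L] [Fintype L] (hcard : Fintype.card L = 2 ^ n) (f : Polynomial L)
    (hodd : Odd f.natDegree)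
    (hgold : ¬ ∃ k : ℕ, 0 < k ∧ f.natDegree = 2 ^ k + 1)
    (hkw : ¬ ∃ k : ℕ, 0 < k ∧ f.natDegree = 2 ^ (2 * k) - 2 ^ k + 1) :
    NotAPNOnAllLargeExtensions f ∧ ¬ IsExceptionalAPN f := by
  have : CharP L 2 := charP_of_card_eq_prime_pow hcard
  have h := PlaneCurve.notAPNOnAllLargeExtensions hn hcard f hodd hgold hkw
  refine ⟨h, fun hex => ?_⟩
  obtain ⟨N, hN⟩ := h
  obtain ⟨m, hm, hNm⟩ := hex.2.exists_gt N
  obtain ⟨M, _, _, e, hM⟩ := PlaneCurve.exists_extension (L := L) (show m ≠ 0 by omega)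
  exact hN m hNm.le M e hM (hm M e hM)
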